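/- arXiv:2212.10302 — 2 statements merged into one kernel-verified Lean document; each statement's English description precedes it below -/
import Mathlib

section
/- Under the hypotheses of the previous comparison (two C¹ solutions on [0,T] × ℝ of the damped wave system with parameters ξ₁ ≥ ξ₂ ≥ 0, same data, and a uniform bound M ≥ sup_{t∈[0,T]} ∫_ℝ τ₂(t,y)² dy < ∞), one has for all t ∈ [0,T]: ∫_ℝ ( G(u₁−u₂)² + (τ₁−τ₂)² )(t,y) dy ≤ (ξ₁ − ξ₂) · M · t. In particular (u₁,τ₁) → (u₂,τ₂) in L²(ℝ) uniformly on [0,T] as ξ₁ → ξ₂. -/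
open MeasureTheory Set

open Filter Topology in
lemma aux_oneD (φ φ' : ℝ → ℝ) (hφ : ∀ x, HasDerivAt φ (φ' x) x) (n : NNReal) (t1 t2 : ℝ)
    (h12 : t1 ≤ t2) (C : Set ℝ) (hC : IsClosed C) (hCs : C ⊆ Icc t1 t2) (hne : C.Nonempty)
    (hlip : ∀ k ∈ C, ∀ s ∈ Icc t1 t2, |φ s - φ k| ≤ n * |s - k|) :
    |φ t2 - φ t1 - ∫ x in C, φ' x| ≤ n * volume.real (Icc t1 t2 \ C) := by
  obtain ⟨k, hk⟩ := hne
  have hL : LipschitzOnWith n φ (C ∪ {t1, t2}) := by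
    have h1 : t1 ∈ Icc t1 t2 := ⟨le_rfl, h12⟩
    have h2 : t2 ∈ Icc t1 t2 := ⟨h12, le_rfl⟩
    have key : |φ t1 - φ t2| ≤ n * |t1 - t2| := by
      have e1 := hlip k hk t1 h1
      have e2 := hlip k hk t2 h2
      have hk' := hCs hk
      rw [abs_of_nonpos (a := t1 - k) (by linarith [hk'.1])] at e1
      rw [abs_of_nonneg (a := t2 - k) (by linarith [hk'.2])] at e2
      rw [abs_of_nonpos (sub_nonpos.2 h12)]
      calc |φ t1 - φ t2| = |(φ t1 - φ k) - (φ t2 - φ k)| := by ring_nf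
        _ ≤ _ := abs_sub _ _
        _ ≤ _ := by nlinarith
    apply LipschitzOnWith.of_dist_le_mul
    intro x hx y hy
    rw [Real.dist_eq, Real.dist_eq]
    have sub : ∀ z ∈ C ∪ {t1, t2}, z ∈ Icc t1 t2 := by
      rintro z (hz | rfl | rfl)
      · exact hCs hz
      · exact h1
      · exact h2
    rcases hy with hy | hy
    · exact hlip y hy x (sub x hx)
    · rcases hx with hx | hx
      · rw [abs_sub_comm, abs_sub_comm x y]
        exact hlip x hx y (sub y (Or.inr hy))
      · rcases hx with rfl | rfl <;> rcases hy with rfl | rfl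
        · simp
        · exact key
        · rw [abs_sub_comm, abs_sub_comm x y]; exact key
        · simp
  obtain ⟨ψ, hψ, heq⟩ := hL.extend_real
  have hac : AbsolutelyContinuousOnInterval ψ t1 t2 :=
    (hψ.lipschitzOnWith (s := uIcc t1 t2)).absolutelyContinuousOnInterval
  have hftc := hac.integral_deriv_eq_sub
  have hint := hac.intervalIntegrable_deriv
  rw [intervalIntegral.integral_of_le h12, ← integral_Icc_eq_integral_Ioc] at hftc
  rw [intervalIntegrable_iff_integrableOn_Icc_of_le h12] at hint
  have hsplit : ∫ x in Icc t1 t2, deriv ψ x = (∫ x in C, deriv ψ x) + ∫ x in Icc t1 t2 \ C, deriv ψ x := by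
    rw [← setIntegral_union disjoint_sdiff_right (measurableSet_Icc.diff hC.measurableSet)
      (hint.mono_set hCs) (hint.mono_set sdiff_subset), union_sdiff_cancel hCs]
  have hae : ∫ x in C, deriv ψ x = ∫ x in C, φ' x := by
    apply setIntegral_congr_ae hC.measurableSet
    have hcount := (countable_setOfPred_isolated_right_within (s := C)).ae_notMem volume
    filter_upwards [hcount, hψ.ae_differentiableAt_real] with x hx hd hxC
    have hacc : UniqueDiffWithinAt ℝ C x := by
      rw [uniqueDiffWithinAt_iff_accPt, accPt_principal_iff_nhdsWithin]
      have : 𝓝[C ∩ Ioi x] x ≠ ⊥ := fun h => hx ⟨hxC, h⟩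
      have : (𝓝[C ∩ Ioi x] x).NeBot := ⟨this⟩
      refine this.mono (nhdsWithin_mono _ ?_)
      rintro y ⟨hy, hy'⟩
      exact ⟨hy, ne_of_gt hy'⟩
    have a1 := hd.hasDerivAt.hasDerivWithinAt (s := C)
    have a2 := (hφ x).hasDerivWithinAt (s := C)
    have a3 : HasDerivWithinAt ψ (φ' x) C x :=
      a2.congr (fun y hy => (heq (Or.inl hy)).symm) (heq (Or.inl hxC)).symm
    exact hacc.eq_deriv C a1 a3
  have e1 : φ t1 = ψ t1 := heq (by simp)
  have e2 : φ t2 = ψ t2 := heq (by simp)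
  rw [e1, e2, ← hftc, hsplit, hae, add_sub_cancel_left, ← Real.norm_eq_abs]
  apply norm_setIntegral_le_of_norm_le_const
  · exact (measure_mono sdiff_subset).trans_lt (by simp)
  · intro x _
    exact norm_deriv_le_of_lipschitz hψ

/-- Baire category in the form: a nonempty closed set in a complete metric space covered by
countably many closed sets has a portion contained in one of them. -/
lemma aux_baire {X : Type*} [MetricSpace X] [CompleteSpace X] (C : Set X) (hC : IsClosed C)
    (hne : C.Nonempty) (f : ℕ → Set X) (hf : ∀ n, IsClosed (f n)) (hcov : ∀ x ∈ C, ∃ n, x ∈ f n) :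
    ∃ x0 ∈ C, ∃ ε > 0, ∃ n, ∀ x ∈ C, dist x x0 < ε → x ∈ f n := by
  have : CompleteSpace C := hC.completeSpace_coe
  have : Nonempty C := hne.to_subtype
  obtain ⟨n, x0, hx0⟩ := nonempty_interior_of_iUnion_of_closed (X := C)
    (f := fun n => Subtype.val ⁻¹' (f n)) (fun n => (hf n).preimage continuous_subtype_val)
    (by
      ext x
      simp only [mem_iUnion, mem_preimage, mem_univ, iff_true]
      exact hcov x x.2)
  rw [mem_interior_iff_mem_nhds, Metric.mem_nhds_iff] at hx0
  obtain ⟨ε, hε, hb⟩ := hx0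
  exact ⟨x0, x0.2, ε, hε, n, fun x hx hd => hb (show (⟨x, hx⟩ : C) ∈ Metric.ball x0 ε from hd)⟩

lemma aux_short (E : ℝ → ℝ) (T L D : ℝ) (hL : 0 ≤ L) (hD : 0 ≤ D)
    (hE0 : ∀ t ∈ Icc 0 T, 0 ≤ E t)
    (hest : ∀ s t m, 0 ≤ s → s ≤ t → t ≤ T → (∀ r ∈ Icc s t, E r ≤ m) →
      |E t - E s| ≤ (t - s) * (L * m + D))
    (s t : ℝ) (hs : 0 ≤ s) (ht : t ≤ T) (h1 : (t - s) * L ≤ 1 / 2) (h2 : t - s ≤ 1)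
    (hb : ∃ m, ∀ r ∈ Icc s t, E r ≤ m) :
    ∀ r0 ∈ Icc s t, ∀ r ∈ Icc s t, E r ≤ 2 * (E r0 + D) := by
  intro r0 hr0
  have hst : s ≤ t := hr0.1.trans hr0.2
  have hbdd : BddAbove (E '' Icc s t) := by
    obtain ⟨m, hm⟩ := hb
    refine ⟨m, ?_⟩
    rintro _ ⟨r, hr, rfl⟩
    exact hm r hr
  set m := sSup (E '' Icc s t) with hmdef
  have hm : ∀ r ∈ Icc s t, E r ≤ m := fun r hr => le_csSup hbdd ⟨r, hr, rfl⟩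
  have hm0 : 0 ≤ m := (hE0 r0 ⟨hs.trans hr0.1, hr0.2.trans ht⟩).trans (hm r0 hr0)
  have hLm : 0 ≤ L * m + D := by positivity
  have key : ∀ r ∈ Icc s t, E r ≤ E r0 + D + m / 2 := by
    intro r hr
    have hdiff : |E r - E r0| ≤ (t - s) * (L * m + D) := by
      rcases le_total r0 r with h | h
      · refine (hest r0 r m (hs.trans hr0.1) h (hr.2.trans ht)
          (fun x hx => hm x ⟨hr0.1.trans hx.1, hx.2.trans hr.2⟩)).trans ?_
        exact mul_le_mul_of_nonneg_right (by linarith [hr.2, hr0.1]) hLm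
      · rw [abs_sub_comm]
        refine (hest r r0 m (hs.trans hr.1) h (hr0.2.trans ht)
          (fun x hx => hm x ⟨hr.1.trans hx.1, hx.2.trans hr0.2⟩)).trans ?_
        exact mul_le_mul_of_nonneg_right (by linarith [hr0.2, hr.1]) hLm
    have := (abs_le.1 hdiff).2
    nlinarith
  have : m ≤ E r0 + D + m / 2 := by
    refine csSup_le (s := E '' Icc s t) ⟨E r0, r0, hr0, rfl⟩ ?_
    rintro _ ⟨r, hr, rfl⟩
    exact key r hr
  intro r hr
  linarith [hm r hr]

lemma aux_TB (E : ℝ → ℝ) (T L D : ℝ) (hL : 0 ≤ L) (hD : 0 ≤ D)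
    (hE0 : ∀ t ∈ Icc 0 T, 0 ≤ E t)
    (hclosed : ∀ n : ℕ, IsClosed {t | t ∈ Icc 0 T ∧ E t ≤ n})
    (hest : ∀ s t m, 0 ≤ s → s ≤ t → t ≤ T → (∀ r ∈ Icc s t, E r ≤ m) →
      |E t - E s| ≤ (t - s) * (L * m + D)) :
    ∃ m, ∀ t ∈ Icc 0 T, E t ≤ m := by
  let P : ℝ → Prop := fun t => ∃ ε > 0, ∃ m, ∀ r ∈ Icc 0 T, |r - t| < ε → E r ≤ m
  have hcomp : ∀ s t, 0 ≤ s → t ≤ T → (∀ r ∈ Icc s t, P r) → ∃ m, ∀ r ∈ Icc s t, E r ≤ m := by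
    intro s t hs ht hP
    have : ∃ m, ∀ r ∈ Icc s t, r ∈ Icc 0 T → E r ≤ m := by
      refine (isCompact_Icc (a := s) (b := t)).induction_on
        (p := fun S => ∃ m, ∀ r ∈ S, r ∈ Icc 0 T → E r ≤ m) ?_ ?_ ?_ ?_
      · exact ⟨0, by simp⟩
      · rintro S S' hSS ⟨m, hm⟩
        exact ⟨m, fun r hr => hm r (hSS hr)⟩
      · rintro S S' ⟨m, hm⟩ ⟨m', hm'⟩
        refine ⟨max m m', ?_⟩
        rintro r (hr | hr) hr'
        · exact (hm r hr hr').trans (le_max_left _ _)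
        · exact (hm' r hr hr').trans (le_max_right _ _)
      · intro x hx
        obtain ⟨ε, hε, m, hm⟩ := hP x hx
        exact ⟨Metric.ball x ε, mem_nhdsWithin_of_mem_nhds (Metric.ball_mem_nhds x hε), m,
          fun r hr hr' => hm r hr' hr⟩
    obtain ⟨m, hm⟩ := this
    exact ⟨m, fun r hr => hm r hr ⟨hs.trans hr.1, hr.2.trans ht⟩⟩
  by_contra hcon
  have hopen : IsOpen {t | P t} := by
    rw [Metric.isOpen_iff]
    rintro t ⟨ε, hε, m, hm⟩
    refine ⟨ε / 2, by positivity, ?_⟩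
    intro t' ht'
    refine ⟨ε / 2, by positivity, m, fun r hr hrt => hm r hr ?_⟩
    have : |t' - t| < ε / 2 := ht'
    calc |r - t| = |(r - t') + (t' - t)| := by ring_nf
      _ ≤ _ := abs_add_le _ _
      _ < ε := by linarith
  set C : Set ℝ := Icc 0 T ∩ {t | P t}ᶜ with hCdef
  have hC : IsClosed C := isClosed_Icc.inter hopen.isClosed_compl
  have hne : C.Nonempty := by
    by_contra h
    apply hcon
    apply hcomp 0 T le_rfl le_rfl
    intro r hr
    by_contra hr'
    exact h ⟨r, hr, hr'⟩
  obtain ⟨c0, hc0, ε, hε, n, hn⟩ := aux_baire C hC hne _ hclosed (by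
    intro x hx
    obtain ⟨n, hn⟩ := exists_nat_ge (E x)
    exact ⟨n, hx.1, hn⟩)
  apply hc0.2
  set δ := min ε (min 1 (1 / (2 * (L + 1)))) with hδ
  have hδ0 : 0 < δ := by positivity
  have hδ1 : δ ≤ ε := min_le_left _ _
  have hδ2 : δ ≤ 1 := (min_le_right _ _).trans (min_le_left _ _)
  have hδ3 : δ * L ≤ 1 / 2 := by
    have : δ ≤ 1 / (2 * (L + 1)) := (min_le_right _ _).trans (min_le_right _ _)
    rw [le_div_iff₀ (by positivity)] at this
    nlinarith
  have hnn : (0 : ℝ) ≤ n := n.cast_nonneg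
  refine ⟨δ, hδ0, 2 * (n + D), fun t ht htc => ?_⟩
  have hshort := aux_short E T L D hL hD hE0 hest
  by_cases htC : t ∈ C
  · have := (hn t htC (lt_of_lt_of_le htc hδ1)).2
    linarith
  rw [abs_lt] at htc
  rcases le_total c0 t with hct | hct
  · set S := C ∩ Icc c0 t with hS
    have hSc : IsCompact S := isCompact_Icc.inter_left hC
    obtain ⟨a, haS, hamax⟩ := hSc.exists_isGreatest ⟨c0, hc0, le_rfl, hct⟩
    have hat : a ≤ t := haS.2.2
    have hEa : E a ≤ n := (hn a haS.1 (by
      rw [Real.dist_eq, abs_lt]; constructor <;> linarith [haS.2.1, haS.2.2])).2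
    have ha0 : 0 ≤ a := haS.1.1.1
    have hgood : ∀ r, a < r → r ≤ t → P r := by
      intro r h1 h2
      by_contra h
      have := hamax ⟨⟨⟨by linarith, h2.trans ht.2⟩, h⟩, by linarith [haS.2.1], h2⟩
      linarith
    have hle : (t - a) * L ≤ 1 / 2 := by
      have : t - a ≤ δ := by linarith [haS.2.1]
      nlinarith
    have hle2 : t - a ≤ 1 := by linarith [haS.2.1]
    have hbd : ∃ m, ∀ r ∈ Icc a t, E r ≤ m := by
      refine ⟨max (n : ℝ) (2 * (E t + D)), fun r hr => ?_⟩
      rcases eq_or_lt_of_le hr.1 with h | h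
      · rw [← h]; exact hEa.trans (le_max_left _ _)
      · refine le_trans ?_ (le_max_right _ _)
        refine hshort r t (ha0.trans h.le) ht.2 ?_ (by linarith) ?_ t ⟨hr.2, le_rfl⟩ r ⟨le_rfl, hr.2⟩
        · nlinarith
        · exact hcomp r t (ha0.trans h.le) ht.2 (fun x hx => hgood x (h.trans_le hx.1) hx.2)
    have := hshort a t ha0 ht.2 hle hle2 hbd a ⟨le_rfl, hat⟩ t ⟨hat, le_rfl⟩
    linarith
  · set S := C ∩ Icc t c0 with hS
    have hSc : IsCompact S := isCompact_Icc.inter_left hC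
    obtain ⟨a, haS, hamin⟩ := hSc.exists_isLeast ⟨c0, hc0, hct, le_rfl⟩
    have hat : t ≤ a := haS.2.1
    have hEa : E a ≤ n := (hn a haS.1 (by
      rw [Real.dist_eq, abs_lt]; constructor <;> linarith [haS.2.1, haS.2.2])).2
    have ha0 : a ≤ T := haS.1.1.2
    have hgood : ∀ r, r < a → t ≤ r → P r := by
      intro r h1 h2
      by_contra h
      have := hamin ⟨⟨⟨ht.1.trans h2, by linarith⟩, h⟩, h2, by linarith [haS.2.2]⟩
      linarith
    have hle : (a - t) * L ≤ 1 / 2 := by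
      have : a - t ≤ δ := by linarith [haS.2.2]
      nlinarith
    have hle2 : a - t ≤ 1 := by linarith [haS.2.2]
    have hbd : ∃ m, ∀ r ∈ Icc t a, E r ≤ m := by
      refine ⟨max (n : ℝ) (2 * (E t + D)), fun r hr => ?_⟩
      rcases eq_or_lt_of_le hr.2 with h | h
      · rw [h]; exact hEa.trans (le_max_left _ _)
      · refine le_trans ?_ (le_max_right _ _)
        refine hshort t r ht.1 (h.le.trans ha0) ?_ (by linarith) ?_ t ⟨le_rfl, hr.1⟩ r ⟨hr.1, le_rfl⟩
        · nlinarith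
        · exact hcomp t r ht.1 (h.le.trans ha0) (fun x hx => hgood x (hx.2.trans_lt h) hx.1)
    have := hshort t a ht.1 ha0 hle hle2 hbd a ⟨hat, le_rfl⟩ t ⟨le_rfl, hat⟩
    linarith

/-- The circulation defect of a rectangle. -/
noncomputable def auxQ (v : ℝ → ℝ → ℝ) (α β : ℝ) (H : ℝ × ℝ → ℝ) (t1 t2 a b : ℝ) : ℝ :=
  α * (∫ y in a..b, (v t2 y - v t1 y)) + β * (∫ r in t1..t2, (v r b - v r a))
    - ∫ x in Ioc t1 t2 ×ˢ Ioc a b, H x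

lemma auxQ_swap (v : ℝ → ℝ → ℝ) (α β : ℝ) (H : ℝ × ℝ → ℝ) (t1 t2 a b : ℝ) :
    auxQ (fun y t => v t y) β α (fun x => H x.swap) a b t1 t2 = auxQ v α β H t1 t2 a b := by
  unfold auxQ
  have : ∫ x in Ioc a b ×ˢ Ioc t1 t2, H x.swap = ∫ x in Ioc t1 t2 ×ˢ Ioc a b, H x :=
    setIntegral_prod_swap (μ := volume) (ν := volume) (Ioc t1 t2) (Ioc a b) H
  rw [this]
  ring

lemma auxQ_add_t (v : ℝ → ℝ → ℝ) (hct : ∀ y, Continuous fun s => v s y)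
    (hcy : ∀ t, Continuous (v t)) (α β : ℝ) (H : ℝ × ℝ → ℝ) (hH : Integrable H)
    (t1 t2 t3 a b : ℝ) (h12 : t1 ≤ t2) (h23 : t2 ≤ t3) :
    auxQ v α β H t1 t3 a b = auxQ v α β H t1 t2 a b + auxQ v α β H t2 t3 a b := by
  unfold auxQ
  have e1 : ∫ y in a..b, (v t3 y - v t1 y) =
      (∫ y in a..b, (v t2 y - v t1 y)) + ∫ y in a..b, (v t3 y - v t2 y) := by
    rw [← intervalIntegral.integral_add]
    · congr 1; ext y; ring
    · exact ((hcy _).sub (hcy _)).intervalIntegrable _ _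
    · exact ((hcy _).sub (hcy _)).intervalIntegrable _ _
  have e2 : ∫ r in t1..t3, (v r b - v r a) =
      (∫ r in t1..t2, (v r b - v r a)) + ∫ r in t2..t3, (v r b - v r a) := by
    rw [intervalIntegral.integral_add_adjacent_intervals]
    · exact ((hct _).sub (hct _)).intervalIntegrable _ _
    · exact ((hct _).sub (hct _)).intervalIntegrable _ _
  have e3 : ∫ x in Ioc t1 t3 ×ˢ Ioc a b, H x =
      (∫ x in Ioc t1 t2 ×ˢ Ioc a b, H x) + ∫ x in Ioc t2 t3 ×ˢ Ioc a b, H x := by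
    rw [← setIntegral_union, ← Set.union_prod, Ioc_union_Ioc_eq_Ioc h12 h23]
    · rw [Set.disjoint_prod]
      left
      exact Set.Ioc_disjoint_Ioc_of_le le_rfl
    · exact measurableSet_Ioc.prod measurableSet_Ioc
    · exact hH.integrableOn
    · exact hH.integrableOn
  rw [e1, e2, e3]
  ring

lemma auxQ_add_y (v : ℝ → ℝ → ℝ) (hct : ∀ y, Continuous fun s => v s y)
    (hcy : ∀ t, Continuous (v t)) (α β : ℝ) (H : ℝ × ℝ → ℝ) (hH : Integrable H)
    (t1 t2 a b c : ℝ) (h12 : a ≤ b) (h23 : b ≤ c) :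
    auxQ v α β H t1 t2 a c = auxQ v α β H t1 t2 a b + auxQ v α β H t1 t2 b c := by
  rw [← auxQ_swap v α β H t1 t2 a c, ← auxQ_swap v α β H t1 t2 a b, ← auxQ_swap v α β H t1 t2 b c]
  exact auxQ_add_t _ hcy hct β α _ hH.swap a b c t1 t2 h12 h23

lemma auxQ_deg_t (v : ℝ → ℝ → ℝ) (α β : ℝ) (H : ℝ × ℝ → ℝ) (t a b : ℝ) :
    auxQ v α β H t t a b = 0 := by
  simp [auxQ]

lemma auxQ_deg_y (v : ℝ → ℝ → ℝ) (α β : ℝ) (H : ℝ × ℝ → ℝ) (t1 t2 a : ℝ) :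
    auxQ v α β H t1 t2 a a = 0 := by
  simp [auxQ]

lemma auxQ_cont (v : ℝ → ℝ → ℝ) (hct : ∀ y, Continuous fun s => v s y)
    (hcy : ∀ t, Continuous (v t)) (Bd : ℝ) (hb : ∀ t y, |v t y| ≤ Bd)
    (α β : ℝ) (H : ℝ × ℝ → ℝ) (hH : Integrable H)
    (t1 a b : ℝ) : ContinuousOn (fun t => auxQ v α β H t1 t a b) (Ici t1) := by
  have hJ : Integrable (fun r => ∫ y in Ioc a b, H (r, y)) := by
    have : Integrable H ((volume : Measure ℝ).prod (volume.restrict (Ioc a b))) := by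
      have h := hH.integrableOn (s := univ ×ˢ Ioc a b)
      rw [IntegrableOn, Measure.volume_eq_prod, ← Measure.prod_restrict, Measure.restrict_univ] at h
      exact h
    exact this.integral_prod_left
  have heq : ∀ t ∈ Ici t1, auxQ v α β H t1 t a b =
      α * (∫ y in a..b, (v t y - v t1 y)) + β * (∫ r in t1..t, (v r b - v r a))
    - ∫ r in t1..t, ∫ y in Ioc a b, H (r, y) := by
    intro t ht
    unfold auxQ
    rw [intervalIntegral.integral_of_le (f := fun r => ∫ y in Ioc a b, H (r, y)) ht]
    congr 1
    exact setIntegral_prod (μ := volume) (ν := volume) H hH.integrableOn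
  refine ContinuousOn.congr (Continuous.continuousOn ?_) heq
  refine Continuous.sub (Continuous.add (continuous_const.mul ?_) (continuous_const.mul ?_)) ?_
  · refine intervalIntegral.continuous_of_dominated_interval (bound := fun _ => 2 * Bd) ?_ ?_ ?_ ?_
    · intro t
      exact ((hcy t).sub (hcy t1)).aestronglyMeasurable
    · intro t
      refine Filter.Eventually.of_forall fun y _ => ?_
      rw [Real.norm_eq_abs]
      linarith [abs_sub (v t y) (v t1 y), hb t y, hb t1 y]
    · exact intervalIntegrable_const
    · exact Filter.Eventually.of_forall fun y _ => (hct y).sub continuous_const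
  · exact intervalIntegral.continuous_primitive
      (fun x y => ((hct b).sub (hct a)).intervalIntegrable x y) _
  · exact intervalIntegral.continuous_primitive (fun x y => hJ.intervalIntegrable) _

lemma auxQ_strip_t (v : ℝ → ℝ → ℝ) (hct : ∀ y, Continuous fun s => v s y)
    (hcy : ∀ t, Continuous (v t)) (Bd : ℝ) (hb : ∀ t y, |v t y| ≤ Bd)
    (α β : ℝ) (H : ℝ × ℝ → ℝ) (hH : Integrable H)
    (s t a b : ℝ) (hst : s ≤ t)
    (hz : ∀ s' t', s < s' → s' ≤ t' → t' < t → auxQ v α β H s' t' a b = 0) :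
    auxQ v α β H s t a b = 0 := by
  rcases eq_or_lt_of_le hst with rfl | hlt
  · exact auxQ_deg_t v α β H s a b
  have hcont := (auxQ_cont v hct hcy Bd hb α β H hH s a b).mono
    (Icc_subset_Ici_self : Icc s t ⊆ Ici s)
  set m := (s + t) / 2 with hm
  have hsm : s < m := by rw [hm]; linarith
  have hmt : m < t := by rw [hm]; linarith
  have hconst : ∀ x ∈ Ioo s t, auxQ v α β H s x a b = auxQ v α β H s m a b := by
    intro x hx
    rcases le_total x m with h | h
    · rw [auxQ_add_t v hct hcy α β H hH s x m a b hx.1.le h, hz x m hx.1 h hmt, add_zero]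
    · rw [auxQ_add_t v hct hcy α β H hH s m x a b hsm.le h, hz m x hsm h hx.2, add_zero]
  have hall : EqOn (fun x => auxQ v α β H s x a b) (fun _ => auxQ v α β H s m a b) (Icc s t) := by
    refine EqOn.of_subset_closure (s := Ioo s t) hconst hcont continuousOn_const Ioo_subset_Icc_self ?_
    rw [closure_Ioo hlt.ne]
  have h1 := hall ⟨hst, le_rfl⟩
  have h2 := hall (⟨le_rfl, hst⟩ : s ∈ Icc s t)
  simp only at h1 h2
  rw [h1, ← h2, auxQ_deg_t]

lemma auxQ_strip_y (v : ℝ → ℝ → ℝ) (hct : ∀ y, Continuous fun s => v s y)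
    (hcy : ∀ t, Continuous (v t)) (Bd : ℝ) (hb : ∀ t y, |v t y| ≤ Bd)
    (α β : ℝ) (H : ℝ × ℝ → ℝ) (hH : Integrable H)
    (s t a b : ℝ) (hab : a ≤ b)
    (hz : ∀ a' b', a < a' → a' ≤ b' → b' < b → auxQ v α β H s t a' b' = 0) :
    auxQ v α β H s t a b = 0 := by
  rw [← auxQ_swap]
  refine auxQ_strip_t _ hcy hct Bd (fun t y => hb y t) β α _ hH.swap a b s t hab ?_
  intro a' b' h1 h2 h3
  exact (auxQ_swap v α β H s t a' b').trans (hz a' b' h1 h2 h3)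

lemma aux_bisect (q : ℝ → ℝ → ℝ → ℝ → ℝ)
    (hqt : ∀ t1 t2 t3 a b, t1 ≤ t2 → t2 ≤ t3 → q t1 t3 a b = q t1 t2 a b + q t2 t3 a b)
    (hqy : ∀ t1 t2 a b c, a ≤ b → b ≤ c → q t1 t2 a c = q t1 t2 a b + q t1 t2 b c)
    (ν : Measure (ℝ × ℝ)) [IsFiniteMeasure ν] (k : ℕ) :
    ∀ t1 t2 a b, t1 ≤ t2 → a ≤ b →
      (∀ t1' t2' a' b', t1 ≤ t1' → t1' ≤ t2' → t2' ≤ t2 → a ≤ a' → a' ≤ b' → b' ≤ b →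
        t2' - t1' = (t2 - t1) / 2 ^ k → b' - a' = (b - a) / 2 ^ k →
        |q t1' t2' a' b'| ≤ ν.real (Ioc t1' t2' ×ˢ Ioc a' b')) →
      |q t1 t2 a b| ≤ ν.real (Ioc t1 t2 ×ˢ Ioc a b) := by
  induction k with
  | zero =>
    intro t1 t2 a b h1 h2 h
    exact h t1 t2 a b le_rfl h1 le_rfl le_rfl h2 le_rfl (by simp) (by simp)
  | succ k ih =>
    intro t1 t2 a b h1 h2 h
    set m := (t1 + t2) / 2 with hm
    set c := (a + b) / 2 with hc
    have hm1 : t1 ≤ m := by rw [hm]; linarith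
    have hm2 : m ≤ t2 := by rw [hm]; linarith
    have hc1 : a ≤ c := by rw [hc]; linarith
    have hc2 : c ≤ b := by rw [hc]; linarith
    have sub : ∀ s1 s2 d e, t1 ≤ s1 → s1 ≤ s2 → s2 ≤ t2 → a ≤ d → d ≤ e → e ≤ b →
        s2 - s1 = (t2 - t1) / 2 → e - d = (b - a) / 2 →
        |q s1 s2 d e| ≤ ν.real (Ioc s1 s2 ×ˢ Ioc d e) := by
      intro s1 s2 d e g1 g2 g3 g4 g5 g6 g7 g8
      apply ih s1 s2 d e g2 g5
      intro t1' t2' a' b' f1 f2 f3 f4 f5 f6 f7 f8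
      apply h t1' t2' a' b' (g1.trans f1) f2 (f3.trans g3) (g4.trans f4) f5 (f6.trans g6)
      · rw [f7, g7, pow_succ]; field_simp
      · rw [f8, g8, pow_succ]; field_simp
    have q1 := sub t1 m a c le_rfl hm1 hm2 le_rfl hc1 hc2 (by rw [hm]; ring) (by rw [hc]; ring)
    have q2 := sub t1 m c b le_rfl hm1 hm2 hc1 hc2 le_rfl (by rw [hm]; ring) (by rw [hc]; ring)
    have q3 := sub m t2 a c hm1 hm2 le_rfl le_rfl hc1 hc2 (by rw [hm]; ring) (by rw [hc]; ring)
    have q4 := sub m t2 c b hm1 hm2 le_rfl hc1 hc2 le_rfl (by rw [hm]; ring) (by rw [hc]; ring)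
    have mu : ∀ s1 s2, ν.real (Ioc s1 s2 ×ˢ Ioc a b)
        = ν.real (Ioc s1 s2 ×ˢ Ioc a c) + ν.real (Ioc s1 s2 ×ˢ Ioc c b) := by
      intro s1 s2
      rw [← measureReal_union, ← Set.prod_union, Ioc_union_Ioc_eq_Ioc hc1 hc2]
      · rw [Set.disjoint_prod]; right; exact Set.Ioc_disjoint_Ioc_of_le le_rfl
      · exact measurableSet_Ioc.prod measurableSet_Ioc
    have mu2 : ν.real (Ioc t1 t2 ×ˢ Ioc a b)
        = ν.real (Ioc t1 m ×ˢ Ioc a b) + ν.real (Ioc m t2 ×ˢ Ioc a b) := by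
      rw [← measureReal_union, ← Set.union_prod, Ioc_union_Ioc_eq_Ioc hm1 hm2]
      · rw [Set.disjoint_prod]; left; exact Set.Ioc_disjoint_Ioc_of_le le_rfl
      · exact measurableSet_Ioc.prod measurableSet_Ioc
    rw [mu2, mu, mu, hqt t1 m t2 a b hm1 hm2, hqy t1 m a c b hc1 hc2, hqy m t2 a c b hc1 hc2]
    rw [abs_le] at *
    constructor <;> linarith [q1.1, q2.1, q3.1, q4.1, q1.2, q2.2, q3.2, q4.2]

lemma aux_est_t (v vt : ℝ → ℝ → ℝ) (hvt : ∀ t y, HasDerivAt (fun s => v s y) (vt t y) t)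
    (hcy : ∀ t, Continuous (v t)) (hm : Measurable (fun x : ℝ × ℝ => vt x.1 x.2))
    (n : NNReal) (κ : ℝ) (hκ : 0 ≤ κ) (t1 t2 a b s1 s2 c d : ℝ)
    (ht : t1 ≤ s1 ∧ s1 ≤ s2 ∧ s2 ≤ t2) (hy : a ≤ c ∧ c ≤ d ∧ d ≤ b)
    (hshape : b - a ≤ κ * (t2 - t1))
    (K : Set (ℝ × ℝ)) (hK : IsClosed K) (hKs : K ⊆ Icc s1 s2 ×ˢ Icc c d)
    (hKt : ∀ x ∈ K, ∀ s ∈ Icc t1 t2, |v s x.2 - v x.1 x.2| ≤ n * |s - x.1|)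
    (hKy : ∀ x ∈ K, ∀ z ∈ Icc a b, |v x.1 z - v x.1 x.2| ≤ n * |z - x.2|)
    (hKb : ∀ x ∈ K, |vt x.1 x.2| ≤ n)
    (k1 k2 : ℝ × ℝ) (hk1 : k1 ∈ K) (hk1' : k1.1 = s1) (hk2 : k2 ∈ K) (hk2' : k2.1 = s2) :
    |(∫ y in c..d, (v s2 y - v s1 y)) - ∫ x in K, vt x.1 x.2|
      ≤ n * (3 * κ + 1) * volume.real ((Icc t1 t2 ×ˢ Icc a b) \ K) := by
  obtain ⟨ht1, ht2, ht3⟩ := ht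
  obtain ⟨hy1, hy2, hy3⟩ := hy
  have hn : (0 : ℝ) ≤ n := n.2
  set R : Set (ℝ × ℝ) := Icc t1 t2 ×ˢ Icc a b with hR
  have hRm : MeasurableSet (R \ K) := (measurableSet_Icc.prod measurableSet_Icc).diff hK.measurableSet
  have hRfin : volume R < ⊤ := (isCompact_Icc.prod isCompact_Icc).measure_lt_top
  have hKR : K ⊆ R := hKs.trans (Set.prod_mono (Icc_subset_Icc ht1 ht3) (Icc_subset_Icc hy1 hy3))
  have hint : Integrable (K.indicator fun x => vt x.1 x.2) := by
    rw [integrable_indicator_iff hK.measurableSet]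
    refine Measure.integrableOn_of_bounded (M := n) ((measure_mono hKR).trans_lt hRfin).ne
      hm.aestronglyMeasurable ?_
    exact (ae_restrict_iff' hK.measurableSet).2 (Filter.Eventually.of_forall fun x hx => hKb x hx)
  have hint2 : Integrable ((R \ K).indicator fun _ => (1 : ℝ)) := by
    rw [integrable_indicator_iff hRm]
    exact integrableOn_const ((measure_mono sdiff_subset).trans_lt hRfin).ne
  -- slices
  let S : ℝ → Set ℝ := fun y => {t | (t, y) ∈ K}
  have hS : ∀ y, IsClosed (S y) := fun y => hK.preimage (by fun_prop : Continuous fun t : ℝ => (t, y))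
  have hI1 : ∫ x in K, vt x.1 x.2 = ∫ y in Ioc c d, ∫ t in S y, vt t y := by
    rw [← integral_indicator hK.measurableSet, Measure.volume_eq_prod, integral_prod_symm _ hint,
      ← integral_Icc_eq_integral_Ioc, ← integral_indicator measurableSet_Icc]
    congr 1
    ext y
    have : ∫ t, K.indicator (fun x => vt x.1 x.2) (t, y) = ∫ t in S y, vt t y := by
      rw [← integral_indicator (hS y).measurableSet]
      rfl
    rw [this]
    by_cases hyc : y ∈ Icc c d
    · rw [indicator_of_mem hyc]
    · rw [indicator_of_notMem hyc]
      have : S y = ∅ := by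
        ext t
        simp only [S, mem_setOf_eq, mem_empty_iff_false, iff_false]
        intro h
        exact hyc (hKs h).2
      rw [this]
      simp
  have hI1int : IntegrableOn (fun y => ∫ t in S y, vt t y) (Ioc c d) := by
    have := (hint.integral_prod_right (μ := (volume : Measure ℝ)) (ν := (volume : Measure ℝ)))
    have h2 : (fun y => ∫ t, K.indicator (fun x => vt x.1 x.2) (t, y)) = fun y => ∫ t in S y, vt t y := by
      ext y
      rw [← integral_indicator (hS y).measurableSet]
      rfl
    rw [h2] at this
    exact this.integrableOn
  let g : ℝ → ℝ := fun y => ∫ t, (R \ K).indicator (fun _ => (1 : ℝ)) (t, y)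
  have hg : Integrable g := hint2.integral_prod_right (μ := (volume : Measure ℝ)) (ν := (volume : Measure ℝ))
  have hg0 : ∀ y, 0 ≤ g y := fun y => integral_nonneg fun t => indicator_nonneg (fun _ _ => zero_le_one) _
  have hgI : ∫ y, g y = volume.real (R \ K) := by
    have h1 : ∫ x, (R \ K).indicator (fun _ => (1 : ℝ)) x = ∫ y, g y := by
      rw [Measure.volume_eq_prod, integral_prod_symm _ hint2]
    rw [← h1, integral_indicator hRm]
    simp
  have hgy : ∀ y ∈ Icc a b, g y = volume.real (Icc t1 t2 \ S y) := by
    intro y hyab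
    have : (fun t => (R \ K).indicator (fun _ => (1 : ℝ)) (t, y)) =
        (Icc t1 t2 \ S y).indicator (fun _ => (1 : ℝ)) := by
      ext t
      have hiff : (t, y) ∈ R \ K ↔ t ∈ Icc t1 t2 \ S y := by
        constructor
        · rintro ⟨⟨h1, _⟩, h2⟩
          exact ⟨h1, h2⟩
        · rintro ⟨h1, h2⟩
          exact ⟨⟨h1, hyab⟩, h2⟩
      by_cases ht : t ∈ Icc t1 t2 \ S y
      · rw [indicator_of_mem ht, indicator_of_mem (hiff.2 ht)]
      · rw [indicator_of_notMem ht, indicator_of_notMem (fun h => ht (hiff.1 h))]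
    simp only [g]
    rw [this, integral_indicator (measurableSet_Icc.diff (hS y).measurableSet)]
    simp
  have hI2int : IntegrableOn (fun y => v s2 y - v s1 y) (Ioc c d) :=
    (((hcy _).sub (hcy _)).continuousOn.integrableOn_Icc).mono_set Ioc_subset_Icc_self
  rw [hI1, intervalIntegral.integral_of_le hy2, ← integral_sub hI2int hI1int, ← hgI,
    ← integral_const_mul]
  refine le_trans (b := ∫ y in Ioc c d, n * (3 * κ + 1) * g y) ?_ ?_
  · rw [← Real.norm_eq_abs]
    apply norm_integral_le_of_norm_le (hg.const_mul _).integrableOn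
    rw [ae_restrict_iff' measurableSet_Ioc]
    refine Filter.Eventually.of_forall fun y hycd => ?_
    have hyab : y ∈ Icc a b := ⟨hy1.trans hycd.1.le, hycd.2.trans hy3⟩
    rw [hgy y hyab, Real.norm_eq_abs]
    by_cases hne : (S y).Nonempty
    · have h1 := aux_oneD (fun s => v s y) (fun s => vt s y) (fun s => hvt s y) n s1 s2 ht2 (S y)
        (hS y) (fun t ht => (hKs ht).1) hne
        (fun k hk s hs => hKt (k, y) hk s ⟨ht1.trans hs.1, hs.2.trans ht3⟩)
      refine h1.trans ?_
      have h2 : volume.real (Icc s1 s2 \ S y) ≤ volume.real (Icc t1 t2 \ S y) := by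
        exact measureReal_mono (sdiff_subset_sdiff_left (Icc_subset_Icc ht1 ht3))
          ((measure_mono sdiff_subset).trans_lt (by simp : volume (Icc t1 t2) < ⊤)).ne
      have h3 : 0 ≤ volume.real (Icc t1 t2 \ S y) := measureReal_nonneg
      calc n * volume.real (Icc s1 s2 \ S y) ≤ n * volume.real (Icc t1 t2 \ S y) := by gcongr
        _ ≤ n * (3 * κ + 1) * volume.real (Icc t1 t2 \ S y) := by
          have : 0 ≤ n * κ * volume.real (Icc t1 t2 \ S y) := by positivity
          linarith
    · rw [not_nonempty_iff_eq_empty] at hne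
      have hk1y := (hKs hk1).2
      have hk2y := (hKs hk2).2
      have t12 : t1 ≤ t2 := ht1.trans (ht2.trans ht3)
      rw [hne]
      simp only [Measure.restrict_empty, integral_zero_measure, sub_zero, sdiff_empty,
        Real.volume_real_Icc_of_le t12]
      have bd : ∀ z w, z ∈ Icc a b → w ∈ Icc a b → |z - w| ≤ κ * (t2 - t1) := by
        intro z w hz hw
        rw [abs_le]
        constructor <;> linarith [hz.1, hz.2, hw.1, hw.2]
      have k1ab : k1.2 ∈ Icc a b := ⟨hy1.trans hk1y.1, hk1y.2.trans hy3⟩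
      have k2ab : k2.2 ∈ Icc a b := ⟨hy1.trans hk2y.1, hk2y.2.trans hy3⟩
      have e1 := hKy k1 hk1 y hyab
      have e2 := hKy k2 hk2 y hyab
      have e3 := hKy k2 hk2 k1.2 k1ab
      have e4 := hKt k1 hk1 s2 ⟨ht1.trans ht2, ht3⟩
      rw [hk1'] at e1 e4
      rw [hk2'] at e2 e3
      have f1 := e1.trans (mul_le_mul_of_nonneg_left (bd y k1.2 hyab k1ab) hn)
      have f2 := e2.trans (mul_le_mul_of_nonneg_left (bd y k2.2 hyab k2ab) hn)
      have f3 := e3.trans (mul_le_mul_of_nonneg_left (bd k1.2 k2.2 k1ab k2ab) hn)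
      have f4 := e4.trans (mul_le_mul_of_nonneg_left
        (show |s2 - s1| ≤ t2 - t1 by rw [abs_of_nonneg (by linarith)]; linarith) hn)
      rw [abs_le] at *
      constructor <;> linarith [f1.1, f2.1, f3.1, f4.1, f1.2, f2.2, f3.2, f4.2]
  · refine setIntegral_le_integral (hg.const_mul _) (Filter.Eventually.of_forall fun y => ?_)
    have := hg0 y
    positivity

lemma aux_est_y (v vy : ℝ → ℝ → ℝ) (hvy : ∀ t y, HasDerivAt (fun z => v t z) (vy t y) y)
    (hct : ∀ y, Continuous fun s => v s y) (hm : Measurable (fun x : ℝ × ℝ => vy x.1 x.2))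
    (n : NNReal) (κ : ℝ) (hκ : 0 ≤ κ) (t1 t2 a b s1 s2 c d : ℝ)
    (ht : t1 ≤ s1 ∧ s1 ≤ s2 ∧ s2 ≤ t2) (hy : a ≤ c ∧ c ≤ d ∧ d ≤ b)
    (hshape : t2 - t1 ≤ κ * (b - a))
    (K : Set (ℝ × ℝ)) (hK : IsClosed K) (hKs : K ⊆ Icc s1 s2 ×ˢ Icc c d)
    (hKt : ∀ x ∈ K, ∀ s ∈ Icc t1 t2, |v s x.2 - v x.1 x.2| ≤ n * |s - x.1|)
    (hKy : ∀ x ∈ K, ∀ z ∈ Icc a b, |v x.1 z - v x.1 x.2| ≤ n * |z - x.2|)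
    (hKb : ∀ x ∈ K, |vy x.1 x.2| ≤ n)
    (k1 k2 : ℝ × ℝ) (hk1 : k1 ∈ K) (hk1' : k1.2 = c) (hk2 : k2 ∈ K) (hk2' : k2.2 = d) :
    |(∫ r in s1..s2, (v r d - v r c)) - ∫ x in K, vy x.1 x.2|
      ≤ n * (3 * κ + 1) * volume.real ((Icc t1 t2 ×ˢ Icc a b) \ K) := by
  have key := aux_est_t (fun y t => v t y) (fun y t => vy t y) (fun y t => hvy t y) hct
    (hm.comp measurable_swap) n κ hκ a b t1 t2 c d s1 s2 hy ht hshape (Prod.swap ⁻¹' K)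
    (hK.preimage continuous_swap) (fun x hx => ⟨(hKs hx).2, (hKs hx).1⟩)
    (fun x hx s hs => hKy x.swap hx s hs) (fun x hx s hs => hKt x.swap hx s hs)
    (fun x hx => hKb x.swap hx) k1.swap k2.swap (by simpa using hk1) hk1' (by simpa using hk2) hk2'
  have hsw : MeasurePreserving (Prod.swap : ℝ × ℝ → ℝ × ℝ) volume volume :=
    Measure.measurePreserving_swap
  have e1 : ∫ x in Prod.swap ⁻¹' K, vy x.2 x.1 = ∫ x in K, vy x.1 x.2 :=
    hsw.setIntegral_preimage_emb (MeasurableEquiv.prodComm.measurableEmbedding)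
      (fun x => vy x.1 x.2) K
  have e2 : volume.real ((Icc a b ×ˢ Icc t1 t2) \ Prod.swap ⁻¹' K)
      = volume.real ((Icc t1 t2 ×ˢ Icc a b) \ K) := by
    have : (Icc a b ×ˢ Icc t1 t2) \ Prod.swap ⁻¹' K = Prod.swap ⁻¹' ((Icc t1 t2 ×ˢ Icc a b) \ K) := by
      ext x; simp [and_comm]
    rw [this, measureReal_def, measureReal_def, hsw.measure_preimage
      ((measurableSet_Icc.prod measurableSet_Icc).diff hK.measurableSet).nullMeasurableSet]
  rw [e1, e2] at key
  exact key

open Filter Topology in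
lemma aux_Fn_closed (v : ℝ → ℝ → ℝ) (hct : ∀ y, Continuous fun s => v s y)
    (hcy : ∀ t, Continuous (v t)) (n δ : ℝ) (hδ : 0 < δ) :
    IsClosed {x : ℝ × ℝ | (∀ s, |s - x.1| < δ → |v s x.2 - v x.1 x.2| ≤ n * |s - x.1|) ∧
      (∀ z, |z - x.2| < δ → |v x.1 z - v x.1 x.2| ≤ n * |z - x.2|)} := by
  apply IsSeqClosed.isClosed
  intro x p hx hp
  have hp1 : Tendsto (fun k => (x k).1) atTop (𝓝 p.1) := (continuous_fst.tendsto p).comp hp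
  have hp2 : Tendsto (fun k => (x k).2) atTop (𝓝 p.2) := (continuous_snd.tendsto p).comp hp
  have hs : ∀ s, Tendsto (fun k => v s (x k).2) atTop (𝓝 (v s p.2)) :=
    fun s => ((hcy s).tendsto p.2).comp hp2
  have hz : ∀ z, Tendsto (fun k => v (x k).1 z) atTop (𝓝 (v p.1 z)) :=
    fun z => ((hct z).tendsto p.1).comp hp1
  have hd1 : ∀ s, Tendsto (fun k => |s - (x k).1|) atTop (𝓝 |s - p.1|) :=
    fun s => (tendsto_const_nhds.sub hp1).abs
  have hd2 : ∀ s, Tendsto (fun k => |s - (x k).2|) atTop (𝓝 |s - p.2|) :=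
    fun s => (tendsto_const_nhds.sub hp2).abs
  have hv : Tendsto (fun k => v (x k).1 (x k).2) atTop (𝓝 (v p.1 p.2)) := by
    have h0 : Tendsto (fun k => n * |p.1 - (x k).1|) atTop (𝓝 0) := by
      have := (hd1 p.1).const_mul n
      simpa using this
    have h1 : Tendsto (fun k => v p.1 (x k).2 - v (x k).1 (x k).2) atTop (𝓝 0) := by
      apply squeeze_zero_norm' _ h0
      have : ∀ᶠ k in atTop, |p.1 - (x k).1| < δ := (hd1 p.1).eventually_lt_const (by simpa using hδ)
      filter_upwards [this] with k hk
      exact (hx k).1 _ hk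
    have h2 := (hs p.1).sub h1
    simpa using h2
  constructor
  · intro s hsd
    refine le_of_tendsto_of_tendsto ((hs s).sub hv).abs ((hd1 s).const_mul n) ?_
    filter_upwards [(hd1 s).eventually_lt_const hsd] with k hk
    exact (hx k).1 s hk
  · intro z hzd
    refine le_of_tendsto_of_tendsto ((hz z).sub hv).abs ((hd2 z).const_mul n) ?_
    filter_upwards [(hd2 z).eventually_lt_const hzd] with k hk
    exact (hx k).2 z hk

open Filter Topology in
lemma aux_lip_pt (φ : ℝ → ℝ) (φ' x : ℝ) (h : HasDerivAt φ φ' x) :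
    ∃ N : ℕ, ∀ n ≥ N, ∀ s, |s - x| < 1 / ((n : ℝ) + 1) → |φ s - φ x| ≤ n * |s - x| := by
  have h1 := h.isBigO_sub
  rw [Asymptotics.isBigO_iff] at h1
  obtain ⟨c, hc⟩ := h1
  rw [Metric.eventually_nhds_iff] at hc
  obtain ⟨ε, hε, hb⟩ := hc
  obtain ⟨N1, hN1⟩ := exists_nat_ge c
  obtain ⟨N2, hN2⟩ := exists_nat_one_div_lt hε
  refine ⟨max N1 N2, fun n hn s hs => ?_⟩
  have hn1 : (N1 : ℝ) ≤ n := by exact_mod_cast (le_max_left _ _).trans hn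
  have hn2 : (N2 : ℝ) ≤ n := by exact_mod_cast (le_max_right _ _).trans hn
  have : 1 / ((n : ℝ) + 1) ≤ 1 / ((N2 : ℝ) + 1) := by gcongr
  have h2 := hb (y := s) (by rw [Real.dist_eq]; linarith)
  rw [Real.norm_eq_abs, Real.norm_eq_abs] at h2
  exact h2.trans (mul_le_mul_of_nonneg_right (by linarith) (abs_nonneg _))

open Filter Topology in
lemma aux_deriv_bd (φ : ℝ → ℝ) (φ' x n δ : ℝ) (hn : 0 ≤ n) (h : HasDerivAt φ φ' x) (hδ : 0 < δ)
    (hl : ∀ s, |s - x| < δ → |φ s - φ x| ≤ n * |s - x|) : |φ'| ≤ n := by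
  have := norm_deriv_le_of_lip' (f := φ) (x₀ := x) hn (by
    rw [Metric.eventually_nhds_iff]
    exact ⟨δ, hδ, fun y hy => hl y hy⟩)
  rwa [h.deriv] at this

open Filter Topology in
lemma aux_meas_t (v vt : ℝ → ℝ → ℝ) (hvt : ∀ t y, HasDerivAt (fun s => v s y) (vt t y) t)
    (hcy : ∀ t, Continuous (v t)) :
    Measurable (fun x : ℝ × ℝ => v x.1 x.2) ∧ Measurable (fun x : ℝ × ℝ => vt x.1 x.2) := by
  have hct : ∀ y, Continuous fun s => v s y :=
    fun y => continuous_iff_continuousAt.2 fun t => (hvt t y).continuousAt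
  have h1 : Measurable (fun x : ℝ × ℝ => v x.1 x.2) :=
    (stronglyMeasurable_uncurry_of_continuous_of_stronglyMeasurable hct
      (fun t => (hcy t).stronglyMeasurable)).measurable
  refine ⟨h1, ?_⟩
  have hlim : ∀ x : ℝ × ℝ, Tendsto (fun k : ℕ =>
      (1 / ((k : ℝ) + 1))⁻¹ * (v (x.1 + 1 / ((k : ℝ) + 1)) x.2 - v x.1 x.2)) atTop (𝓝 (vt x.1 x.2)) := by
    intro x
    have h2 := (hvt x.1 x.2).tendsto_slope_zero
    have h3 : Tendsto (fun k : ℕ => 1 / ((k : ℝ) + 1)) atTop (𝓝[≠] 0) := by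
      rw [tendsto_nhdsWithin_iff]
      exact ⟨tendsto_one_div_add_atTop_nhds_zero_nat,
        Eventually.of_forall fun k => (by positivity : (0 : ℝ) < 1 / ((k : ℝ) + 1)).ne'⟩
    exact h2.comp h3
  refine measurable_of_tendsto_metrizable (fun k => ?_) (tendsto_pi_nhds.2 hlim)
  have h4 : Measurable (fun x : ℝ × ℝ => v (x.1 + 1 / ((k : ℝ) + 1)) x.2) :=
    h1.comp (g := fun x : ℝ × ℝ => v x.1 x.2) (f := fun x : ℝ × ℝ => (x.1 + 1 / ((k : ℝ) + 1), x.2))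
      (by fun_prop)
  exact (h4.sub h1).const_mul _

lemma aux_rect_ae (t1 t2 a b : ℝ) :
    (Ioc t1 t2 ×ˢ Ioc a b : Set (ℝ × ℝ)) =ᵐ[volume] (Icc t1 t2 ×ˢ Icc a b : Set (ℝ × ℝ)) := by
  rw [Measure.volume_eq_prod]
  exact Measure.set_prod_ae_eq Ioc_ae_eq_Icc Ioc_ae_eq_Icc

lemma aux_sub_est (v vt vy : ℝ → ℝ → ℝ) (hvt : ∀ t y, HasDerivAt (fun s => v s y) (vt t y) t)
    (hvy : ∀ t y, HasDerivAt (fun z => v t z) (vy t y) y)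
    (Bd : ℝ) (hb : ∀ t y, |v t y| ≤ Bd) (α β : ℝ) (H : ℝ × ℝ → ℝ) (hH : Integrable H)
    (n : NNReal) (κ : ℝ) (hκ : 0 ≤ κ) (t1 t2 a b : ℝ) (ht12 : t1 ≤ t2) (hab : a ≤ b)
    (hsh1 : b - a ≤ κ * (t2 - t1)) (hsh2 : t2 - t1 ≤ κ * (b - a))
    (K : Set (ℝ × ℝ)) (hK : IsClosed K)
    (hK0 : ∀ s1 s2 c d, t1 ≤ s1 → s1 ≤ s2 → s2 ≤ t2 → a ≤ c → c ≤ d → d ≤ b →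
      (∀ x ∈ K, x ∉ Icc s1 s2 ×ˢ Icc c d) → auxQ v α β H s1 s2 c d = 0)
    (hKt : ∀ x ∈ K, x ∈ Icc t1 t2 ×ˢ Icc a b →
      ∀ s ∈ Icc t1 t2, |v s x.2 - v x.1 x.2| ≤ n * |s - x.1|)
    (hKy : ∀ x ∈ K, x ∈ Icc t1 t2 ×ˢ Icc a b →
      ∀ z ∈ Icc a b, |v x.1 z - v x.1 x.2| ≤ n * |z - x.2|)
    (hKbt : ∀ x ∈ K, x ∈ Icc t1 t2 ×ˢ Icc a b → |vt x.1 x.2| ≤ n)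
    (hKby : ∀ x ∈ K, x ∈ Icc t1 t2 ×ˢ Icc a b → |vy x.1 x.2| ≤ n)
    (hHeq : ∀ x ∈ K, x ∈ Icc t1 t2 ×ˢ Icc a b → H x = α * vt x.1 x.2 + β * vy x.1 x.2)
    (hne : (K ∩ Icc t1 t2 ×ˢ Icc a b).Nonempty) :
    |auxQ v α β H t1 t2 a b| ≤
      ∫ x in (Icc t1 t2 ×ˢ Icc a b) \ K, ((|α| + |β|) * (n * (3 * κ + 1)) + |H x|) := by
  have hct : ∀ y, Continuous fun s => v s y :=
    fun y => continuous_iff_continuousAt.2 fun t => (hvt t y).continuousAt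
  have hcy : ∀ t, Continuous (v t) :=
    fun t => continuous_iff_continuousAt.2 fun y => (hvy t y).continuousAt
  have hmt := (aux_meas_t v vt hvt hcy).2
  have hmy : Measurable (fun x : ℝ × ℝ => vy x.1 x.2) :=
    (aux_meas_t (fun y t => v t y) (fun y t => vy t y) (fun y t => hvy t y) hct).2.comp measurable_swap
  set R : Set (ℝ × ℝ) := Icc t1 t2 ×ˢ Icc a b with hR
  have hRc : IsCompact R := isCompact_Icc.prod isCompact_Icc
  have hK'c : IsCompact (K ∩ R) := hRc.inter_left hK
  obtain ⟨k1, hk1, hk1m⟩ := hK'c.exists_isMinOn hne continuous_fst.continuousOn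
  obtain ⟨k2, hk2, hk2m⟩ := hK'c.exists_isMaxOn hne continuous_fst.continuousOn
  obtain ⟨k3, hk3, hk3m⟩ := hK'c.exists_isMinOn hne continuous_snd.continuousOn
  obtain ⟨k4, hk4, hk4m⟩ := hK'c.exists_isMaxOn hne continuous_snd.continuousOn
  rw [isMinOn_iff] at hk1m hk3m
  rw [isMaxOn_iff] at hk2m hk4m
  have ht1 : t1 ≤ k1.1 := hk1.2.1.1
  have ht2 : k1.1 ≤ k2.1 := hk1m _ hk2
  have ht3 : k2.1 ≤ t2 := hk2.2.1.2
  have hy1 : a ≤ k3.2 := hk3.2.2.1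
  have hy2 : k3.2 ≤ k4.2 := hk3m _ hk4
  have hy3 : k4.2 ≤ b := hk4.2.2.2
  set K' := K ∩ R with hK'
  have hKs : K' ⊆ Icc k1.1 k2.1 ×ˢ Icc k3.2 k4.2 :=
    fun x hx => ⟨⟨hk1m x hx, hk2m x hx⟩, ⟨hk3m x hx, hk4m x hx⟩⟩
  have eT := aux_est_t v vt hvt hcy hmt n κ hκ t1 t2 a b k1.1 k2.1 k3.2 k4.2
    ⟨ht1, ht2, ht3⟩ ⟨hy1, hy2, hy3⟩ hsh1 K' hK'c.isClosed hKs
    (fun x hx => hKt x hx.1 hx.2) (fun x hx => hKy x hx.1 hx.2) (fun x hx => hKbt x hx.1 hx.2)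
    k1 k2 hk1 rfl hk2 rfl
  have eY := aux_est_y v vy hvy hct hmy n κ hκ t1 t2 a b k1.1 k2.1 k3.2 k4.2
    ⟨ht1, ht2, ht3⟩ ⟨hy1, hy2, hy3⟩ hsh2 K' hK'c.isClosed hKs
    (fun x hx => hKt x hx.1 hx.2) (fun x hx => hKy x hx.1 hx.2) (fun x hx => hKby x hx.1 hx.2)
    k3 k4 hk3 rfl hk4 rfl
  have hRK : R \ K' = R \ K := by
    ext x
    constructor
    · rintro ⟨h1, h2⟩
      exact ⟨h1, fun h => h2 ⟨h, h1⟩⟩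
    · rintro ⟨h1, h2⟩
      exact ⟨h1, fun h => h2 h.1⟩
  rw [← hR, hRK] at eT eY
  -- outer pieces
  have q1 : auxQ v α β H t1 k1.1 a b = 0 := by
    apply auxQ_strip_t v hct hcy Bd hb α β H hH _ _ _ _ ht1
    intro s' t' h1 h2 h3
    refine hK0 s' t' a b h1.le h2 (by linarith) le_rfl hab le_rfl fun x hx hxr => ?_
    have := hk1m x ⟨hx, ⟨⟨by linarith [hxr.1.1], by linarith [hxr.1.2]⟩, hxr.2⟩⟩
    linarith [hxr.1.2]
  have q2 : auxQ v α β H k2.1 t2 a b = 0 := by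
    apply auxQ_strip_t v hct hcy Bd hb α β H hH _ _ _ _ ht3
    intro s' t' h1 h2 h3
    refine hK0 s' t' a b (by linarith) h2 h3.le le_rfl hab le_rfl fun x hx hxr => ?_
    have := hk2m x ⟨hx, ⟨⟨by linarith [hxr.1.1], by linarith [hxr.1.2]⟩, hxr.2⟩⟩
    linarith [hxr.1.1]
  have q3 : auxQ v α β H k1.1 k2.1 a k3.2 = 0 := by
    apply auxQ_strip_y v hct hcy Bd hb α β H hH _ _ _ _ hy1
    intro s' t' h1 h2 h3
    refine hK0 k1.1 k2.1 s' t' ht1 ht2 ht3 h1.le h2 (by linarith) fun x hx hxr => ?_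
    have := hk3m x ⟨hx, ⟨⟨by linarith [hxr.1.1], by linarith [hxr.1.2]⟩,
      ⟨by linarith [hxr.2.1], by linarith [hxr.2.2]⟩⟩⟩
    linarith [hxr.2.2]
  have q4 : auxQ v α β H k1.1 k2.1 k4.2 b = 0 := by
    apply auxQ_strip_y v hct hcy Bd hb α β H hH _ _ _ _ hy3
    intro s' t' h1 h2 h3
    refine hK0 k1.1 k2.1 s' t' ht1 ht2 ht3 (by linarith) h2 h3.le fun x hx hxr => ?_
    have := hk4m x ⟨hx, ⟨⟨by linarith [hxr.1.1], by linarith [hxr.1.2]⟩,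
      ⟨by linarith [hxr.2.1], by linarith [hxr.2.2]⟩⟩⟩
    linarith [hxr.2.1]
  have hq : auxQ v α β H t1 t2 a b = auxQ v α β H k1.1 k2.1 k3.2 k4.2 := by
    rw [auxQ_add_t v hct hcy α β H hH t1 k1.1 t2 a b ht1 (ht2.trans ht3),
      auxQ_add_t v hct hcy α β H hH k1.1 k2.1 t2 a b ht2 ht3,
      auxQ_add_y v hct hcy α β H hH k1.1 k2.1 a k3.2 b hy1 (hy2.trans hy3),
      auxQ_add_y v hct hcy α β H hH k1.1 k2.1 k3.2 k4.2 b hy2 hy3, q1, q2, q3, q4]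
    ring
  -- integral over the trace of K
  have hRfin : volume R < ⊤ := hRc.measure_lt_top
  have hK'm : MeasurableSet K' := hK'c.isClosed.measurableSet
  have hK'fin : volume K' ≠ ⊤ := hK'c.measure_lt_top.ne
  have it : IntegrableOn (fun x : ℝ × ℝ => vt x.1 x.2) K' :=
    Measure.integrableOn_of_bounded (M := n) hK'fin hmt.aestronglyMeasurable
      ((ae_restrict_iff' hK'm).2 (Filter.Eventually.of_forall fun x hx => hKbt x hx.1 hx.2))
  have iy : IntegrableOn (fun x : ℝ × ℝ => vy x.1 x.2) K' :=
    Measure.integrableOn_of_bounded (M := n) hK'fin hmy.aestronglyMeasurable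
      ((ae_restrict_iff' hK'm).2 (Filter.Eventually.of_forall fun x hx => hKby x hx.1 hx.2))
  have eK : ∫ x in K', H x = α * (∫ x in K', vt x.1 x.2) + β * ∫ x in K', vy x.1 x.2 := by
    rw [← integral_const_mul, ← integral_const_mul, ← integral_add (it.const_mul α) (iy.const_mul β)]
    exact setIntegral_congr_fun hK'm fun x hx => hHeq x hx.1 hx.2
  have hsub : (Icc k1.1 k2.1 ×ˢ Icc k3.2 k4.2 : Set (ℝ × ℝ)) ⊆ R :=
    Set.prod_mono (Icc_subset_Icc ht1 ht3) (Icc_subset_Icc hy1 hy3)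
  have eH : |(∫ x in Ioc k1.1 k2.1 ×ˢ Ioc k3.2 k4.2, H x) - ∫ x in K', H x|
      ≤ ∫ x in R \ K, |H x| := by
    rw [setIntegral_congr_set (aux_rect_ae _ _ _ _),
      ← setIntegral_sdiff hK'm hH.integrableOn hKs, ← hRK]
    refine (abs_integral_le_integral_abs).trans ?_
    exact setIntegral_mono_set hH.abs.integrableOn (Filter.Eventually.of_forall fun x => abs_nonneg _)
      (sdiff_subset_sdiff_left hsub).eventuallyLE
  have hfin2 : volume (R \ K) ≠ ⊤ := ((measure_mono sdiff_subset).trans_lt hRfin).ne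
  have ic : IntegrableOn (fun _ : ℝ × ℝ => (|α| + |β|) * (n * (3 * κ + 1) : ℝ)) (R \ K) := integrableOn_const hfin2
  rw [integral_add ic hH.abs.integrableOn]
  simp only [integral_const, MeasurableSet.univ, measureReal_restrict_apply, univ_inter, smul_eq_mul]
  rw [hq, auxQ]
  set V := volume.real (R \ K)
  set I1 := ∫ y in k3.2..k4.2, (v k2.1 y - v k1.1 y)
  set I2 := ∫ r in k1.1..k2.1, (v r k4.2 - v r k3.2)
  set I3 := ∫ x in Ioc k1.1 k2.1 ×ˢ Ioc k3.2 k4.2, H x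
  have : α * I1 + β * I2 - I3 = α * (I1 - ∫ x in K', vt x.1 x.2) + β * (I2 - ∫ x in K', vy x.1 x.2)
      - (I3 - ∫ x in K', H x) := by
    rw [eK]; ring
  rw [this]
  refine (abs_sub _ _).trans ?_
  have a1 : |α * (I1 - ∫ x in K', vt x.1 x.2) + β * (I2 - ∫ x in K', vy x.1 x.2)|
      ≤ |α| * (n * (3 * κ + 1) * V) + |β| * (n * (3 * κ + 1) * V) := by
    refine (abs_add_le _ _).trans ?_
    rw [abs_mul, abs_mul]
    gcongr
  linarith

lemma aux_rect_ball (t1 t2 a b δ : ℝ) (x : ℝ × ℝ) (hx : x ∈ Icc t1 t2 ×ˢ Icc a b)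
    (h1 : t2 - t1 < δ) (h2 : b - a < δ) : Icc t1 t2 ×ˢ Icc a b ⊆ Metric.ball x δ := by
  intro y hy
  rw [Metric.mem_ball, Prod.dist_eq, max_lt_iff, Real.dist_eq, Real.dist_eq, abs_lt, abs_lt]
  refine ⟨⟨?_, ?_⟩, ?_, ?_⟩ <;>
    linarith [hx.1.1, hx.1.2, hx.2.1, hx.2.2, hy.1.1, hy.1.2, hy.2.1, hy.2.2]

lemma aux_scale (x δ : ℝ) (hδ : 0 < δ) : ∃ N : ℕ, ∀ k ≥ N, x / 2 ^ k < δ := by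
  have h : Filter.Tendsto (fun k : ℕ => x / 2 ^ k) Filter.atTop (nhds 0) := by
    have := (tendsto_pow_atTop_nhds_zero_of_lt_one (r := (1 / 2 : ℝ)) (by norm_num) (by norm_num)).const_mul x
    rw [mul_zero] at this
    refine this.congr fun k => ?_
    rw [one_div, inv_pow, div_eq_mul_inv]
  exact Filter.eventually_atTop.1 (h.eventually_lt_const hδ)

lemma aux_local (q : ℝ → ℝ → ℝ → ℝ → ℝ)
    (hqt : ∀ t1 t2 t3 a b, t1 ≤ t2 → t2 ≤ t3 → q t1 t3 a b = q t1 t2 a b + q t2 t3 a b)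
    (hqy : ∀ t1 t2 a b c, a ≤ b → b ≤ c → q t1 t2 a c = q t1 t2 a b + q t1 t2 b c)
    (X : Set (ℝ × ℝ)) (t1 t2 a b : ℝ) (h12 : t1 ≤ t2) (hab : a ≤ b) (hX : Icc t1 t2 ×ˢ Icc a b ⊆ X)
    (hg : ∀ x ∈ Icc t1 t2 ×ˢ Icc a b, ∃ ε > 0, ∀ s1 s2 c d, s1 ≤ s2 → c ≤ d →
      Icc s1 s2 ×ˢ Icc c d ⊆ X → Icc s1 s2 ×ˢ Icc c d ⊆ Metric.ball x ε → q s1 s2 c d = 0) :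
    q t1 t2 a b = 0 := by
  have hc : IsCompact (Icc t1 t2 ×ˢ Icc a b) := isCompact_Icc.prod isCompact_Icc
  choose! ε hε hq using hg
  obtain ⟨δ, hδ, hδ2⟩ := lebesgue_number_lemma_of_metric hc
    (c := fun x : (Icc t1 t2 ×ˢ Icc a b : Set (ℝ × ℝ)) => Metric.ball (x : ℝ × ℝ) (ε x))
    (fun i => Metric.isOpen_ball)
    (fun x hx => mem_iUnion.2 ⟨⟨x, hx⟩, Metric.mem_ball_self (hε x hx)⟩)
  obtain ⟨N1, hN1⟩ := aux_scale (t2 - t1) δ hδ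
  obtain ⟨N2, hN2⟩ := aux_scale (b - a) δ hδ
  have := aux_bisect q hqt hqy 0 (max N1 N2) t1 t2 a b h12 hab ?_
  · simpa using this
  · intro t1' t2' a' b' g1 g2 g3 g4 g5 g6 g7 g8
    have hx : ((t1', a') : ℝ × ℝ) ∈ Icc t1 t2 ×ˢ Icc a b :=
      ⟨⟨g1, g2.trans g3⟩, ⟨g4, g5.trans g6⟩⟩
    obtain ⟨i, hi⟩ := hδ2 _ hx
    have hsub : (Icc t1' t2' ×ˢ Icc a' b' : Set (ℝ × ℝ)) ⊆ Icc t1 t2 ×ˢ Icc a b :=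
      Set.prod_mono (Icc_subset_Icc g1 g3) (Icc_subset_Icc g4 g6)
    rw [hq i i.2 t1' t2' a' b' g2 g5 (hsub.trans hX) ((aux_rect_ball t1' t2' a' b' δ (t1', a')
      ⟨⟨le_rfl, g2⟩, ⟨le_rfl, g5⟩⟩ (by rw [g7]; exact hN1 _ (le_max_left _ _))
      (by rw [g8]; exact hN2 _ (le_max_right _ _))).trans hi)]
    simp

open Filter Topology in
lemma aux_LM (v vt vy : ℝ → ℝ → ℝ) (hvt : ∀ t y, HasDerivAt (fun s => v s y) (vt t y) t)
    (hvy : ∀ t y, HasDerivAt (fun z => v t z) (vy t y) y)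
    (Bd : ℝ) (hb : ∀ t y, |v t y| ≤ Bd) (α β : ℝ) (H : ℝ × ℝ → ℝ) (hH : Integrable H)
    (T1 T2 A B : ℝ) (hT : T1 ≤ T2) (hAB : A ≤ B)
    (hHeq : ∀ x ∈ Icc T1 T2 ×ˢ Icc A B, H x = α * vt x.1 x.2 + β * vy x.1 x.2) :
    auxQ v α β H T1 T2 A B = 0 := by
  have hct : ∀ y, Continuous fun s => v s y :=
    fun y => continuous_iff_continuousAt.2 fun t => (hvt t y).continuousAt
  have hcy : ∀ t, Continuous (v t) :=
    fun t => continuous_iff_continuousAt.2 fun y => (hvy t y).continuousAt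
  set X : Set (ℝ × ℝ) := Icc T1 T2 ×ˢ Icc A B with hX
  set q := auxQ v α β H with hqdef
  have hqt := auxQ_add_t v hct hcy α β H hH
  have hqy := auxQ_add_y v hct hcy α β H hH
  set good : ℝ × ℝ → Prop := fun x => ∃ ε > 0, ∀ s1 s2 c d, s1 ≤ s2 → c ≤ d →
      Icc s1 s2 ×ˢ Icc c d ⊆ X → Icc s1 s2 ×ˢ Icc c d ⊆ Metric.ball x ε → q s1 s2 c d = 0 with hgood
  have hloc : ∀ t1 t2 a b, t1 ≤ t2 → a ≤ b → Icc t1 t2 ×ˢ Icc a b ⊆ X →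
      (∀ x ∈ Icc t1 t2 ×ˢ Icc a b, good x) → q t1 t2 a b = 0 :=
    fun t1 t2 a b h1 h2 h3 h4 => aux_local q hqt hqy X t1 t2 a b h1 h2 h3 h4
  have hopen : IsOpen {x | good x} := by
    rw [Metric.isOpen_iff]
    rintro x ⟨ε, hε, hx⟩
    refine ⟨ε / 2, by positivity, fun y hy => ⟨ε / 2, by positivity, ?_⟩⟩
    intro s1 s2 c d g1 g2 g3 g4
    refine hx s1 s2 c d g1 g2 g3 (g4.trans (Metric.ball_subset_ball' ?_))
    rw [Metric.mem_ball] at hy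
    linarith
  set K : Set (ℝ × ℝ) := X ∩ {x | good x}ᶜ with hK
  have hKcl : IsClosed K := (isClosed_Icc.prod isClosed_Icc).inter hopen.isClosed_compl
  have hloc' : ∀ t1 t2 a b, t1 ≤ t2 → a ≤ b → Icc t1 t2 ×ˢ Icc a b ⊆ X →
      (∀ x ∈ K, x ∉ Icc t1 t2 ×ˢ Icc a b) → q t1 t2 a b = 0 := by
    intro t1 t2 a b h1 h2 h3 h4
    refine hloc t1 t2 a b h1 h2 h3 fun x hx => ?_
    by_contra hc
    exact h4 x ⟨h3 hx, hc⟩ hx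
  by_cases hKe : K.Nonempty
  swap
  · refine hloc' T1 T2 A B hT hAB le_rfl fun x hx => (hKe ⟨x, hx⟩).elim
  exfalso
  obtain ⟨x0, hx0, ε, hε, n, hn⟩ := aux_baire K hKcl hKe
    (fun n : ℕ => {x : ℝ × ℝ |
      (∀ s, |s - x.1| < 1 / ((n : ℝ) + 1) → |v s x.2 - v x.1 x.2| ≤ n * |s - x.1|) ∧
      (∀ z, |z - x.2| < 1 / ((n : ℝ) + 1) → |v x.1 z - v x.1 x.2| ≤ n * |z - x.2|)})
    (fun n => aux_Fn_closed v hct hcy n _ (by positivity))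
    (by
      intro x _
      obtain ⟨N1, h1⟩ := aux_lip_pt _ _ _ (hvt x.1 x.2)
      obtain ⟨N2, h2⟩ := aux_lip_pt _ _ _ (hvy x.1 x.2)
      exact ⟨max N1 N2, h1 _ (le_max_left _ _), h2 _ (le_max_right _ _)⟩)
  apply hx0.2
  set δ0 : ℝ := 1 / ((n : ℝ) + 1) with hδ0
  have hδ0p : 0 < δ0 := by positivity
  refine ⟨min ε (δ0 / 2), by positivity, ?_⟩
  intro t1 t2 a b h12 hab hRX hRb
  rcases eq_or_lt_of_le h12 with rfl | h12'
  · exact auxQ_deg_t v α β H _ _ _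
  rcases eq_or_lt_of_le hab with rfl | hab'
  · exact auxQ_deg_y v α β H _ _ _
  set R : Set (ℝ × ℝ) := Icc t1 t2 ×ˢ Icc a b with hR
  set κ : ℝ := max ((b - a) / (t2 - t1)) ((t2 - t1) / (b - a)) with hκ
  have hL1 : 0 < t2 - t1 := by linarith
  have hL2 : 0 < b - a := by linarith
  have hκ0 : 0 ≤ κ := le_max_of_le_left (by positivity)
  have hsh1 : b - a ≤ κ * (t2 - t1) := by
    rw [← div_le_iff₀ hL1]; exact le_max_left _ _
  have hsh2 : t2 - t1 ≤ κ * (b - a) := by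
    rw [← div_le_iff₀ hL2]; exact le_max_right _ _
  -- properties of points of K in R
  have hFK : ∀ x ∈ K, x ∈ R → (∀ s, |s - x.1| < δ0 → |v s x.2 - v x.1 x.2| ≤ n * |s - x.1|) ∧
      (∀ z, |z - x.2| < δ0 → |v x.1 z - v x.1 x.2| ≤ n * |z - x.2|) := by
    intro x hx hxR
    exact hn x hx (lt_of_lt_of_le (Metric.mem_ball.1 (hRb hxR)) (min_le_left _ _))
  have hdist : ∀ x ∈ R, ∀ y ∈ R, |x.1 - y.1| < δ0 ∧ |x.2 - y.2| < δ0 := by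
    intro x hx y hy
    have h1 := lt_of_lt_of_le (Metric.mem_ball.1 (hRb hx)) (min_le_right _ _)
    have h2 := lt_of_lt_of_le (Metric.mem_ball.1 (hRb hy)) (min_le_right _ _)
    have h3 : dist x y < δ0 := by linarith [dist_triangle_right x y x0]
    rw [Prod.dist_eq, max_lt_iff] at h3
    exact h3
  set Cst : ℝ := (|α| + |β|) * (((n : NNReal) : ℝ) * (3 * κ + 1)) with hCst
  have hCst0 : 0 ≤ Cst := by positivity
  set h : ℝ × ℝ → ℝ := fun x => Cst + |H x| with hh
  have hh0 : ∀ x, 0 ≤ h x := fun x => add_nonneg hCst0 (abs_nonneg _)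
  have hRm : MeasurableSet (R \ K) := (measurableSet_Icc.prod measurableSet_Icc).diff hKcl.measurableSet
  have hRfin : volume (R \ K) ≠ ⊤ :=
    ((measure_mono sdiff_subset).trans_lt (isCompact_Icc.prod isCompact_Icc).measure_lt_top).ne
  have hhi : IntegrableOn h (R \ K) := by
    have ic : IntegrableOn (fun _ : ℝ × ℝ => Cst) (R \ K) := integrableOn_const hRfin
    exact ic.add hH.abs.integrableOn
  set μ0 : Measure (ℝ × ℝ) := (volume.restrict (R \ K)).withDensity (fun x => ENNReal.ofReal (h x)) with hμ0
  haveI : IsFiniteMeasure μ0 := isFiniteMeasure_withDensity_ofReal hhi.2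
  have hμS : ∀ S, MeasurableSet S → μ0.real S = ∫ x in S ∩ (R \ K), h x := by
    intro S hS
    rw [measureReal_def, hμ0, withDensity_apply _ hS, Measure.restrict_restrict hS,
      ← ofReal_integral_eq_lintegral_ofReal (hhi.mono_set inter_subset_right)
        (Eventually.of_forall hh0), ENNReal.toReal_ofReal (integral_nonneg hh0)]
  have main : ∀ δ > 0, |q t1 t2 a b| ≤ μ0.real (Metric.thickening δ K) := by
    intro δ hδ
    obtain ⟨N1, hN1⟩ := aux_scale (t2 - t1) δ hδ
    obtain ⟨N2, hN2⟩ := aux_scale (b - a) δ hδ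
    have hb := aux_bisect q hqt hqy (μ0.restrict (Metric.thickening δ K)) (max N1 N2)
      t1 t2 a b h12 hab ?_
    · refine hb.trans ?_
      rw [measureReal_restrict_apply (measurableSet_Ioc.prod measurableSet_Ioc)]
      exact measureReal_mono inter_subset_right (measure_ne_top _ _)
    · intro t1' t2' a' b' g1 g2 g3 g4 g5 g6 g7 g8
      have hsub : (Icc t1' t2' ×ˢ Icc a' b' : Set (ℝ × ℝ)) ⊆ R :=
        Set.prod_mono (Icc_subset_Icc g1 g3) (Icc_subset_Icc g4 g6)
      by_cases hne : (K ∩ Icc t1' t2' ×ˢ Icc a' b').Nonempty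
      swap
      · rw [hloc' t1' t2' a' b' g2 g5 (hsub.trans hRX) fun x hx hxr => hne ⟨x, hx, hxr⟩]
        simp
      have hest := aux_sub_est v vt vy hvt hvy Bd hb α β H hH (n : NNReal) κ hκ0 t1' t2' a' b' g2 g5
        (by rw [g7, g8, ← mul_div_assoc]; gcongr)
        (by rw [g7, g8, ← mul_div_assoc]; gcongr) K hKcl
        (fun s1 s2 c d e1 e2 e3 e4 e5 e6 e7 => hloc' s1 s2 c d e2 e5
          ((Set.prod_mono (Icc_subset_Icc e1 e3) (Icc_subset_Icc e4 e6)).trans (hsub.trans hRX)) e7)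
        (fun x hx hxr s hs => by
          simpa using (hFK x hx (hsub hxr)).1 s
            (hdist (s, x.2) (hsub ⟨hs, hxr.2⟩) x (hsub hxr)).1)
        (fun x hx hxr s hs => by
          simpa using (hFK x hx (hsub hxr)).2 s
            (hdist (x.1, s) (hsub ⟨hxr.1, hs⟩) x (hsub hxr)).2)
        (fun x hx hxr => by
          simpa using aux_deriv_bd _ _ _ n δ0 (by positivity) (hvt x.1 x.2) hδ0p (hFK x hx (hsub hxr)).1)
        (fun x hx hxr => by
          simpa using aux_deriv_bd _ _ _ n δ0 (by positivity) (hvy x.1 x.2) hδ0p (hFK x hx (hsub hxr)).2)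
        (fun x hx _ => hHeq x hx.1) hne
      refine hest.trans (le_of_eq ?_)
      have hthick : (Icc t1' t2' ×ˢ Icc a' b' : Set (ℝ × ℝ)) ⊆ Metric.thickening δ K := by
        obtain ⟨z, hzK, hzr⟩ := hne
        exact (aux_rect_ball t1' t2' a' b' δ z hzr (by rw [g7]; exact hN1 _ (le_max_left _ _))
          (by rw [g8]; exact hN2 _ (le_max_right _ _))).trans (Metric.ball_subset_thickening hzK δ)
      have hS : MeasurableSet (Ioc t1' t2' ×ˢ Ioc a' b' : Set (ℝ × ℝ)) :=
        measurableSet_Ioc.prod measurableSet_Ioc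
      have hIoc : (Ioc t1' t2' ×ˢ Ioc a' b' : Set (ℝ × ℝ)) ⊆ Icc t1' t2' ×ˢ Icc a' b' :=
        Set.prod_mono Ioc_subset_Icc_self Ioc_subset_Icc_self
      rw [measureReal_restrict_apply hS, inter_eq_left.2 (hIoc.trans hthick), hμS _ hS]
      have e1 : ((Ioc t1' t2' ×ˢ Ioc a' b') ∩ (R \ K) : Set (ℝ × ℝ)) = (Ioc t1' t2' ×ˢ Ioc a' b') ∩ Kᶜ := by
        ext x
        constructor
        · rintro ⟨p1, p2⟩
          exact ⟨p1, p2.2⟩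
        · rintro ⟨p1, p2⟩
          exact ⟨p1, hsub (hIoc p1), p2⟩
      rw [e1, sdiff_eq]
      exact setIntegral_congr_set ((aux_rect_ae t1' t2' a' b').symm.inter (ae_eq_refl _))
  have hlim := tendsto_measure_thickening_of_isClosed (μ := μ0) ⟨1, one_pos, measure_ne_top _ _⟩ hKcl
  have hK0 : μ0.real K = 0 := by
    rw [hμS K hKcl.measurableSet]
    simp
  have hlim2 : Tendsto (fun r => μ0.real (Metric.thickening r K)) (𝓝[>] 0) (𝓝 0) := by
    have := (ENNReal.tendsto_toReal (measure_ne_top μ0 K)).comp hlim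
    rw [← measureReal_def, hK0] at this
    exact this
  have : |q t1 t2 a b| ≤ 0 := ge_of_tendsto hlim2 (by
    filter_upwards [self_mem_nhdsWithin] with r hr using main r hr)
  exact abs_eq_zero.1 (le_antisymm this (abs_nonneg _))

noncomputable def auxB (ε x : ℝ) : ℝ := x ^ 2 / (1 + ε * x ^ 2)
noncomputable def auxB' (ε x : ℝ) : ℝ := 2 * x / (1 + ε * x ^ 2) ^ 2

lemma auxB_deriv (ε x : ℝ) (hε : 0 < ε) : HasDerivAt (auxB ε) (auxB' ε x) x := by
  have h1 : HasDerivAt (fun x : ℝ => x ^ 2) (2 * x) x := by simpa using hasDerivAt_pow 2 x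
  have hp : 0 < 1 + ε * x ^ 2 := by positivity
  have h2 : HasDerivAt (fun x : ℝ => 1 + ε * x ^ 2) (ε * (2 * x)) x := (h1.const_mul ε).const_add 1
  have h3 := h1.div h2 hp.ne'
  convert! h3 using 1
  rw [auxB']
  congr 1
  ring

lemma auxB_nonneg (ε x : ℝ) (hε : 0 < ε) : 0 ≤ auxB ε x := by unfold auxB; positivity

lemma auxB_le_sq (ε x : ℝ) (hε : 0 < ε) : auxB ε x ≤ x ^ 2 := by
  unfold auxB
  apply div_le_self (by positivity)
  have : 0 ≤ ε * x ^ 2 := by positivity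
  linarith

lemma auxB_le (ε x : ℝ) (hε : 0 < ε) : auxB ε x ≤ 1 / ε := by
  unfold auxB
  rw [div_le_div_iff₀ (by positivity) hε]
  linarith

lemma auxB'_le (ε x : ℝ) (hε : 0 < ε) : |auxB' ε x| ≤ 2 * |x| := by
  unfold auxB'
  have : 0 ≤ ε * x ^ 2 := by positivity
  rw [abs_div, abs_mul, abs_two, abs_of_nonneg (by positivity : 0 ≤ (1 + ε * x ^ 2) ^ 2)]
  apply div_le_self (by positivity)
  nlinarith

lemma auxB_meas (ε : ℝ) : Measurable (auxB ε) := by unfold auxB; fun_prop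
lemma auxB'_meas (ε : ℝ) : Measurable (auxB' ε) := by unfold auxB'; fun_prop

lemma aux_bF (ε x F : ℝ) (hε : 0 < ε) : |auxB' ε x * F| ≤ x ^ 2 + F ^ 2 := by
  rw [abs_mul]
  have h1 := mul_le_mul_of_nonneg_right (auxB'_le ε x hε) (abs_nonneg F)
  have h2 := sq_nonneg (|x| - |F|)
  rw [sub_sq, sq_abs, sq_abs] at h2
  linarith

lemma aux_volstrip (S : Set ℝ) : (volume : Measure (ℝ × ℝ)).restrict (S ×ˢ univ) =
    (volume.restrict S).prod volume := by
  rw [Measure.volume_eq_prod, ← Measure.prod_restrict, Measure.restrict_univ]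

open Filter Topology in
lemma aux_trans1 (p pt py F : ℝ → ℝ → ℝ) (hpt : ∀ t y, HasDerivAt (fun s => p s y) (pt t y) t)
    (hpy : ∀ t y, HasDerivAt (fun z => p t z) (py t y) y) (β s t : ℝ) (hst : s ≤ t)
    (hF : Measurable fun x : ℝ × ℝ => F x.1 x.2)
    (heq : ∀ r ∈ Icc s t, ∀ y, pt r y + β * py r y = F r y)
    (hp2 : IntegrableOn (fun x : ℝ × ℝ => p x.1 x.2 ^ 2) (Icc s t ×ˢ univ))
    (hF2 : IntegrableOn (fun x : ℝ × ℝ => F x.1 x.2 ^ 2) (Icc s t ×ˢ univ))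
    (hs : Integrable fun y => p s y ^ 2) (ht : Integrable fun y => p t y ^ 2)
    (ε : ℝ) (hε : 0 < ε) :
    (∫ y, auxB ε (p t y)) - ∫ y, auxB ε (p s y) =
      ∫ x in Icc s t ×ˢ univ, auxB' ε (p x.1 x.2) * F x.1 x.2 := by
  have hcy : ∀ t, Continuous (p t) :=
    fun t => continuous_iff_continuousAt.2 fun y => (hpy t y).continuousAt
  have hpm : Measurable fun x : ℝ × ℝ => p x.1 x.2 := (aux_meas_t p pt hpt hcy).1
  set S : Set (ℝ × ℝ) := Icc s t ×ˢ univ with hS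
  have hSm : MeasurableSet S := measurableSet_Icc.prod MeasurableSet.univ
  set H0 : ℝ × ℝ → ℝ := fun x => auxB' ε (p x.1 x.2) * F x.1 x.2 with hH0
  have hH0i : IntegrableOn H0 S := by
    refine Integrable.mono' (hp2.add hF2) (((auxB'_meas ε).comp hpm).mul hF).aestronglyMeasurable ?_
    exact Eventually.of_forall fun x => aux_bF ε _ _ hε
  have hHi : Integrable (S.indicator H0) := (integrable_indicator_iff hSm).2 hH0i
  have hLM : ∀ R : ℝ, 0 ≤ R → auxQ (fun r y => auxB ε (p r y)) 1 β (S.indicator H0) s t (-R) R = 0 := by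
    intro R hR
    refine aux_LM (fun r y => auxB ε (p r y)) (fun r y => auxB' ε (p r y) * pt r y)
      (fun r y => auxB' ε (p r y) * py r y)
      (fun r y => HasDerivAt.comp (h₂ := auxB ε) (h := fun s => p s y) r (auxB_deriv ε (p r y) hε) (hpt r y))
      (fun r y => HasDerivAt.comp (h₂ := auxB ε) (h := fun z => p r z) y (auxB_deriv ε (p r y) hε) (hpy r y)) (1 / ε)
      (fun r y => by rw [abs_of_nonneg (auxB_nonneg _ _ hε)]; exact auxB_le _ _ hε)
      1 β _ hHi s t (-R) R hst (by linarith) ?_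
    intro x hx
    rw [indicator_of_mem (show x ∈ S from ⟨hx.1, trivial⟩)]
    simp only [hH0]
    rw [← heq x.1 hx.1 x.2]
    ring
  have hbi : ∀ r, Integrable (fun y => p r y ^ 2) → Integrable fun y => auxB ε (p r y) := by
    intro r hr
    refine hr.mono' ((auxB_meas ε).comp (hcy r).measurable).aestronglyMeasurable ?_
    refine Eventually.of_forall fun y => ?_
    rw [Real.norm_eq_abs, abs_of_nonneg (auxB_nonneg _ _ hε)]
    exact auxB_le_sq _ _ hε
  have hl1 : Tendsto (fun R : ℝ => ∫ y in (-R)..R, (auxB ε (p t y) - auxB ε (p s y))) atTop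
      (𝓝 (∫ y, (auxB ε (p t y) - auxB ε (p s y)))) :=
    intervalIntegral_tendsto_integral ((hbi t ht).sub (hbi s hs)) tendsto_neg_atTop_atBot tendsto_id
  have hl3 : Tendsto (fun R : ℝ => ∫ x in Ioc s t ×ˢ Ioc (-R) R, S.indicator H0 x) atTop
      (𝓝 (∫ x in S, H0 x)) := by
    have h1 := tendsto_setIntegral_of_monotone (μ := volume) (f := S.indicator H0)
      (s := fun R : ℝ => (Ioc s t ×ˢ Ioc (-R) R : Set (ℝ × ℝ)))
      (fun R => measurableSet_Ioc.prod measurableSet_Ioc)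
      (fun R R' h => Set.prod_mono le_rfl (Ioc_subset_Ioc (by linarith) h)) hHi.integrableOn
    have h2 : (⋃ R : ℝ, (Ioc s t ×ˢ Ioc (-R) R : Set (ℝ × ℝ))) = Ioc s t ×ˢ univ := by
      ext x
      simp only [mem_iUnion, mem_prod, mem_univ, and_true]
      constructor
      · rintro ⟨R, h, _⟩
        exact h
      · intro h
        refine ⟨|x.2| + 1, h, ?_, ?_⟩
        · linarith [neg_abs_le x.2]
        · linarith [le_abs_self x.2]
    rw [h2] at h1
    have h3 : ∫ x in Ioc s t ×ˢ univ, S.indicator H0 x = ∫ x in S, H0 x := by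
      have h4 : (Ioc s t ×ˢ univ : Set (ℝ × ℝ)) =ᵐ[volume] S := by
        rw [Measure.volume_eq_prod]
        exact Measure.set_prod_ae_eq Ioc_ae_eq_Icc (ae_eq_refl _)
      rw [setIntegral_congr_set h4, setIntegral_indicator hSm, inter_self]
    rw [h3] at h1
    exact h1
  set W : ℝ → ℝ := fun R => β * ∫ r in s..t, (auxB ε (p r R) - auxB ε (p r (-R))) with hW
  have hWi : Integrable W := by
    have h1 : Integrable (fun x : ℝ × ℝ => auxB ε (p x.1 x.2)) ((volume.restrict (Icc s t)).prod volume) := by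
      rw [← aux_volstrip]
      refine hp2.mono' ((auxB_meas ε).comp hpm).aestronglyMeasurable ?_
      refine Eventually.of_forall fun y => ?_
      rw [Real.norm_eq_abs, abs_of_nonneg (auxB_nonneg _ _ hε)]
      exact auxB_le_sq _ _ hε
    have h2 := h1.integral_prod_right
    have h3 := h2.comp_neg
    refine ((h2.sub h3).const_mul β).congr (Eventually.of_forall fun R => ?_)
    have hc : ∀ z, IntegrableOn (fun r => auxB ε (p r z)) (Icc s t) := by
      intro z
      apply ContinuousOn.integrableOn_Icc
      apply Continuous.continuousOn
      exact continuous_iff_continuousAt.2 fun r =>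
        (HasDerivAt.comp (h₂ := auxB ε) (h := fun s => p s z) r (auxB_deriv ε (p r z) hε) (hpt r z)).continuousAt
    simp only [hW, Pi.sub_apply]
    rw [intervalIntegral.integral_of_le hst, ← integral_Icc_eq_integral_Ioc, integral_sub (hc _) (hc _)]
  have hWl : Tendsto W atTop (𝓝 ((∫ x in S, H0 x) - ∫ y, (auxB ε (p t y) - auxB ε (p s y)))) := by
    refine (hl3.sub hl1).congr' ?_
    filter_upwards [eventually_ge_atTop 0] with R hR
    have := hLM R hR
    simp only [auxQ] at this
    simp only [hW]
    linarith
  have hz := IntegrableAtFilter.eq_zero_of_tendsto (μ := volume) (hWi.integrableAtFilter atTop) (by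
    intro s hs
    rcases mem_atTop_sets.1 hs with ⟨b, hb⟩
    rw [← top_le_iff, ← Real.volume_Ici (a := b)]
    exact measure_mono hb) hWl
  rw [← integral_sub (hbi t ht) (hbi s hs)]
  linarith

open Filter Topology in
lemma auxB_tendsto (x : ℝ) : Tendsto (fun n : ℕ => auxB (1 / ((n : ℝ) + 1)) x) atTop (𝓝 (x ^ 2)) := by
  have h0 : Tendsto (fun n : ℕ => 1 / ((n : ℝ) + 1)) atTop (𝓝 0) := tendsto_one_div_add_atTop_nhds_zero_nat
  have h1 : Tendsto (fun n : ℕ => 1 + 1 / ((n : ℝ) + 1) * x ^ 2) atTop (𝓝 1) := by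
    simpa using (h0.mul_const (x ^ 2)).const_add 1
  have := (tendsto_const_nhds (x := x ^ 2)).div h1 one_ne_zero
  rw [div_one] at this
  exact this

open Filter Topology in
lemma auxB'_tendsto (x : ℝ) : Tendsto (fun n : ℕ => auxB' (1 / ((n : ℝ) + 1)) x) atTop (𝓝 (2 * x)) := by
  have h0 : Tendsto (fun n : ℕ => 1 / ((n : ℝ) + 1)) atTop (𝓝 0) := tendsto_one_div_add_atTop_nhds_zero_nat
  have h1 : Tendsto (fun n : ℕ => (1 + 1 / ((n : ℝ) + 1) * x ^ 2) ^ 2) atTop (𝓝 1) := by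
    simpa using ((h0.mul_const (x ^ 2)).const_add 1).pow 2
  have := (tendsto_const_nhds (x := 2 * x)).div h1 one_ne_zero
  rw [div_one] at this
  exact this

open Filter Topology in
lemma aux_trans (p pt py F : ℝ → ℝ → ℝ) (hpt : ∀ t y, HasDerivAt (fun s => p s y) (pt t y) t)
    (hpy : ∀ t y, HasDerivAt (fun z => p t z) (py t y) y) (β s t : ℝ) (hst : s ≤ t)
    (hF : Measurable fun x : ℝ × ℝ => F x.1 x.2)
    (heq : ∀ r ∈ Icc s t, ∀ y, pt r y + β * py r y = F r y)
    (hp2 : IntegrableOn (fun x : ℝ × ℝ => p x.1 x.2 ^ 2) (Icc s t ×ˢ univ))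
    (hF2 : IntegrableOn (fun x : ℝ × ℝ => F x.1 x.2 ^ 2) (Icc s t ×ˢ univ))
    (hs : Integrable fun y => p s y ^ 2) (ht : Integrable fun y => p t y ^ 2) :
    (∫ y, p t y ^ 2) - ∫ y, p s y ^ 2 = ∫ x in Icc s t ×ˢ univ, 2 * p x.1 x.2 * F x.1 x.2 := by
  have hcy : ∀ t, Continuous (p t) :=
    fun t => continuous_iff_continuousAt.2 fun y => (hpy t y).continuousAt
  have hpm : Measurable fun x : ℝ × ℝ => p x.1 x.2 := (aux_meas_t p pt hpt hcy).1
  have hε : ∀ n : ℕ, 0 < 1 / ((n : ℝ) + 1) := fun n => by positivity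
  have hl : ∀ r, Integrable (fun y => p r y ^ 2) →
      Tendsto (fun n : ℕ => ∫ y, auxB (1 / ((n : ℝ) + 1)) (p r y)) atTop (𝓝 (∫ y, p r y ^ 2)) := by
    intro r hr
    refine tendsto_integral_of_dominated_convergence (fun y => p r y ^ 2)
      (fun n => ((auxB_meas _).comp (hcy r).measurable).aestronglyMeasurable) hr ?_ ?_
    · refine fun n => Eventually.of_forall fun y => ?_
      rw [Real.norm_eq_abs, abs_of_nonneg (auxB_nonneg _ _ (hε n))]
      exact auxB_le_sq _ _ (hε n)
    · exact Eventually.of_forall fun y => auxB_tendsto _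
  have hl2 : Tendsto (fun n : ℕ => ∫ x in Icc s t ×ˢ univ,
      auxB' (1 / ((n : ℝ) + 1)) (p x.1 x.2) * F x.1 x.2) atTop
      (𝓝 (∫ x in Icc s t ×ˢ univ, 2 * p x.1 x.2 * F x.1 x.2)) := by
    refine tendsto_integral_of_dominated_convergence (fun x => p x.1 x.2 ^ 2 + F x.1 x.2 ^ 2)
      (fun n => (((auxB'_meas _).comp hpm).mul hF).aestronglyMeasurable) (by exact Integrable.add hp2 hF2) ?_ ?_
    · exact fun n => Eventually.of_forall fun x => aux_bF _ _ _ (hε n)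
    · exact Eventually.of_forall fun x => (auxB'_tendsto _).mul_const _
  refine tendsto_nhds_unique ((hl t ht).sub (hl s hs)) (hl2.congr fun n => ?_)
  exact (aux_trans1 p pt py F hpt hpy β s t hst hF heq hp2 hF2 hs ht _ (hε n)).symm

open Filter Topology in
lemma aux_strip_int (φ : ℝ → ℝ → ℝ) (hφ : Measurable fun x : ℝ × ℝ => φ x.1 x.2)
    (hi : ∀ r, Integrable fun y => φ r y ^ 2) (s t C : ℝ) (hst : s ≤ t)
    (hC : ∀ r ∈ Icc s t, ∫ y, φ r y ^ 2 ≤ C) :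
    IntegrableOn (fun x : ℝ × ℝ => φ x.1 x.2 ^ 2) (Icc s t ×ˢ univ) ∧
      ∫ x in Icc s t ×ˢ univ, φ x.1 x.2 ^ 2 ≤ (t - s) * C := by
  have hm : AEStronglyMeasurable (fun x : ℝ × ℝ => φ x.1 x.2 ^ 2)
      ((volume.restrict (Icc s t)).prod (volume : Measure ℝ)) := (hφ.pow_const 2).aestronglyMeasurable
  have hn : ∀ r, ∫ y, ‖φ r y ^ 2‖ = ∫ y, φ r y ^ 2 := by
    intro r
    congr 1
    ext y
    rw [Real.norm_eq_abs, abs_of_nonneg (sq_nonneg _)]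
  have hI : Integrable (fun r => ∫ y, φ r y ^ 2) (volume.restrict (Icc s t)) := by
    refine Measure.integrableOn_of_bounded (M := C) (by simp)
      (hφ.pow_const 2).stronglyMeasurable.integral_prod_right'.aestronglyMeasurable ?_
    refine (ae_restrict_iff' measurableSet_Icc).2 (Eventually.of_forall fun r hr => ?_)
    rw [Real.norm_eq_abs, abs_of_nonneg (integral_nonneg fun y => sq_nonneg _)]
    exact hC r hr
  have h1 : Integrable (fun x : ℝ × ℝ => φ x.1 x.2 ^ 2) ((volume.restrict (Icc s t)).prod volume) := by
    rw [integrable_prod_iff hm]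
    refine ⟨Eventually.of_forall fun r => hi r, ?_⟩
    simp only [hn]
    exact hI
  constructor
  · rw [IntegrableOn, aux_volstrip]
    exact h1
  · rw [aux_volstrip, integral_prod _ h1]
    refine (setIntegral_mono_on hI (integrableOn_const (by simp)) measurableSet_Icc hC).trans ?_
    simp [hst]

open Filter Topology in
lemma aux_E_closed (e : ℝ → ℝ → ℝ) (he0 : ∀ r y, 0 ≤ e r y) (hec : ∀ y, Continuous fun r => e r y)
    (hei : ∀ r, Integrable (e r)) (T : ℝ) (n : ℝ) :
    IsClosed {t | t ∈ Icc 0 T ∧ ∫ y, e t y ≤ n} := by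
  apply IsSeqClosed.isClosed
  intro x a hx ha
  refine ⟨isClosed_Icc.mem_of_tendsto ha (Eventually.of_forall fun k => (hx k).1), ?_⟩
  have hn : 0 ≤ n := (integral_nonneg (he0 (x 0))).trans (hx 0).2
  have hE : ∀ r, ENNReal.ofReal (∫ y, e r y) = ∫⁻ y, ENNReal.ofReal (e r y) := fun r =>
    ofReal_integral_eq_lintegral_ofReal (hei r) (Eventually.of_forall (he0 r))
  rw [← ENNReal.ofReal_le_ofReal_iff hn, hE]
  have hlim : ∀ y, ENNReal.ofReal (e a y) = liminf (fun k => ENNReal.ofReal (e (x k) y)) atTop := by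
    intro y
    refine (Tendsto.liminf_eq ?_).symm
    exact ENNReal.tendsto_ofReal (((hec y).tendsto a).comp ha)
  simp only [hlim]
  refine (lintegral_liminf_le' fun k => (hei (x k)).aestronglyMeasurable.aemeasurable.ennreal_ofReal).trans ?_
  refine liminf_le_of_frequently_le' (Frequently.of_forall fun k => ?_)
  rw [← hE]
  exact ENNReal.ofReal_le_ofReal (hx k).2

open Filter Topology in
lemma aux_energy (G ξ d : ℝ) (hG : 0 < G) (hd : 0 ≤ d) (hξd : d ≤ ξ)
    (w wt wy σ σt σy g : ℝ → ℝ → ℝ)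
    (hwt : ∀ t y, HasDerivAt (fun s => w s y) (wt t y) t)
    (hwy : ∀ t y, HasDerivAt (fun z => w t z) (wy t y) y)
    (hσt : ∀ t y, HasDerivAt (fun s => σ s y) (σt t y) t)
    (hσy : ∀ t y, HasDerivAt (fun z => σ t z) (σy t y) y)
    (hgm : Measurable fun x : ℝ × ℝ => g x.1 x.2)
    (h1 : ∀ t y, wt t y = σy t y)
    (h2 : ∀ t y, σt t y = G * wy t y + (-ξ * σ t y - d * g t y))
    (hwi : ∀ t, Integrable fun y => w t y ^ 2)
    (hσi : ∀ t, Integrable fun y => σ t y ^ 2)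
    (hgi : ∀ t, Integrable fun y => g t y ^ 2)
    (M m s t : ℝ) (hst : s ≤ t) (hM : ∀ r ∈ Icc s t, ∫ y, g r y ^ 2 ≤ M)
    (hm : ∀ r ∈ Icc s t, ∫ y, (G * w r y ^ 2 + σ r y ^ 2) ≤ m) :
    (∫ y, (G * w t y ^ 2 + σ t y ^ 2)) - (∫ y, (G * w s y ^ 2 + σ s y ^ 2)) ≤ d * M * (t - s) ∧
    |(∫ y, (G * w t y ^ 2 + σ t y ^ 2)) - (∫ y, (G * w s y ^ 2 + σ s y ^ 2))|
      ≤ (t - s) * ((2 * ξ + d) * m + d * M) := by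
  have hξ : 0 ≤ ξ := hd.trans hξd
  set c := Real.sqrt G with hc
  have hcc : c * c = G := Real.mul_self_sqrt hG.le
  have hwcy : ∀ t, Continuous (w t) :=
    fun t => continuous_iff_continuousAt.2 fun y => (hwy t y).continuousAt
  have hσcy : ∀ t, Continuous (σ t) :=
    fun t => continuous_iff_continuousAt.2 fun y => (hσy t y).continuousAt
  have hwm := (aux_meas_t w wt hwt hwcy).1
  have hσm := (aux_meas_t σ σt hσt hσcy).1
  have hEi : ∀ r, Integrable (fun y => G * w r y ^ 2 + σ r y ^ 2) :=
    fun r => ((hwi r).const_mul G).add (hσi r)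
  obtain ⟨iσ, bσ⟩ := aux_strip_int σ hσm hσi s t m hst fun r hr =>
    (integral_mono (hσi r) (hEi r) fun y => by
      have : 0 ≤ G * w r y ^ 2 := by positivity
      show σ r y ^ 2 ≤ G * w r y ^ 2 + σ r y ^ 2
      linarith).trans (hm r hr)
  obtain ⟨iw, -⟩ := aux_strip_int w hwm hwi s t (m / G) hst fun r hr => by
    rw [le_div_iff₀' hG, ← integral_const_mul]
    refine (integral_mono ((hwi r).const_mul G) (hEi r) fun y => ?_).trans (hm r hr)
    show G * w r y ^ 2 ≤ G * w r y ^ 2 + σ r y ^ 2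
    have : 0 ≤ σ r y ^ 2 := sq_nonneg _
    linarith
  obtain ⟨ig, bg⟩ := aux_strip_int g hgm hgi s t M hst hM
  set F : ℝ → ℝ → ℝ := fun r y => -ξ * σ r y - d * g r y with hF
  have hFm : Measurable fun x : ℝ × ℝ => F x.1 x.2 := (hσm.const_mul (-ξ)).sub (hgm.const_mul d)
  have iF : IntegrableOn (fun x : ℝ × ℝ => F x.1 x.2 ^ 2) (Icc s t ×ˢ univ) := by
    refine Integrable.mono' ((iσ.const_mul (2 * ξ ^ 2)).add (ig.const_mul (2 * d ^ 2)))
      (hFm.pow_const 2).aestronglyMeasurable (Eventually.of_forall fun x => ?_)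
    rw [Real.norm_eq_abs, abs_of_nonneg (sq_nonneg _)]
    simp only [hF, Pi.add_apply]
    nlinarith [sq_nonneg (-ξ * σ x.1 x.2 + d * g x.1 x.2)]
  have sqi : ∀ (k : ℝ) (r : ℝ), k * k = G → Integrable fun y => (k * w r y + σ r y) ^ 2 := by
    intro k r hk
    refine Integrable.mono' (((hwi r).const_mul (2 * G)).add ((hσi r).const_mul 2))
      ((((hwcy r).const_mul k).add (hσcy r)).pow 2).aestronglyMeasurable
      (Eventually.of_forall fun y => ?_)
    rw [Real.norm_eq_abs, abs_of_nonneg (sq_nonneg _), ← hk]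
    simp only [Pi.add_apply]
    nlinarith [sq_nonneg (k * w r y - σ r y)]
  have sqi2 : ∀ (k : ℝ), k * k = G →
      IntegrableOn (fun x : ℝ × ℝ => (k * w x.1 x.2 + σ x.1 x.2) ^ 2) (Icc s t ×ˢ univ) := by
    intro k hk
    refine Integrable.mono' ((iw.const_mul (2 * G)).add (iσ.const_mul 2))
      (((hwm.const_mul k).add hσm).pow_const 2).aestronglyMeasurable
      (Eventually.of_forall fun x => ?_)
    rw [Real.norm_eq_abs, abs_of_nonneg (sq_nonneg _), ← hk]
    simp only [Pi.add_apply]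
    nlinarith [sq_nonneg (k * w x.1 x.2 - σ x.1 x.2)]
  have key : ∀ k : ℝ, k * k = G →
      (∫ y, (k * w t y + σ t y) ^ 2) - ∫ y, (k * w s y + σ s y) ^ 2 =
        ∫ x in Icc s t ×ˢ univ, 2 * (k * w x.1 x.2 + σ x.1 x.2) * F x.1 x.2 := by
    intro k hk
    refine aux_trans (fun r y => k * w r y + σ r y) (fun r y => k * wt r y + σt r y)
      (fun r y => k * wy r y + σy r y) F
      (fun r y => ((hwt r y).const_mul k).add (hσt r y))
      (fun r y => ((hwy r y).const_mul k).add (hσy r y)) (-k) s t hst hFm ?_ (sqi2 k hk) iF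
      (sqi k s hk) (sqi k t hk)
    intro r _ y
    simp only [hF]
    rw [h1, h2, ← hk]
    ring
  have prodi : ∀ k : ℝ, k * k = G → IntegrableOn
      (fun x : ℝ × ℝ => 2 * (k * w x.1 x.2 + σ x.1 x.2) * F x.1 x.2) (Icc s t ×ˢ univ) := by
    intro k hk
    refine Integrable.mono' ((sqi2 k hk).add iF)
      ((((hwm.const_mul k).add hσm).const_mul 2).mul hFm).aestronglyMeasurable
      (Eventually.of_forall fun x => ?_)
    rw [Real.norm_eq_abs, abs_le]
    simp only [Pi.add_apply]
    constructor
    · nlinarith [sq_nonneg (k * w x.1 x.2 + σ x.1 x.2 + F x.1 x.2)]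
    · nlinarith [sq_nonneg (k * w x.1 x.2 + σ x.1 x.2 - F x.1 x.2)]
  have hcc' : (-c) * (-c) = G := by rw [neg_mul_neg, hcc]
  have hE : ∀ r, (∫ y, (c * w r y + σ r y) ^ 2) + (∫ y, (-c * w r y + σ r y) ^ 2) =
      2 * ∫ y, (G * w r y ^ 2 + σ r y ^ 2) := by
    intro r
    rw [← integral_add (sqi c r hcc) (sqi (-c) r hcc'), ← integral_const_mul]
    congr 1
    ext y
    rw [← hcc]
    ring
  have hI : (∫ x in Icc s t ×ˢ univ, 2 * (c * w x.1 x.2 + σ x.1 x.2) * F x.1 x.2) +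
      (∫ x in Icc s t ×ˢ univ, 2 * (-c * w x.1 x.2 + σ x.1 x.2) * F x.1 x.2) =
      2 * ∫ x in Icc s t ×ˢ univ, 2 * σ x.1 x.2 * F x.1 x.2 := by
    rw [← integral_add (prodi c hcc) (prodi (-c) hcc'), ← integral_const_mul]
    congr 1
    ext x
    ring
  have hdiff : (∫ y, (G * w t y ^ 2 + σ t y ^ 2)) - (∫ y, (G * w s y ^ 2 + σ s y ^ 2)) =
      ∫ x in Icc s t ×ˢ univ, 2 * σ x.1 x.2 * F x.1 x.2 := by
    have k1 := key c hcc
    have k2 := key (-c) hcc'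
    linarith [hE s, hE t]
  have ptw : ∀ x : ℝ × ℝ, |2 * σ x.1 x.2 * F x.1 x.2| ≤
      (2 * ξ + d) * σ x.1 x.2 ^ 2 + d * g x.1 x.2 ^ 2 := by
    intro x
    simp only [hF]
    have e1 := mul_nonneg hd (sq_nonneg (σ x.1 x.2 + g x.1 x.2))
    have e2 := mul_nonneg hd (sq_nonneg (σ x.1 x.2 - g x.1 x.2))
    have e3 := mul_nonneg hξ (sq_nonneg (σ x.1 x.2))
    rw [abs_le]
    constructor <;> nlinarith
  have ptw2 : ∀ x : ℝ × ℝ, 2 * σ x.1 x.2 * F x.1 x.2 ≤ d * g x.1 x.2 ^ 2 := by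
    intro x
    simp only [hF]
    have e1 := mul_nonneg hd (sq_nonneg (σ x.1 x.2 + g x.1 x.2))
    have e3 := mul_nonneg hξ (sq_nonneg (σ x.1 x.2))
    have e4 := mul_nonneg (sub_nonneg.2 hξd) (sq_nonneg (σ x.1 x.2))
    nlinarith
  have ibd : IntegrableOn (fun x : ℝ × ℝ => (2 * ξ + d) * σ x.1 x.2 ^ 2 + d * g x.1 x.2 ^ 2)
      (Icc s t ×ˢ univ) := (iσ.const_mul _).add (ig.const_mul _)
  have iσF : IntegrableOn (fun x : ℝ × ℝ => 2 * σ x.1 x.2 * F x.1 x.2) (Icc s t ×ˢ univ) :=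
    Integrable.mono' ibd ((hσm.const_mul 2).mul hFm).aestronglyMeasurable (Eventually.of_forall ptw)
  rw [hdiff]
  constructor
  · refine (integral_mono iσF (ig.const_mul d) ptw2).trans ?_
    rw [integral_const_mul]
    have := mul_le_mul_of_nonneg_left bg hd
    linarith
  · rw [← Real.norm_eq_abs]
    refine (norm_integral_le_of_norm_le ibd (Eventually.of_forall ptw)).trans ?_
    rw [integral_add (iσ.const_mul _) (ig.const_mul _), integral_const_mul, integral_const_mul]
    have b1 := mul_le_mul_of_nonneg_left bg hd
    have b2 := mul_le_mul_of_nonneg_left bσ (by positivity : 0 ≤ 2 * ξ + d)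
    linarith

theorem stmt_2
    (G ξ₁ ξ₂ T : ℝ) (hG : 0 < G) (hξ : ξ₁ ≥ ξ₂) (hξ₂ : ξ₂ ≥ 0) (hT : 0 < T)
    (f : ℝ → ℝ → ℝ)
    (u₁ τ₁ u₂ τ₂ : ℝ → ℝ → ℝ)
    (ut₁ uy₁ τt₁ τy₁ ut₂ uy₂ τt₂ τy₂ : ℝ → ℝ → ℝ)
    -- C¹ regularity
    (hut₁ : ∀ t y, HasDerivAt (fun s => u₁ s y) (ut₁ t y) t)
    (huy₁ : ∀ t y, HasDerivAt (fun z => u₁ t z) (uy₁ t y) y)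
    (hτt₁ : ∀ t y, HasDerivAt (fun s => τ₁ s y) (τt₁ t y) t)
    (hτy₁ : ∀ t y, HasDerivAt (fun z => τ₁ t z) (τy₁ t y) y)
    (hut₂ : ∀ t y, HasDerivAt (fun s => u₂ s y) (ut₂ t y) t)
    (huy₂ : ∀ t y, HasDerivAt (fun z => u₂ t z) (uy₂ t y) y)
    (hτt₂ : ∀ t y, HasDerivAt (fun s => τ₂ s y) (τt₂ t y) t)
    (hτy₂ : ∀ t y, HasDerivAt (fun z => τ₂ t z) (τy₂ t y) y)
    -- the two damped wave systems with the same source f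
    (hpde1₁ : ∀ t y, ut₁ t y - τy₁ t y = f t y)
    (hpde2₁ : ∀ t y, τt₁ t y - G * uy₁ t y = -ξ₁ * τ₁ t y)
    (hpde1₂ : ∀ t y, ut₂ t y - τy₂ t y = f t y)
    (hpde2₂ : ∀ t y, τt₂ t y - G * uy₂ t y = -ξ₂ * τ₂ t y)
    -- same initial data
    (hinitu : ∀ y, u₁ 0 y = u₂ 0 y) (hinitτ : ∀ y, τ₁ 0 y = τ₂ 0 y)
    -- integrability and decay at infinity
    (hint : ∀ t, Integrable (fun y => (u₁ t y - u₂ t y) ^ 2) ∧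
                 Integrable (fun y => (τ₁ t y - τ₂ t y) ^ 2) ∧
                 Integrable (fun y => (τ₂ t y) ^ 2))
    (hdecayTop : ∀ t, Filter.Tendsto
      (fun y => (u₁ t y - u₂ t y) * (τ₁ t y - τ₂ t y)) Filter.atTop (nhds 0))
    (hdecayBot : ∀ t, Filter.Tendsto
      (fun y => (u₁ t y - u₂ t y) * (τ₁ t y - τ₂ t y)) Filter.atBot (nhds 0))
    -- uniform bound on ∫ τ₂²
    (M : ℝ) (hM : ∀ t ∈ Icc 0 T, ∫ y, (τ₂ t y) ^ 2 ≤ M) :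
    ∀ t ∈ Icc 0 T,
      (∫ y, (G * (u₁ t y - u₂ t y) ^ 2 + (τ₁ t y - τ₂ t y) ^ 2))
        ≤ (ξ₁ - ξ₂) * M * t := by
  set w : ℝ → ℝ → ℝ := fun t y => u₁ t y - u₂ t y with hw
  set σ : ℝ → ℝ → ℝ := fun t y => τ₁ t y - τ₂ t y with hσ
  have hwt : ∀ t y, HasDerivAt (fun s => w s y) (ut₁ t y - ut₂ t y) t :=
    fun t y => (hut₁ t y).sub (hut₂ t y)
  have hwy : ∀ t y, HasDerivAt (fun z => w t z) (uy₁ t y - uy₂ t y) y :=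
    fun t y => (huy₁ t y).sub (huy₂ t y)
  have hσt : ∀ t y, HasDerivAt (fun s => σ s y) (τt₁ t y - τt₂ t y) t :=
    fun t y => (hτt₁ t y).sub (hτt₂ t y)
  have hσy : ∀ t y, HasDerivAt (fun z => σ t z) (τy₁ t y - τy₂ t y) y :=
    fun t y => (hτy₁ t y).sub (hτy₂ t y)
  have hgm : Measurable fun x : ℝ × ℝ => τ₂ x.1 x.2 :=
    (aux_meas_t τ₂ τt₂ hτt₂ fun t =>
      continuous_iff_continuousAt.2 fun y => (hτy₂ t y).continuousAt).1
  have hd : 0 ≤ ξ₁ - ξ₂ := by linarith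
  have hM0 : 0 ≤ M := (integral_nonneg fun y => sq_nonneg _).trans (hM 0 ⟨le_rfl, hT.le⟩)
  set E : ℝ → ℝ := fun t => ∫ y, (G * w t y ^ 2 + σ t y ^ 2) with hE
  have hcore : ∀ s t m, 0 ≤ s → s ≤ t → t ≤ T → (∀ r ∈ Icc s t, E r ≤ m) →
      E t - E s ≤ (ξ₁ - ξ₂) * M * (t - s) ∧
      |E t - E s| ≤ (t - s) * ((2 * ξ₁ + (ξ₁ - ξ₂)) * m + (ξ₁ - ξ₂) * M) := by
    intro s t m h0 hst htT hm
    refine aux_energy G ξ₁ (ξ₁ - ξ₂) hG hd (by linarith) w _ _ σ _ _ τ₂ hwt hwy hσt hσy hgm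
      (fun t y => by linarith [hpde1₁ t y, hpde1₂ t y])
      (fun t y => by
        simp only [hσ]
        linarith [hpde2₁ t y, hpde2₂ t y])
      (fun t => (hint t).1) (fun t => (hint t).2.1) (fun t => (hint t).2.2) M m s t hst
      (fun r hr => hM r ⟨h0.trans hr.1, hr.2.trans htT⟩) hm
  have hEi : ∀ t, Integrable fun y => G * w t y ^ 2 + σ t y ^ 2 :=
    fun t => ((hint t).1.const_mul G).add (hint t).2.1
  have he0 : ∀ t y, 0 ≤ G * w t y ^ 2 + σ t y ^ 2 := fun t y => by positivity
  obtain ⟨m, hm⟩ := aux_TB E T (2 * ξ₁ + (ξ₁ - ξ₂)) ((ξ₁ - ξ₂) * M) (by linarith) (by positivity)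
    (fun t _ => integral_nonneg (he0 t))
    (fun n => aux_E_closed (fun t y => G * w t y ^ 2 + σ t y ^ 2) he0
      (fun y => by
        have c1 : Continuous fun r => w r y :=
          continuous_iff_continuousAt.2 fun t => (hwt t y).continuousAt
        have c2 : Continuous fun r => σ r y :=
          continuous_iff_continuousAt.2 fun t => (hσt t y).continuousAt
        exact ((c1.pow 2).const_mul G).add (c2.pow 2)) hEi T n)
    (fun s t m h0 hst htT h => (hcore s t m h0 hst htT h).2)
  intro t ht
  have hfin := (hcore 0 t m le_rfl ht.1 ht.2 fun r hr => hm r ⟨hr.1, hr.2.trans ht.2⟩).1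
  have hE0 : E 0 = 0 := by simp [hE, hw, hσ, hinitu, hinitτ]
  rw [hE0, sub_zero, sub_zero] at hfin
  exact hfin
end

section
/- Let G > 0 and let (u_ξ, τ_ξ) for ξ ∈ [0,1] be the C¹ solutions on [0,T] × ℝ of ∂ₜu − ∂_y τ = 0, ∂ₜτ − G∂_y u = −ξτ with common compactly supported smooth initial data (u⁰, τ⁰). Assume sup_{t∈[0,T]} ‖τ₀(t,·)‖_{L²} ≤ M where (u₀, τ₀) is the solution with ξ = 0 (the undamped elastic wave system). Then ‖u_ξ(t) − u₀(t)‖_{L²(ℝ)}² + ‖τ_ξ(t) − τ₀(t)‖_{L²(ℝ)}² ≤ max(1, 1/G) · ξ · M² · t for all t ∈ [0,T]; hence the Maxwell shear waves converge in L² to the elastic shear waves as λ = 1/ξ → ∞. -/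
open MeasureTheory Set Real

open Filter Topology

/-- approximate directional differentiability, with error at most `ε` -/
def QD (g S : ℝ × ℝ → ℝ) (v : ℝ × ℝ) (ε : ℝ) (q : ℝ × ℝ) : Prop :=
  ∀ ε₁ > ε, ∀ᶠ h in 𝓝 (0:ℝ), |g (q + h • v) - g q - h * S q| ≤ ε₁ * |h|

lemma QD.scale {g S : ℝ × ℝ → ℝ} {v : ℝ × ℝ} {ε : ℝ} {q : ℝ × ℝ} (H : QD g S v ε q) (k : ℝ)
    (hk : k ≠ 0) : QD g (fun p => k * S p) (k • v) (|k| * ε) q := by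
  intro ε₁ h1
  have hk' : 0 < |k| := abs_pos.mpr hk
  have h2 : ε < ε₁ / |k| := by rw [lt_div_iff₀ hk']; linarith
  have h3 : Tendsto (fun h : ℝ => h * k) (𝓝 0) (𝓝 0) := by
    have : Continuous (fun h : ℝ => h * k) := by fun_prop
    simpa using this.tendsto 0
  filter_upwards [h3.eventually (H _ h2)] with h hh
  rw [smul_smul]
  have e : ε₁ / |k| * |h * k| = ε₁ * |h| := by rw [abs_mul]; field_simp
  rw [e] at hh
  rw [← mul_assoc]
  exact hh

lemma QD.swap {g S : ℝ × ℝ → ℝ} {v : ℝ × ℝ} {ε : ℝ} {q : ℝ × ℝ} (H : QD g S v ε q.swap) :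
    QD (fun p => g p.swap) (fun p => S p.swap) v.swap ε q := by
  intro ε₁ h1
  filter_upwards [H _ h1] with h hh
  exact hh

lemma line_le {f : ℝ → ℝ} {h C : ℝ} (hh : 0 ≤ h) (hc : ContinuousOn f (Icc 0 h))
    (hd : ∀ l ∈ Ico 0 h, ∀ C₁ > C, ∀ᶠ k in 𝓝 (0:ℝ), f (l + k) - f l ≤ C₁ * |k|) :
    f h - f 0 ≤ C * h := by
  have := image_le_of_liminf_slope_right_le_deriv_boundary (f := f) (a := 0) (b := h)
    (B := fun x => f 0 + C * x) (B' := fun _ => C) hc (by simp) (by fun_prop)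
    (fun x _ => by
      have : HasDerivAt (fun x => f 0 + C * x) C x := by
        simpa using ((hasDerivAt_id x).const_mul C).const_add (f 0)
      exact this.hasDerivWithinAt)
    (by
      intro x hx r hr
      obtain ⟨C₁, h1, h2⟩ := exists_between hr
      have h3 : Tendsto (fun z : ℝ => z - x) (𝓝[>] x) (𝓝 0) := by
        have : Continuous (fun h : ℝ => h - x) := by fun_prop
        have := this.tendsto x
        simp only [sub_self] at this
        exact this.mono_left nhdsWithin_le_nhds
      have := h3.eventually (hd x hx C₁ h1)
      apply Eventually.frequently
      filter_upwards [this, self_mem_nhdsWithin] with z hz hz2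
      have hz2 : x < z := hz2
      rw [slope_def_field]
      rw [abs_of_pos (by linarith), add_sub_cancel] at hz
      calc _ ≤ C₁ := by rw [div_le_iff₀ (by linarith)]; exact hz
        _ < r := h2) (x := h) ⟨hh, le_rfl⟩
  linarith

lemma line {g S : ℝ × ℝ → ℝ} {v q : ℝ × ℝ} {ε m D h : ℝ} (hh : 0 ≤ h)
    (hc : ∀ l ∈ Icc 0 h, ContinuousAt g (q + l • v))
    (hQ : ∀ l ∈ Ico 0 h, QD g S v ε (q + l • v))
    (hm : ∀ l ∈ Ico 0 h, |S (q + l • v) - D| ≤ m) :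
    |g (q + h • v) - g q - h * D| ≤ (ε + m) * h := by
  have hcont : ContinuousOn (fun l : ℝ => g (q + l • v)) (Icc 0 h) := by
    intro l hl
    apply ContinuousAt.continuousWithinAt
    exact ContinuousAt.comp (f := fun l : ℝ => q + l • v) (hc l hl) (by fun_prop)
  have key : ∀ l ∈ Ico 0 h, ∀ C₁ > ε + m, ∀ᶠ k in 𝓝 (0:ℝ),
      |g (q + (l + k) • v) - g (q + l • v) - k * D| ≤ C₁ * |k| := by
    intro l hl C₁ hC
    filter_upwards [hQ l hl (C₁ - m) (by linarith)] with k hk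
    have h1 := hm l hl
    rw [add_assoc, ← add_smul] at hk
    have : g (q + (l + k) • v) - g (q + l • v) - k * D
      = (g (q + (l + k) • v) - g (q + l • v) - k * S (q + l • v))
        + k * (S (q + l • v) - D) := by ring
    rw [this]
    refine (abs_add_le _ _).trans ?_
    rw [abs_mul]
    nlinarith [abs_nonneg k]
  have a1 := line_le (f := fun l => g (q + l • v) - l * D) (C := ε + m) hh
    (hcont.sub (by fun_prop)) (by
      intro l hl C₁ hC
      filter_upwards [key l hl C₁ hC] with k hk
      have := (abs_le.mp hk).2
      linarith)
  have a2 := line_le (f := fun l => -(g (q + l • v) - l * D)) (C := ε + m) hh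
    (hcont.sub (by fun_prop)).neg (by
      intro l hl C₁ hC
      filter_upwards [key l hl C₁ hC] with k hk
      have := (abs_le.mp hk).1
      linarith)
  simp only [zero_smul, add_zero, zero_mul, sub_zero] at a1 a2
  rw [abs_le]
  constructor <;> linarith

/-- good point -/
def Good (r s : ℝ × ℝ → ℝ) (k1 k2 ε : ℝ) (q : ℝ × ℝ) : Prop :=
  ContinuousAt r q ∧ ContinuousAt s q ∧
    QD r (fun p => k1 * ((r p - s p) / 2)) (1, -1) ε q ∧
    QD s (fun p => k2 * ((r p - s p) / 2)) (1, 1) ε q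

lemma tri {r s : ℝ × ℝ → ℝ} {k1 k2 k ε K B H σ t1 x0 re se : ℝ}
    (hk1 : |k1| ≤ k) (hk2 : |k2| ≤ k) (hσ : |σ| = 1) (hH : 0 ≤ H) (hkH : k * H ≤ 1 / 2)
    (hG : ∀ h x, 0 ≤ h → h ≤ H → |x - x0| ≤ H - h → Good r s k1 k2 ε (t1 + σ * h, x))
    (hB : ∀ x, |x - x0| ≤ H → |r (t1, x) - re| ≤ B ∧ |s (t1, x) - se| ≤ B)
    (hK1 : |k1 * ((re - se) / 2)| ≤ K) (hK2 : |k2 * ((re - se) / 2)| ≤ K) (hε : 0 ≤ ε) :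
    |r (t1 + σ * H, x0) - re| ≤ 2 * (B + (K + ε) * H) ∧
    |s (t1 + σ * H, x0) - se| ≤ 2 * (B + (K + ε) * H) := by
  have hσσ : σ * σ = 1 := by rw [← abs_mul_abs_self, hσ, one_mul]
  have hσ0 : σ ≠ 0 := by rintro rfl; simp at hσ
  set D : Set (ℝ × ℝ) := {p | 0 ≤ p.1 ∧ p.1 ≤ H ∧ |p.2 - x0| ≤ H - p.1} with hD
  have hDc : IsCompact D := by
    apply (isCompact_Icc (a := ((0:ℝ), x0 - H)) (b := (H, x0 + H))).of_isClosed_subset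
    · apply IsClosed.inter
      · exact isClosed_le continuous_const continuous_fst
      · apply IsClosed.inter
        · exact isClosed_le continuous_fst continuous_const
        · exact isClosed_le (f := fun p : ℝ × ℝ => |p.2 - x0|) (g := fun p : ℝ × ℝ => H - p.1)
            (by fun_prop) (by fun_prop)
    · rintro ⟨a, b⟩ ⟨h1, h2, h3⟩
      simp only at h1 h2 h3
      rw [abs_le] at h3
      exact ⟨⟨h1, by simp only; linarith⟩, ⟨h2, by simp only; linarith⟩⟩
  set φ : ℝ × ℝ → ℝ := fun p =>
    max |r (t1 + σ * p.1, p.2) - re| |s (t1 + σ * p.1, p.2) - se| with hφ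
  have hφc : ContinuousOn φ D := by
    rintro ⟨a, b⟩ ⟨h1, h2, h3⟩
    apply ContinuousAt.continuousWithinAt
    obtain ⟨c1, c2, -, -⟩ := hG a b h1 h2 h3
    have d1 : ContinuousAt (fun p : ℝ × ℝ => r (t1 + σ * p.1, p.2)) (a, b) :=
      ContinuousAt.comp (f := fun p : ℝ × ℝ => (t1 + σ * p.1, p.2)) c1 (by fun_prop)
    have d2 : ContinuousAt (fun p : ℝ × ℝ => s (t1 + σ * p.1, p.2)) (a, b) :=
      ContinuousAt.comp (f := fun p : ℝ × ℝ => (t1 + σ * p.1, p.2)) c2 (by fun_prop)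
    exact ((d1.sub continuousAt_const).abs).max ((d2.sub continuousAt_const).abs)
  have hap : (H, x0) ∈ D := ⟨hH, le_rfl, by simp⟩
  obtain ⟨⟨h, x⟩, ⟨hh0, hhH, hx⟩, hmax⟩ := hDc.exists_isMaxOn ⟨_, hap⟩ hφc
  simp only at hh0 hhH hx
  set m := φ (h, x) with hm
  have hle : ∀ h' x', 0 ≤ h' → h' ≤ H → |x' - x0| ≤ H - h' →
      |r (t1 + σ * h', x') - re| ≤ m ∧ |s (t1 + σ * h', x') - se| ≤ m := by
    intro h' x' a1 a2 a3
    have : φ (h', x') ≤ m := hmax (show (h', x') ∈ D from ⟨a1, a2, a3⟩)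
    exact ⟨(le_max_left _ _).trans this, (le_max_right _ _).trans this⟩
  have hm0 : 0 ≤ m := (abs_nonneg _).trans (hle H x0 hH le_rfl (by simp)).1
  have hk0 : 0 ≤ k := (abs_nonneg _).trans hk1
  have hS : ∀ κ, |κ| ≤ k → ∀ h' x', 0 ≤ h' → h' ≤ H → |x' - x0| ≤ H - h' →
      |σ * (κ * ((r (t1 + σ * h', x') - s (t1 + σ * h', x')) / 2)) - σ * (κ * ((re - se) / 2))|
        ≤ k * m := by
    intro κ hκ h' x' a1 a2 a3
    obtain ⟨b1, b2⟩ := hle h' x' a1 a2 a3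
    rw [← mul_sub, ← mul_sub, abs_mul, abs_mul, hσ, one_mul]
    apply mul_le_mul hκ _ (abs_nonneg _) hk0
    rw [abs_le] at *
    constructor <;> linarith [b1.1, b1.2, b2.1, b2.2]
  -- the two characteristic estimates, for a direction sign `j`
  have main : ∀ (g : ℝ × ℝ → ℝ) (κ j ge : ℝ), |κ| ≤ k → |j| = 1 →
      (|κ * ((re - se) / 2)| ≤ K) →
      (∀ x, |x - x0| ≤ H → |g (t1, x) - ge| ≤ B) →
      (∀ h x, 0 ≤ h → h ≤ H → |x - x0| ≤ H - h → ContinuousAt g (t1 + σ * h, x) ∧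
        QD g (fun p => κ * ((r p - s p) / 2)) (1, j) ε (t1 + σ * h, x)) →
      |g (t1 + σ * h, x) - ge| ≤ B + (K + ε) * H + k * m * H := by
    intro g κ j ge hκ hj hKκ hgB hgG
    have hpt : ∀ l : ℝ, ((t1, x - σ * j * h) : ℝ × ℝ) + l • (σ • ((1, j) : ℝ × ℝ))
        = (t1 + σ * l, x - σ * j * (h - l)) := by
      intro l
      ext
      · simp; ring
      · simp; ring
    have hin : ∀ l, 0 ≤ l → l ≤ h → |x - σ * j * (h - l) - x0| ≤ H - l := by
      intro l a1 a2
      have : x - σ * j * (h - l) - x0 = (x - x0) - σ * j * (h - l) := by ring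
      rw [this]
      refine (abs_sub _ _).trans ?_
      rw [abs_mul, abs_mul, hσ, hj, abs_of_nonneg (by linarith : 0 ≤ h - l)]
      linarith
    have L := line (g := g) (S := fun p => σ * (κ * ((r p - s p) / 2)))
      (v := σ • ((1, j) : ℝ × ℝ)) (q := (t1, x - σ * j * h)) (ε := ε) (m := k * m)
      (D := σ * (κ * ((re - se) / 2))) hh0
      (by
        intro l hl
        rw [hpt]
        exact (hgG l _ hl.1 (hl.2.trans hhH) (hin l hl.1 hl.2)).1)
      (by
        intro l hl
        rw [hpt]
        have := (hgG l _ hl.1 (hl.2.le.trans hhH) (hin l hl.1 hl.2.le)).2.scale σ hσ0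
        rwa [hσ, one_mul] at this)
      (by
        intro l hl
        rw [hpt]
        exact hS κ hκ l _ hl.1 (hl.2.le.trans hhH) (hin l hl.1 hl.2.le))
    rw [hpt] at L
    simp only [sub_self, mul_zero, sub_zero] at L
    have b := hgB (x - σ * j * h) (by
      have := hin 0 le_rfl hh0
      simpa using this)
    have e : g (t1 + σ * h, x) - ge = (g (t1 + σ * h, x) - g (t1, x - σ * j * h)
        - h * (σ * (κ * ((re - se) / 2)))) + (g (t1, x - σ * j * h) - ge)
        + h * (σ * (κ * ((re - se) / 2))) := by ring
    have e2 : |h * (σ * (κ * ((re - se) / 2)))| ≤ H * K := by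
      rw [abs_mul, abs_mul σ, hσ, one_mul, abs_of_nonneg hh0]
      exact mul_le_mul hhH hKκ (abs_nonneg _) hH
    have e3 : (ε + k * m) * h ≤ (ε + k * m) * H :=
      mul_le_mul_of_nonneg_left hhH (by positivity)
    rw [e]
    refine (abs_add_three _ _ _).trans ?_
    linarith
  have m1 := main r k1 (-1) re hk1 (by simp) hK1 (fun x hx => (hB x hx).1)
    (fun h x a b c => ⟨(hG h x a b c).1, (hG h x a b c).2.2.1⟩)
  have m2 := main s k2 1 se hk2 (by simp) hK2 (fun x hx => (hB x hx).2)
    (fun h x a b c => ⟨(hG h x a b c).2.1, (hG h x a b c).2.2.2⟩)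
  have hmm : m ≤ B + (K + ε) * H + k * m * H := max_le m1 m2
  have : k * m * H ≤ m / 2 := by nlinarith
  obtain ⟨c1, c2⟩ := hle H x0 hH le_rfl (by simp)
  constructor <;> linarith

lemma step2 {g S : ℝ × ℝ → ℝ} {v p : ℝ × ℝ} {ε : ℝ} {F : Set (ℝ × ℝ)} (hF : IsClosed F)
    (hpF : p ∈ F)
    (hc : ∀ᶠ z in 𝓝 p, ContinuousAt g z) (hS : ContinuousAt S p) (hε : 0 < ε)
    (hoff : ∀ᶠ z in 𝓝 p, z ∉ F → QD g S v ε z)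
    (hon : ∀ᶠ h in 𝓝 (0:ℝ), p + h • v ∈ F → |g (p + h • v) - g p - h * S p| ≤ ε * |h|) :
    QD g S v ε p := by
  intro ε₁ h1
  have hS' : ∀ᶠ z in 𝓝 p, |S z - S p| < ε₁ - ε := by
    have := (Metric.tendsto_nhds.mp hS) (ε₁ - ε) (by linarith)
    simpa [Real.dist_eq] using this
  have hT : Tendsto (fun h : ℝ => p + h • v) (𝓝 0) (𝓝 p) := by
    have : Continuous (fun h : ℝ => p + h • v) := by fun_prop
    simpa using this.tendsto 0
  have hall := (hT.eventually (hc.and (hS'.and hoff))).and hon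
  rw [Metric.eventually_nhds_iff] at hall ⊢
  obtain ⟨δ, hδ, hall⟩ := hall
  refine ⟨δ, hδ, fun h hh => ?_⟩
  simp only [dist_zero_right, Real.norm_eq_abs] at hall hh
  set Λ : Set ℝ := Icc 0 1 ∩ {l | p + (l * h) • v ∈ F} with hΛ
  have hΛc : IsCompact Λ := by
    apply isCompact_Icc.inter_right
    exact hF.preimage (f := fun l : ℝ => p + (l * h) • v) (by fun_prop)
  obtain ⟨l0, ⟨⟨hl0, hl01⟩, hl0F⟩, hgr⟩ := hΛc.exists_isGreatest
    ⟨0, ⟨le_rfl, zero_le_one⟩, by simpa using hpF⟩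
  have hsm : ∀ l, 0 ≤ l → l ≤ 1 → |l * h| < δ := by
    intro l a b
    rw [abs_mul, abs_of_nonneg a]
    nlinarith [abs_nonneg h]
  have A := (hall (hsm l0 hl0 hl01)).2 hl0F
  have Bd : |g (p + (l0 * h) • v) - g (p + h • v) - (1 - l0) * (-h * S p)|
      ≤ (|h| * ε + |h| * (ε₁ - ε)) * (1 - l0) := by
    rcases eq_or_ne h 0 with rfl | hne
    · simp
    have hpt : ∀ l : ℝ, (p + h • v) + l • ((-h) • v) = p + ((1 - l) * h) • v := by
      intro l; module
    have L := line (g := g) (S := fun p => -h * S p) (v := (-h) • v) (q := p + h • v)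
      (ε := |h| * ε) (m := |h| * (ε₁ - ε)) (D := -h * S p) (h := 1 - l0) (by linarith)
      (by
        intro l hl
        rw [hpt]
        exact (hall (hsm (1 - l) (by linarith [hl.2]) (by linarith [hl.1]))).1.1)
      (by
        intro l hl
        rw [hpt]
        have := (hall (hsm (1 - l) (by linarith [hl.2]) (by linarith [hl.1]))).1.2.2
          (fun hmem => by
            have : 1 - l ≤ l0 := hgr ⟨⟨by linarith [hl.2], by linarith [hl.1]⟩, hmem⟩
            linarith [hl.2])
        have := this.scale (-h) (neg_ne_zero.mpr hne)
        rwa [abs_neg] at this)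
      (by
        intro l hl
        rw [hpt]
        have := (hall (hsm (1 - l) (by linarith [hl.2]) (by linarith [hl.1]))).1.2.1
        rw [← mul_sub, abs_mul, abs_neg]
        exact mul_le_mul_of_nonneg_left this.le (abs_nonneg _))
    rw [hpt, sub_sub_cancel] at L
    exact L
  have e : g (p + h • v) - g p - h * S p
      = (g (p + (l0 * h) • v) - g p - l0 * h * S p)
        - (g (p + (l0 * h) • v) - g (p + h • v) - (1 - l0) * (-h * S p)) := by ring
  rw [e]
  refine (abs_sub _ _).trans ?_
  rw [abs_mul, abs_of_nonneg hl0] at A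
  have : ε * (l0 * |h|) ≤ ε₁ * (l0 * |h|) := by
    apply mul_le_mul_of_nonneg_right h1.le (by positivity)
  nlinarith

lemma Good.swap {r s : ℝ × ℝ → ℝ} {k1 k2 ε : ℝ} {q : ℝ × ℝ} (H : Good r s k1 k2 ε q.swap) :
    Good (fun p => r p.swap) (fun p => s p.swap) (-k1) k2 ε q := by
  obtain ⟨h1, h2, h3, h4⟩ := H
  refine ⟨ContinuousAt.comp (f := Prod.swap) h1 continuous_swap.continuousAt,
    ContinuousAt.comp (f := Prod.swap) h2 continuous_swap.continuousAt, ?_, ?_⟩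
  · have := (h3.scale (-1) (by norm_num)).swap
    simp only [abs_neg, abs_one, one_mul, neg_mul, neg_smul, one_smul] at this
    simpa using this
  · exact h4.swap

lemma near {r s : ℝ × ℝ → ℝ} {k1 k2 k ε K d η δ : ℝ} {z e : ℝ × ℝ}
    (hk1 : |k1| ≤ k) (hk2 : |k2| ≤ k) (hε0 : 0 ≤ ε) (hεK : ε ≤ K) (hη : 0 < η) (hηd : η ≤ d)
    (hoff : ∀ q : ℝ × ℝ, |q.1 - z.1| + |q.2 - z.2| < d → Good r s k1 k2 ε q)
    (hN : |e.1 - z.1| + |e.2 - z.2| < d + η) (hab : |e.1 - z.1| ≤ |e.2 - z.2|)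
    (hcross : ∀ h, |h| ≤ δ → |r (e.1, e.2 + h) - r e| ≤ K * |h| ∧
      |s (e.1, e.2 + h) - s e| ≤ K * |h|)
    (hK1 : |k1 * ((r e - s e) / 2)| ≤ K) (hK2 : |k2 * ((r e - s e) / 2)| ≤ K)
    (hδ : |e.1 - z.1| + |e.2 - z.2| ≤ δ) (hkN : k * (|e.1 - z.1| + |e.2 - z.2|) ≤ 1 / 2) :
    ∃ z' : ℝ × ℝ, |z'.1 - z.1| ≤ η ∧ |z'.2 - z.2| ≤ η ∧
      |r z' - r e| ≤ 6 * K * (|e.1 - z.1| + |e.2 - z.2|) ∧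
      |s z' - s e| ≤ 6 * K * (|e.1 - z.1| + |e.2 - z.2|) := by
  set α := e.1 - z.1 with hα
  set β := e.2 - z.2 with hβ
  obtain ⟨σ, hσ, hσα⟩ : ∃ σ : ℝ, |σ| = 1 ∧ α = -σ * |α| := by
    rcases le_total 0 α with h | h
    · exact ⟨-1, by simp, by rw [abs_of_nonneg h]; ring⟩
    · exact ⟨1, by simp, by rw [abs_of_nonpos h]; ring⟩
  have hk0 : 0 ≤ k := (abs_nonneg _).trans hk1
  have hα0 := abs_nonneg α
  have hβ0 := abs_nonneg β
  set H := max (|α| - η) 0 with hH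
  have H0 : 0 ≤ H := le_max_right _ _
  have Hα : H ≤ |α| := max_le (by linarith) hα0
  have Hη : |α| - H ≤ η := by linarith [le_max_left (|α| - η) 0]
  have Hd : |α| + H < d := by
    rcases max_cases (|α| - η) 0 with ⟨h1, h2⟩ | ⟨h1, h2⟩ <;> rw [hH, h1] <;> linarith
  have T := tri (r := r) (s := s) (k1 := k1) (k2 := k2) (k := k) (ε := ε) (K := K)
    (B := K * (|α| + |β|)) (H := H) (σ := σ) (t1 := e.1) (x0 := z.2) (re := r e) (se := s e)
    hk1 hk2 hσ H0 (by nlinarith)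
    (by
      intro h x a1 a2 a3
      apply hoff
      have : e.1 + σ * h - z.1 = -σ * (|α| - h) := by
        rw [show e.1 + σ * h - z.1 = α + σ * h by rw [hα]; ring]; nth_rewrite 1 [hσα]; ring
      simp only
      rw [this, abs_mul, abs_neg, hσ, abs_of_nonneg (by linarith : 0 ≤ |α| - h)]
      linarith)
    (by
      intro x hx
      have hx2 : |x - e.2| ≤ |α| + |β| := by
        have : x - e.2 = (x - z.2) - β := by rw [hβ]; ring
        rw [this]
        refine (abs_sub _ _).trans ?_
        linarith
      obtain ⟨c1, c2⟩ := hcross (x - e.2) (hx2.trans hδ)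
      rw [add_sub_cancel] at c1 c2
      have : K * |x - e.2| ≤ K * (|α| + |β|) :=
        mul_le_mul_of_nonneg_left hx2 (by linarith)
      exact ⟨c1.trans this, c2.trans this⟩)
    hK1 hK2 hε0
  have hb : 2 * (K * (|α| + |β|) + (K + ε) * H) ≤ 6 * K * (|α| + |β|) := by
    have h1 : (K + ε) * H ≤ (2 * K) * (|α| + |β|) :=
      mul_le_mul (by linarith) (by linarith) H0 (by linarith)
    linarith
  refine ⟨(e.1 + σ * H, z.2), ?_, by simpa using hη.le, T.1.trans hb, T.2.trans hb⟩
  have : e.1 + σ * H - z.1 = -σ * (|α| - H) := by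
    rw [show e.1 + σ * H - z.1 = α + σ * H by rw [hα]; ring]; nth_rewrite 1 [hσα]; ring
  simp only
  rw [this, abs_mul, abs_neg, hσ, abs_of_nonneg (by linarith : 0 ≤ |α| - H)]
  linarith

lemma tendsto_A {f : ℝ × ℝ → ℝ} {A : Set (ℝ × ℝ)} {K δ : ℝ} {p : ℝ × ℝ} (hδ : 0 < δ)
    (hA : ∀ q ∈ A, ∀ h, |h| ≤ δ → |f (q.1 + h, q.2) - f q| ≤ K * |h|)
    (hfx : ContinuousAt (fun x => f (p.1, x)) p.2) : Tendsto f (𝓝[A] p) (𝓝 (f p)) := by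
  have h1 : Tendsto (fun q : ℝ × ℝ => f (p.1, q.2)) (𝓝[A] p) (𝓝 (f p)) := by
    have : ContinuousAt (fun q : ℝ × ℝ => f (p.1, q.2)) p :=
      ContinuousAt.comp (f := fun q : ℝ × ℝ => q.2) hfx continuous_snd.continuousAt
    exact this.tendsto.mono_left nhdsWithin_le_nhds
  have hz : Tendsto (fun q : ℝ × ℝ => |p.1 - q.1|) (𝓝[A] p) (𝓝 0) := by
    have : Continuous (fun q : ℝ × ℝ => |p.1 - q.1|) := by fun_prop
    have := this.tendsto p
    simp only [sub_self, abs_zero] at this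
    exact this.mono_left nhdsWithin_le_nhds
  have h2 : Tendsto (fun q : ℝ × ℝ => f (p.1, q.2) - f q) (𝓝[A] p) (𝓝 0) := by
    apply squeeze_zero_norm' (a := fun q => K * |p.1 - q.1|)
    · filter_upwards [self_mem_nhdsWithin, hz.eventually (ge_mem_nhds hδ)] with q hq hq2
      have := hA q hq (p.1 - q.1) hq2
      rwa [add_sub_cancel] at this
    · simpa using hz.const_mul K
  simpa using h1.sub h2

lemma affine_A {f : ℝ × ℝ → ℝ} {A : Set (ℝ × ℝ)} {a b ε δ : ℝ} {p q : ℝ × ℝ} (hδ : 0 < δ)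
    (hε : 0 ≤ ε)
    (hA1 : ∀ q ∈ A, ∀ h, |h| ≤ δ → |f (q.1 + h, q.2) - f q - a * h| ≤ ε * |h|)
    (hA2 : ∀ q ∈ A, ∀ h, |h| ≤ δ → |f (q.1, q.2 + h) - f q - b * h| ≤ ε * |h|)
    (hfx : ∀ t x, ContinuousAt (fun x => f (t, x)) x)
    (hp : p ∈ closure A) (hq : q ∈ closure A) (hpq : |q.1 - p.1| + |q.2 - p.2| < δ) :
    |f q - f p - a * (q.1 - p.1) - b * (q.2 - p.2)| ≤ ε * (|q.1 - p.1| + |q.2 - p.2|) := by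
  have hL : ∀ q ∈ A, ∀ h, |h| ≤ δ → |f (q.1 + h, q.2) - f q| ≤ (|a| + ε) * |h| := by
    intro q hq h hh
    have := hA1 q hq h hh
    have e : f (q.1 + h, q.2) - f q = (f (q.1 + h, q.2) - f q - a * h) + a * h := by ring
    rw [e]
    refine (abs_add_le _ _).trans ?_
    rw [abs_mul]
    linarith
  have tp := tendsto_A hδ hL (hfx p.1 p.2)
  have tq := tendsto_A hδ hL (hfx q.1 q.2)
  haveI : (𝓝[A] p).NeBot := mem_closure_iff_nhdsWithin_neBot.mp hp
  haveI : (𝓝[A] q).NeBot := mem_closure_iff_nhdsWithin_neBot.mp hq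
  have hid : Tendsto (fun w : (ℝ × ℝ) × (ℝ × ℝ) => w) (𝓝[A] p ×ˢ 𝓝[A] q) (𝓝 (p, q)) := by
    rw [nhds_prod_eq]
    exact Filter.prod_mono nhdsWithin_le_nhds nhdsWithin_le_nhds
  have hcN : Tendsto (fun w : (ℝ × ℝ) × (ℝ × ℝ) => |w.2.1 - w.1.1| + |w.2.2 - w.1.2|)
      (𝓝[A] p ×ˢ 𝓝[A] q) (𝓝 (|q.1 - p.1| + |q.2 - p.2|)) := by
    have : Continuous (fun w : (ℝ × ℝ) × (ℝ × ℝ) => |w.2.1 - w.1.1| + |w.2.2 - w.1.2|) := by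
      fun_prop
    exact (this.tendsto (p, q)).comp hid
  have hcl : Tendsto (fun w : (ℝ × ℝ) × (ℝ × ℝ) => a * (w.2.1 - w.1.1) + b * (w.2.2 - w.1.2))
      (𝓝[A] p ×ˢ 𝓝[A] q) (𝓝 (a * (q.1 - p.1) + b * (q.2 - p.2))) := by
    have : Continuous (fun w : (ℝ × ℝ) × (ℝ × ℝ) =>
      a * (w.2.1 - w.1.1) + b * (w.2.2 - w.1.2)) := by fun_prop
    exact (this.tendsto (p, q)).comp hid
  have lim := (((tq.comp tendsto_snd).sub (tp.comp tendsto_fst)).sub hcl).abs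
  have := le_of_tendsto_of_tendsto lim (hcN.const_mul ε) (by
    have hA : ∀ᶠ w in 𝓝[A] p ×ˢ 𝓝[A] q, w.1 ∈ A ∧ w.2 ∈ A :=
      (eventually_mem_nhdsWithin (s := A) (a := p)).prod_mk
        (eventually_mem_nhdsWithin (s := A) (a := q))
    filter_upwards [hA, hcN.eventually (gt_mem_nhds hpq)] with w hw hwδ
    obtain ⟨h1, h2⟩ := hw
    have e0 := abs_nonneg (w.2.1 - w.1.1)
    have e1 := abs_nonneg (w.2.2 - w.1.2)
    have c1 := hA2 _ h1 (w.2.2 - w.1.2) (by linarith)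
    have c2 := hA1 _ h2 (w.1.1 - w.2.1) (by rw [abs_sub_comm]; linarith)
    rw [add_sub_cancel] at c1 c2
    rw [abs_sub_comm w.1.1] at c2
    simp only [Function.comp]
    rw [abs_le] at *
    constructor <;> linarith [c1.1, c1.2, c2.1, c2.2])
  have e : f q - f p - a * (q.1 - p.1) - b * (q.2 - p.2)
    = f q - f p - (a * (q.1 - p.1) + b * (q.2 - p.2)) := by ring
  rw [e]
  exact this

/-- continuity at a point of the exceptional set -/
lemma step1 {r s : ℝ × ℝ → ℝ} {k1 k2 k ε K δ ρ : ℝ} {F A : Set (ℝ × ℝ)} {p : ℝ × ℝ}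
    (hk1 : |k1| ≤ k) (hk2 : |k2| ≤ k) (hε : 0 < ε) (hεK : ε ≤ K) (hδ : 0 < δ) (hρ : 0 < ρ)
    (hF : IsClosed F) (hAF : A ⊆ F) (hpF : p ∈ F)
    (hoff : ∀ z, z ∉ F → Good r s k1 k2 ε z)
    (hdense : ∀ q ∈ F, |q.1 - p.1| + |q.2 - p.2| < ρ → q ∈ closure A)
    (hc1 : ∀ e ∈ A, ∀ h, |h| ≤ δ → |r (e.1 + h, e.2) - r e| ≤ K * |h| ∧
      |s (e.1 + h, e.2) - s e| ≤ K * |h|)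
    (hc2 : ∀ e ∈ A, ∀ h, |h| ≤ δ → |r (e.1, e.2 + h) - r e| ≤ K * |h| ∧
      |s (e.1, e.2 + h) - s e| ≤ K * |h|)
    (hK1 : ∀ e ∈ A, |k1 * ((r e - s e) / 2)| ≤ K) (hK2 : ∀ e ∈ A, |k2 * ((r e - s e) / 2)| ≤ K)
    (hlip : ∀ e ∈ closure A, |e.1 - p.1| + |e.2 - p.2| < δ →
      |r e - r p| ≤ K * (|e.1 - p.1| + |e.2 - p.2|) ∧
      |s e - s p| ≤ K * (|e.1 - p.1| + |e.2 - p.2|)) :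
    ContinuousAt r p ∧ ContinuousAt s p := by
  have hK0 : 0 < K := by linarith
  have hk0 : 0 ≤ k := (abs_nonneg _).trans hk1
  obtain ⟨κ, hκ0, hκρ, hκδ, hκk⟩ : ∃ κ > 0, 4 * κ ≤ ρ ∧ 4 * κ ≤ δ ∧ k * (4 * κ) ≤ 1 / 2 := by
    refine ⟨min (ρ / 4) (min (δ / 4) (1 / (8 * (k + 1)))), by positivity, ?_, ?_, ?_⟩
    · linarith [min_le_left (ρ / 4) (min (δ / 4) (1 / (8 * (k + 1))))]
    · linarith [(min_le_right (ρ / 4) (min (δ / 4) (1 / (8 * (k + 1))))).trans (min_le_left _ _)]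
    · have h1 := (min_le_right (ρ / 4) (min (δ / 4) (1 / (8 * (k + 1))))).trans (min_le_right _ _)
      have h2 : (8 * (k + 1)) * (1 / (8 * (k + 1))) = 1 := by field_simp
      have h3 : 0 < 1 / (8 * (k + 1)) := by positivity
      nlinarith
  have key : ∀ z : ℝ × ℝ, |z.1 - p.1| + |z.2 - p.2| < κ →
      |r z - r p| ≤ (15 * K + 1) * (|z.1 - p.1| + |z.2 - p.2|) ∧
      |s z - s p| ≤ (15 * K + 1) * (|z.1 - p.1| + |z.2 - p.2|) := by
    intro z hz
    set n0 := |z.1 - p.1| + |z.2 - p.2| with hn0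
    have hn00 : 0 ≤ n0 := by positivity
    by_cases hzF : z ∈ F
    · obtain ⟨l1, l2⟩ := hlip z (hdense z hzF (by linarith)) (by linarith)
      rw [← hn0] at l1 l2
      have : K * n0 ≤ (15 * K + 1) * n0 := by
        apply mul_le_mul_of_nonneg_right _ hn00; linarith
      exact ⟨l1.trans this, l2.trans this⟩
    have hn0pos : 0 < n0 := by
      rcases hn00.lt_or_eq with h | h
      · exact h
      · exfalso
        have a1 := abs_nonneg (z.1 - p.1)
        have a2 := abs_nonneg (z.2 - p.2)
        have b1 : z.1 - p.1 = 0 := abs_eq_zero.mp (by linarith)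
        have b2 : z.2 - p.2 = 0 := abs_eq_zero.mp (by linarith)
        have : z = p := Prod.ext (by linarith) (by linarith)
        exact hzF (this ▸ hpF)
    set I : Set ℝ := (fun q : ℝ × ℝ => |q.1 - z.1| + |q.2 - z.2|) '' F with hI
    have hIne : I.Nonempty := ⟨_, p, hpF, rfl⟩
    have hIb : BddBelow I := ⟨0, by rintro _ ⟨q, -, rfl⟩; positivity⟩
    set d := sInf I with hd
    have hdn : d ≤ n0 := by
      apply csInf_le hIb
      exact ⟨p, hpF, by simp only [hn0]; rw [abs_sub_comm p.1, abs_sub_comm p.2]⟩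
    have hd0 : 0 < d := by
      obtain ⟨γ, hγ, hb⟩ := Metric.isOpen_iff.mp hF.isOpen_compl z hzF
      refine lt_of_lt_of_le hγ (le_csInf hIne ?_)
      rintro _ ⟨q, hq, rfl⟩
      by_contra hcon
      push Not at hcon
      have : q ∈ Metric.ball z γ := by
        rw [Metric.mem_ball, Prod.dist_eq, Real.dist_eq, Real.dist_eq]
        apply max_lt <;> linarith [abs_nonneg (q.1 - z.1), abs_nonneg (q.2 - z.2)]
      exact hb this hq
    have hdq : ∀ q : ℝ × ℝ, |q.1 - z.1| + |q.2 - z.2| < d → q ∉ F := by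
      intro q hq hqF
      exact absurd (csInf_le hIb ⟨q, hqF, rfl⟩) (not_le.mpr hq)
    obtain ⟨gr, gs, -, -⟩ := hoff z hzF
    obtain ⟨η0, hη0, hcl⟩ : ∃ η0 > 0, ∀ z' : ℝ × ℝ, |z'.1 - z.1| ≤ η0 → |z'.2 - z.2| ≤ η0 →
        |r z' - r z| < n0 ∧ |s z' - s z| < n0 := by
      have := ((Metric.tendsto_nhds.mp gr) n0 hn0pos).and ((Metric.tendsto_nhds.mp gs) n0 hn0pos)
      rw [Metric.eventually_nhds_iff] at this
      obtain ⟨γ, hγ, hh⟩ := this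
      refine ⟨γ / 2, by linarith, fun z' a b => ?_⟩
      have := hh (y := z') (by
        rw [Prod.dist_eq, Real.dist_eq, Real.dist_eq]
        apply max_lt <;> linarith)
      simpa [Real.dist_eq] using this
    set η := min η0 d with hη
    have hηpos : 0 < η := lt_min hη0 hd0
    have hηd : η ≤ d := min_le_right _ _
    obtain ⟨_, ⟨e0, he0F, rfl⟩, he0⟩ := exists_lt_of_csInf_lt hIne
      (show sInf I < d + η / 2 by linarith)
    simp only at he0
    have tri1 : ∀ q : ℝ × ℝ, |q.1 - p.1| + |q.2 - p.2| ≤ (|q.1 - z.1| + |q.2 - z.2|) + n0 := by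
      intro q
      have a1 := abs_sub_le q.1 z.1 p.1
      have a2 := abs_sub_le q.2 z.2 p.2
      linarith
    have he0c := hdense e0 he0F (by linarith [tri1 e0])
    obtain ⟨e, heA, hee0⟩ := Metric.mem_closure_iff.mp he0c (η / 4) (by linarith)
    rw [Prod.dist_eq, Real.dist_eq, Real.dist_eq, max_lt_iff] at hee0
    have hNe : |e.1 - z.1| + |e.2 - z.2| < d + η := by
      have a1 := abs_sub_le e.1 e0.1 z.1
      have a2 := abs_sub_le e.2 e0.2 z.2
      rw [abs_sub_comm e.1 e0.1] at a1
      rw [abs_sub_comm e.2 e0.2] at a2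
      linarith [hee0.1, hee0.2]
    have hNe2 : |e.1 - z.1| + |e.2 - z.2| ≤ 2 * n0 := by linarith
    have hz' : ∃ z' : ℝ × ℝ, |z'.1 - z.1| ≤ η ∧ |z'.2 - z.2| ≤ η ∧
      |r z' - r e| ≤ 6 * K * (|e.1 - z.1| + |e.2 - z.2|) ∧
      |s z' - s e| ≤ 6 * K * (|e.1 - z.1| + |e.2 - z.2|) := by
      have hkN : k * (|e.1 - z.1| + |e.2 - z.2|) ≤ 1 / 2 := by
        refine le_trans ?_ hκk
        apply mul_le_mul_of_nonneg_left _ hk0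
        linarith
      rcases le_total |e.1 - z.1| |e.2 - z.2| with hab | hab
      · exact near hk1 hk2 hε.le hεK hηpos hηd (fun q hq => hoff q (hdq q hq)) hNe hab
          (hc2 e heA) (hK1 e heA) (hK2 e heA) (by linarith) hkN
      · obtain ⟨z', b1, b2, b3, b4⟩ := near (r := fun p => r p.swap) (s := fun p => s p.swap)
          (k1 := -k1) (k2 := k2) (k := k) (z := z.swap) (e := e.swap) (δ := δ)
          (by rwa [abs_neg]) hk2 hε.le hεK hηpos hηd
          (fun q hq => Good.swap (hoff q.swap (hdq q.swap (by
            simp only [Prod.fst_swap, Prod.snd_swap] at hq ⊢; linarith))))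
          (by simp only [Prod.fst_swap, Prod.snd_swap]; linarith) hab
          (hc1 e heA)
          (by have := hK1 e heA; simpa [abs_mul] using this)
          (by simpa using hK2 e heA)
          (by simp only [Prod.fst_swap, Prod.snd_swap]; linarith)
          (by simp only [Prod.fst_swap, Prod.snd_swap]; linarith)
        simp only [Prod.fst_swap, Prod.snd_swap, Prod.swap_swap] at b1 b2 b3 b4
        exact ⟨z'.swap, b2, b1, by rw [add_comm]; exact b3, by rw [add_comm]; exact b4⟩
    obtain ⟨z', c1, c2, c3, c4⟩ := hz'
    have hηη0 : η ≤ η0 := min_le_left _ _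
    obtain ⟨d1, d2⟩ := hcl z' (c1.trans hηη0) (c2.trans hηη0)
    have hep := tri1 e
    obtain ⟨l1, l2⟩ := hlip e (subset_closure heA) (by linarith)
    have f1 : 6 * K * (|e.1 - z.1| + |e.2 - z.2|) ≤ 6 * K * (2 * n0) :=
      mul_le_mul_of_nonneg_left hNe2 (by linarith)
    have f2 : K * (|e.1 - p.1| + |e.2 - p.2|) ≤ K * (3 * n0) :=
      mul_le_mul_of_nonneg_left (by linarith) (by linarith)
    have g1 := c3.trans f1
    have g2 := c4.trans f1
    have g3 := l1.trans f2
    have g4 := l2.trans f2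
    rw [abs_le] at g1 g2 g3 g4
    rw [abs_lt] at d1 d2
    rw [abs_le, abs_le]
    obtain ⟨_, _⟩ := g1
    obtain ⟨_, _⟩ := g2
    obtain ⟨_, _⟩ := g3
    obtain ⟨_, _⟩ := g4
    obtain ⟨_, _⟩ := d1
    obtain ⟨_, _⟩ := d2
    refine ⟨⟨?_, ?_⟩, ?_, ?_⟩ <;> linarith
  have hNt : Tendsto (fun z : ℝ × ℝ => |z.1 - p.1| + |z.2 - p.2|) (𝓝 p) (𝓝 0) := by
    have : Continuous (fun z : ℝ × ℝ => |z.1 - p.1| + |z.2 - p.2|) := by fun_prop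
    simpa using this.tendsto p
  have hNt2 : Tendsto (fun z : ℝ × ℝ => (15 * K + 1) * (|z.1 - p.1| + |z.2 - p.2|))
    (𝓝 p) (𝓝 0) := by simpa using hNt.const_mul (15 * K + 1)
  constructor
  · apply tendsto_iff_norm_sub_tendsto_zero.mpr
    apply squeeze_zero' (Eventually.of_forall fun _ => norm_nonneg _) _ hNt2
    filter_upwards [hNt.eventually (gt_mem_nhds hκ0)] with z hz
    exact (key z hz).1
  · apply tendsto_iff_norm_sub_tendsto_zero.mpr
    apply squeeze_zero' (Eventually.of_forall fun _ => norm_nonneg _) _ hNt2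
    filter_upwards [hNt.eventually (gt_mem_nhds hκ0)] with z hz
    exact (key z hz).2

lemma baire_portion {ι : Type*} [Countable ι] {F : Set (ℝ × ℝ)} (hF : IsClosed F)
    (hne : F.Nonempty) (A : ι → Set (ℝ × ℝ)) (hA : ∀ p ∈ F, ∃ i, p ∈ A i) :
    ∃ i, ∃ p0 ∈ F, ∃ ρ > 0, ∀ p ∈ F, dist p p0 < ρ → p ∈ closure (A i ∩ F) := by
  have : Nonempty F := hne.to_subtype
  have : CompleteSpace F := hF.completeSpace_coe
  obtain ⟨i, hi⟩ := nonempty_interior_of_iUnion_of_closed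
    (f := fun i => closure ((Subtype.val : F → ℝ × ℝ) ⁻¹' A i)) (fun i => isClosed_closure)
    (by
      rw [eq_univ_iff_forall]
      intro p
      obtain ⟨i, hi⟩ := hA p p.2
      exact mem_iUnion.mpr ⟨i, subset_closure hi⟩)
  obtain ⟨p0, hp0⟩ := hi
  rw [mem_interior_iff_mem_nhds, Metric.mem_nhds_iff] at hp0
  obtain ⟨ρ, hρ, hb⟩ := hp0
  refine ⟨i, p0, p0.2, ρ, hρ, fun p hp hd => ?_⟩
  have h1 : (⟨p, hp⟩ : F) ∈ closure ((Subtype.val : F → ℝ × ℝ) ⁻¹' A i) := hb hd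
  have h2 := (closure_subtype (x := (⟨p, hp⟩ : F))).mp h1
  rwa [Subtype.image_preimage_coe, inter_comm] at h2

lemma exists_rat_near_pt (x : ℝ) {ε : ℝ} (hε : 0 < ε) : ∃ a : ℚ, |x - a| < ε := by
  obtain ⟨a, h1, h2⟩ := exists_rat_btwn (show x - ε < x + ε by linarith)
  exact ⟨a, by rw [abs_lt]; constructor <;> linarith⟩

lemma cross_ev {f : ℝ → ℝ} {f' a ε : ℝ} (hf : HasDerivAt f f' 0) (hε : 0 < ε)
    (ha : |f' - a| < ε / 2) : ∀ᶠ h in 𝓝 (0:ℝ), |f h - f 0 - a * h| ≤ ε * |h| := by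
  have := (hasDerivAt_iff_isLittleO_nhds_zero.mp hf).def (half_pos hε)
  filter_upwards [this] with h hh
  simp only [zero_add, smul_eq_mul, Real.norm_eq_abs] at hh
  have e : f h - f 0 - a * h = (f h - f 0 - h * f') + (f' - a) * h := by ring
  rw [e]
  refine (abs_add_le _ _).trans ?_
  rw [abs_mul]
  nlinarith [abs_nonneg h]

theorem reg {r s rt rx st sx : ℝ × ℝ → ℝ} {k1 k2 : ℝ}
    (hrt : ∀ p : ℝ × ℝ, HasDerivAt (fun h => r (p.1 + h, p.2)) (rt p) 0)
    (hrx : ∀ p : ℝ × ℝ, HasDerivAt (fun h => r (p.1, p.2 + h)) (rx p) 0)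
    (hst : ∀ p : ℝ × ℝ, HasDerivAt (fun h => s (p.1 + h, p.2)) (st p) 0)
    (hsx : ∀ p : ℝ × ℝ, HasDerivAt (fun h => s (p.1, p.2 + h)) (sx p) 0)
    (h1 : ∀ p, rt p - rx p = k1 * ((r p - s p) / 2))
    (h2 : ∀ p, st p + sx p = k2 * ((r p - s p) / 2)) :
    ∀ ε > 0, ∀ p, Good r s k1 k2 ε p := by
  intro ε hε
  by_contra! hcon
  set F := closure {p | ¬ Good r s k1 k2 ε p} with hFdef
  have hF : IsClosed F := isClosed_closure
  have hne : F.Nonempty := by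
    obtain ⟨p, hp⟩ := hcon
    exact ⟨p, subset_closure hp⟩
  have hoff : ∀ z, z ∉ F → Good r s k1 k2 ε z := by
    intro z hz
    by_contra hg
    exact hz (subset_closure hg)
  set ε' := ε / 4 with hε'
  have hε'0 : 0 < ε' := by positivity
  have hcx : ∀ (f fx : ℝ × ℝ → ℝ), (∀ p : ℝ × ℝ, HasDerivAt (fun h => f (p.1, p.2 + h)) (fx p) 0) →
      ∀ t x, ContinuousAt (fun x => f (t, x)) x := by
    intro f fx hfx t x
    have := (hfx (t, x)).continuousAt
    simp only at this
    have h3 : ContinuousAt (fun y => f (t, x + (y - x))) x := by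
      apply ContinuousAt.comp (f := fun y => y - x) (g := fun h => f (t, x + h))
      · simpa using this
      · fun_prop
    simpa using h3
  let A : ℕ × ℚ × ℚ × ℚ × ℚ → Set (ℝ × ℝ) := fun i =>
    {p | (∀ h, |h| ≤ 1 / ((i.1 : ℝ) + 1) →
        |r (p.1 + h, p.2) - r p - i.2.1 * h| ≤ ε' * |h| ∧
        |r (p.1, p.2 + h) - r p - i.2.2.1 * h| ≤ ε' * |h| ∧
        |s (p.1 + h, p.2) - s p - i.2.2.2.1 * h| ≤ ε' * |h| ∧
        |s (p.1, p.2 + h) - s p - i.2.2.2.2 * h| ≤ ε' * |h|) ∧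
      |(i.2.1 : ℝ) - i.2.2.1 - k1 * ((r p - s p) / 2)| ≤ 2 * ε' ∧
      |(i.2.2.2.1 : ℝ) + i.2.2.2.2 - k2 * ((r p - s p) / 2)| ≤ 2 * ε'}
  obtain ⟨⟨n, a, b, c, d⟩, p0, hp0, ρ, hρ, hdense⟩ := baire_portion hF hne A (by
    intro p _
    obtain ⟨a, ha⟩ := exists_rat_near_pt (rt p) (half_pos hε'0)
    obtain ⟨b, hb⟩ := exists_rat_near_pt (rx p) (half_pos hε'0)
    obtain ⟨c, hc⟩ := exists_rat_near_pt (st p) (half_pos hε'0)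
    obtain ⟨d, hd⟩ := exists_rat_near_pt (sx p) (half_pos hε'0)
    have ev := (cross_ev (hrt p) hε'0 ha).and ((cross_ev (hrx p) hε'0 hb).and
      ((cross_ev (hst p) hε'0 hc).and (cross_ev (hsx p) hε'0 hd)))
    rw [Metric.eventually_nhds_iff] at ev
    obtain ⟨γ, hγ, hev⟩ := ev
    obtain ⟨n, hn⟩ := exists_nat_one_div_lt hγ
    refine ⟨(n, a, b, c, d), ?_, ?_, ?_⟩
    · intro h hh
      have := hev (y := h) (by
        rw [dist_zero_right, Real.norm_eq_abs]; exact lt_of_le_of_lt hh hn)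
      simpa using this
    · rw [← h1 p]
      rw [abs_lt] at *
      rw [abs_le]
      simp only
      constructor <;> linarith [ha.1, ha.2, hb.1, hb.2]
    · rw [← h2 p]
      rw [abs_lt] at *
      rw [abs_le]
      simp only
      constructor <;> linarith [hc.1, hc.2, hd.1, hd.2])
  set B := A (n, a, b, c, d) ∩ F with hB
  set δ : ℝ := 1 / ((n : ℝ) + 1) with hδdef
  have hδ : 0 < δ := by positivity
  have hA1 : ∀ q ∈ B, ∀ h, |h| ≤ δ → |r (q.1 + h, q.2) - r q - a * h| ≤ ε' * |h| :=
    fun q hq h hh => (hq.1.1 h hh).1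
  have hA2 : ∀ q ∈ B, ∀ h, |h| ≤ δ → |r (q.1, q.2 + h) - r q - b * h| ≤ ε' * |h| :=
    fun q hq h hh => (hq.1.1 h hh).2.1
  have hA3 : ∀ q ∈ B, ∀ h, |h| ≤ δ → |s (q.1 + h, q.2) - s q - c * h| ≤ ε' * |h| :=
    fun q hq h hh => (hq.1.1 h hh).2.2.1
  have hA4 : ∀ q ∈ B, ∀ h, |h| ≤ δ → |s (q.1, q.2 + h) - s q - d * h| ≤ ε' * |h| :=
    fun q hq h hh => (hq.1.1 h hh).2.2.2
  have hP1 : ∀ q ∈ B, |(a : ℝ) - b - k1 * ((r q - s q) / 2)| ≤ 2 * ε' := fun q hq => hq.1.2.1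
  have hP2 : ∀ q ∈ B, |(c : ℝ) + d - k2 * ((r q - s q) / 2)| ≤ 2 * ε' := fun q hq => hq.1.2.2
  set K : ℝ := |(a:ℝ)| + |(b:ℝ)| + |(c:ℝ)| + |(d:ℝ)| + ε with hK
  have ha0 := abs_nonneg (a:ℝ)
  have hb0 := abs_nonneg (b:ℝ)
  have hc0 := abs_nonneg (c:ℝ)
  have hd0 := abs_nonneg (d:ℝ)
  have tolip : ∀ X α h : ℝ, |α| + ε' ≤ K → |X - α * h| ≤ ε' * |h| → |X| ≤ K * |h| := by
    intro X α h hα hX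
    have e : X = (X - α * h) + α * h := by ring
    rw [e]
    refine (abs_add_le _ _).trans ?_
    rw [abs_mul]
    nlinarith [abs_nonneg h]
  have rA := fun p q hp hq hpq => affine_A (f := r) (p := p) (q := q) hδ hε'0.le hA1 hA2
    (hcx r rx hrx) hp hq hpq
  have sA := fun p q hp hq hpq => affine_A (f := s) (p := p) (q := q) hδ hε'0.le hA3 hA4
    (hcx s sx hsx) hp hq hpq
  -- continuity on the ball
  have hcont : ∀ z, dist z p0 < ρ → ContinuousAt r z ∧ ContinuousAt s z := by
    intro z hz
    by_cases hzF : z ∈ F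
    swap
    · exact ⟨(hoff z hzF).1, (hoff z hzF).2.1⟩
    have hzc := hdense z hzF hz
    apply step1 (k := max |k1| |k2|) (ε := ε) (K := K) (δ := δ) (ρ := ρ - dist z p0) (F := F)
      (A := B) (le_max_left _ _) (le_max_right _ _) hε (by linarith) hδ (by linarith) hF
      inter_subset_right hzF hoff
    · intro q hq hqz
      apply hdense q hq
      have h3 : dist q z ≤ |q.1 - z.1| + |q.2 - z.2| := by
        rw [Prod.dist_eq, Real.dist_eq, Real.dist_eq]
        apply max_le <;> linarith [abs_nonneg (q.1 - z.1), abs_nonneg (q.2 - z.2)]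
      linarith [dist_triangle q z p0]
    · intro e he h hh
      exact ⟨tolip _ a h (by linarith) (hA1 e he h hh), tolip _ c h (by linarith) (hA3 e he h hh)⟩
    · intro e he h hh
      exact ⟨tolip _ b h (by linarith) (hA2 e he h hh), tolip _ d h (by linarith) (hA4 e he h hh)⟩
    · intro e he
      have := hP1 e he
      have e1 := abs_sub (a:ℝ) (b:ℝ)
      have e2 := abs_sub_abs_le_abs_sub (k1 * ((r e - s e) / 2)) ((a:ℝ) - b)
      rw [abs_sub_comm] at this
      linarith
    · intro e he
      have := hP2 e he
      have e1 := abs_add_le (c:ℝ) (d:ℝ)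
      have e2 := abs_sub_abs_le_abs_sub (k2 * ((r e - s e) / 2)) ((c:ℝ) + d)
      rw [abs_sub_comm] at this
      linarith
    · intro e he hez
      have c1 := rA z e hzc he hez
      have c2 := sA z e hzc he hez
      have fin : ∀ X α β x y : ℝ, |α| + |β| + ε' ≤ K → |X - α * x - β * y| ≤ ε' * (|x| + |y|) →
          |X| ≤ K * (|x| + |y|) := by
        intro X α β x y hα hX
        have e : X = (X - α * x - β * y) + α * x + β * y := by ring
        rw [e]
        refine (abs_add_three _ _ _).trans ?_
        rw [abs_mul, abs_mul]
        have := abs_nonneg x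
        have := abs_nonneg y
        have := mul_nonneg (abs_nonneg α) (abs_nonneg y)
        have := mul_nonneg (abs_nonneg β) (abs_nonneg x)
        nlinarith
      exact ⟨fin _ a b _ _ (by linarith) c1, fin _ c d _ _ (by linarith) c2⟩
  have hall : ∀ z, dist z p0 < ρ → Good r s k1 k2 ε z := by
    intro z hz
    by_cases hzF : z ∈ F
    swap
    · exact hoff z hzF
    have hzc := hdense z hzF hz
    obtain ⟨cr, cs⟩ := hcont z hz
    have hnear : ∀ᶠ w in 𝓝 z, dist w p0 < ρ := Metric.isOpen_ball.mem_nhds hz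
    have : (𝓝[B] z).NeBot := mem_closure_iff_nhdsWithin_neBot.mp hzc
    have tr : Tendsto r (𝓝[B] z) (𝓝 (r z)) := cr.tendsto.mono_left nhdsWithin_le_nhds
    have ts : Tendsto s (𝓝[B] z) (𝓝 (s z)) := cs.tendsto.mono_left nhdsWithin_le_nhds
    have hz1 : |(a : ℝ) - b - k1 * ((r z - s z) / 2)| ≤ 2 * ε' := by
      refine le_of_tendsto ((((tr.sub ts).div_const 2).const_mul k1).const_sub ((a:ℝ) - b)).abs ?_
      filter_upwards [self_mem_nhdsWithin] with q hq using hP1 q hq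
    have hz2 : |(c : ℝ) + d - k2 * ((r z - s z) / 2)| ≤ 2 * ε' := by
      refine le_of_tendsto ((((tr.sub ts).div_const 2).const_mul k2).const_sub ((c:ℝ) + d)).abs ?_
      filter_upwards [self_mem_nhdsWithin] with q hq using hP2 q hq
    have cV : ContinuousAt (fun p => (r p - s p) / 2) z := (cr.sub cs).div_const 2
    have hsmall : ∀ v : ℝ × ℝ, |v.1| = 1 → |v.2| = 1 → ∀ᶠ h in 𝓝 (0:ℝ), dist (z + h • v) p0 < ρ ∧
        |(z + h • v).1 - z.1| + |(z + h • v).2 - z.2| < δ ∧ |h| < δ := by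
      intro v hv1 hv2
      have hT : Tendsto (fun h : ℝ => z + h • v) (𝓝 0) (𝓝 z) := by
        have : Continuous (fun h : ℝ => z + h • v) := by fun_prop
        simpa using this.tendsto 0
      have hh : ∀ᶠ h in 𝓝 (0:ℝ), |h| < δ / 2 := by
        have : Continuous (fun h : ℝ => |h|) := by fun_prop
        have := this.tendsto 0
        simp only [abs_zero] at this
        exact this.eventually (gt_mem_nhds (half_pos hδ))
      filter_upwards [hT.eventually hnear, hh] with h a1 a2
      refine ⟨a1, ?_, by linarith⟩
      simp [abs_mul, hv1, hv2]
      linarith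
    refine ⟨cr, cs, ?_, ?_⟩
    · apply step2 hF hzF (hnear.mono fun w hw => (hcont w hw).1) (cV.const_mul k1) hε
        (Eventually.of_forall fun w hw => (hoff w hw).2.2.1)
      filter_upwards [hsmall (1, -1) (by simp) (by simp)] with h hh hmem
      have := rA z _ hzc (hdense _ hmem hh.1) hh.2.1
      simp only [Prod.fst_add, Prod.snd_add, Prod.smul_mk, smul_eq_mul, add_sub_cancel_left,
        mul_one, mul_neg, abs_neg] at this
      have hz1' : |h| * |(a : ℝ) - b - k1 * ((r z - s z) / 2)| ≤ |h| * (2 * ε') :=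
        mul_le_mul_of_nonneg_left hz1 (abs_nonneg h)
      rw [← abs_mul] at hz1'
      simp only [Prod.smul_mk, smul_eq_mul, mul_one, mul_neg]
      rw [abs_le] at *
      constructor <;> nlinarith [this.1, this.2, hz1'.1, hz1'.2]
    · apply step2 hF hzF (hnear.mono fun w hw => (hcont w hw).2) (cV.const_mul k2) hε
        (Eventually.of_forall fun w hw => (hoff w hw).2.2.2)
      filter_upwards [hsmall (1, 1) (by simp) (by simp)] with h hh hmem
      have := sA z _ hzc (hdense _ hmem hh.1) hh.2.1
      simp only [Prod.fst_add, Prod.snd_add, Prod.smul_mk, smul_eq_mul, add_sub_cancel_left,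
        mul_one] at this
      have hz2' : |h| * |(c : ℝ) + d - k2 * ((r z - s z) / 2)| ≤ |h| * (2 * ε') :=
        mul_le_mul_of_nonneg_left hz2 (abs_nonneg h)
      rw [← abs_mul] at hz2'
      simp only [Prod.smul_mk, smul_eq_mul, mul_one]
      rw [abs_le] at *
      constructor <;> nlinarith [this.1, this.2, hz2'.1, hz2'.2]
  obtain ⟨q, hq, hqd⟩ := Metric.mem_closure_iff.mp hp0 ρ hρ
  exact hq (hall q (by rwa [dist_comm]))

lemma QD.hasDerivAt {g S : ℝ × ℝ → ℝ} {v q : ℝ × ℝ} (H : ∀ ε > 0, QD g S v ε q) :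
    HasDerivAt (fun h : ℝ => g (q + h • v)) (S q) 0 := by
  rw [hasDerivAt_iff_isLittleO_nhds_zero, Asymptotics.isLittleO_iff]
  intro c hc
  filter_upwards [H (c / 2) (half_pos hc) c (half_lt_self hc)] with h hh
  simpa using hh

/-- all points are good -/
def AllGood (r s : ℝ × ℝ → ℝ) (ξ : ℝ) : Prop := ∀ ε > 0, ∀ p, Good r s (-ξ) ξ ε p

lemma AllGood.cont {r s : ℝ × ℝ → ℝ} {ξ : ℝ} (H : AllGood r s ξ) : Continuous r ∧ Continuous s :=
  ⟨continuous_iff_continuousAt.mpr fun p => (H 1 one_pos p).1,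
    continuous_iff_continuousAt.mpr fun p => (H 1 one_pos p).2.1⟩

lemma AllGood.dr {r s : ℝ × ℝ → ℝ} {ξ : ℝ} (H : AllGood r s ξ) (t x : ℝ) :
    HasDerivAt (fun t => r (t, x - t)) (-ξ * ((r (t, x - t) - s (t, x - t)) / 2)) t := by
  have := QD.hasDerivAt (fun ε hε => (H ε hε (t, x - t)).2.2.1)
  have h2 : HasDerivAt (fun y : ℝ => y - t) 1 t := (hasDerivAt_id t).sub_const t
  have h3 := HasDerivAt.comp_of_eq t this h2 (by simp)
  rw [mul_one] at h3
  refine h3.congr_of_eventuallyEq (Filter.Eventually.of_forall fun y => ?_)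
  simp only [Function.comp]
  congr 1
  ext <;> simp

lemma AllGood.ds {r s : ℝ × ℝ → ℝ} {ξ : ℝ} (H : AllGood r s ξ) (t x : ℝ) :
    HasDerivAt (fun t => s (t, x + t)) (ξ * ((r (t, x + t) - s (t, x + t)) / 2)) t := by
  have := QD.hasDerivAt (fun ε hε => (H ε hε (t, x + t)).2.2.2)
  have h2 : HasDerivAt (fun y : ℝ => y - t) 1 t := (hasDerivAt_id t).sub_const t
  have h3 := HasDerivAt.comp_of_eq t this h2 (by simp)
  rw [mul_one] at h3
  refine h3.congr_of_eventuallyEq (Filter.Eventually.of_forall fun y => ?_)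
  simp only [Function.comp]
  congr 1
  ext <;> simp

lemma AllGood.step {r s : ℝ × ℝ → ℝ} {ξ t1 L σ H x : ℝ} (G : AllGood r s ξ) (hξ : |ξ| ≤ 1)
    (hz : ∀ x, L < |x| → r (t1, x) = 0 ∧ s (t1, x) = 0) (hσ : |σ| = 1) (hH : 0 ≤ H)
    (hH2 : H ≤ 1 / 2) (hx : L + H < |x|) :
    r (t1 + σ * H, x) = 0 ∧ s (t1 + σ * H, x) = 0 := by
  have key : ∀ ε > 0, |r (t1 + σ * H, x)| ≤ ε ∧ |s (t1 + σ * H, x)| ≤ ε := by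
    intro ε hε
    have T := tri (r := r) (s := s) (k1 := -ξ) (k2 := ξ) (k := 1) (ε := ε) (K := 0) (B := 0)
      (H := H) (σ := σ) (t1 := t1) (x0 := x) (re := 0) (se := 0) (by rwa [abs_neg]) hξ hσ hH
      (by linarith) (fun h y _ _ _ => G ε hε _)
      (by
        intro y hy
        have : L < |y| := by
          have := abs_sub_abs_le_abs_sub x y
          rw [abs_sub_comm] at this
          linarith
        obtain ⟨a, b⟩ := hz y this
        simp [a, b]) (by simp) (by simp) hε.le
    simp only [sub_zero, zero_add] at T
    have : 2 * (ε * H) ≤ ε := by nlinarith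
    exact ⟨T.1.trans this, T.2.trans this⟩
  constructor
  · exact abs_nonpos_iff.mp (le_of_forall_pos_le_add fun ε hε => by simpa using (key ε hε).1)
  · exact abs_nonpos_iff.mp (le_of_forall_pos_le_add fun ε hε => by simpa using (key ε hε).2)

lemma AllGood.supp {r s : ℝ × ℝ → ℝ} {ξ L : ℝ} (G : AllGood r s ξ) (hξ : |ξ| ≤ 1)
    (hz : ∀ x, L < |x| → r (0, x) = 0 ∧ s (0, x) = 0) :
    ∀ t x, L + |t| < |x| → r (t, x) = 0 ∧ s (t, x) = 0 := by
  have key : ∀ n : ℕ, ∀ t, |t| ≤ (n:ℝ) / 2 → ∀ x, L + |t| < |x| → r (t, x) = 0 ∧ s (t, x) = 0 := by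
    intro n
    induction n with
    | zero =>
      intro t ht x hx
      have : t = 0 := abs_nonpos_iff.mp (by simpa using ht)
      subst this
      exact hz x (by simpa using hx)
    | succ n ih =>
      intro t ht x hx
      push_cast at ht
      obtain ⟨σ, hσ, hσt⟩ : ∃ σ : ℝ, |σ| = 1 ∧ t = σ * |t| := by
        rcases le_total 0 t with h | h
        · exact ⟨1, by simp, by rw [abs_of_nonneg h]; ring⟩
        · exact ⟨-1, by simp, by rw [abs_of_nonpos h]; ring⟩
      set H := min |t| (1 / 2) with hH
      have H0 : 0 ≤ H := le_min (abs_nonneg _) (by norm_num)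
      have H1 : H ≤ |t| := min_le_left _ _
      have H2 : H ≤ 1 / 2 := min_le_right _ _
      have ha : |σ * (|t| - H)| = |t| - H := by
        rw [abs_mul, hσ, one_mul, abs_of_nonneg (by linarith)]
      have hn : |t| - H ≤ (n:ℝ) / 2 := by
        rcases min_cases |t| (1 / 2 : ℝ) with ⟨h1, h2⟩ | ⟨h1, h2⟩ <;> rw [hH, h1]
        · simp; positivity
        · linarith
      have := G.step (t1 := σ * (|t| - H)) (L := L + (|t| - H)) (σ := σ) (H := H) (x := x) hξ
        (fun y hy => ih _ (by rw [ha]; exact hn) y (by rw [ha]; exact hy)) hσ H0 H2 (by linarith)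
      have e : σ * (|t| - H) + σ * H = t := by rw [← mul_add, sub_add_cancel]; exact hσt.symm
      rwa [e] at this
  intro t x hx
  obtain ⟨n, hn⟩ := exists_nat_ge (2 * |t|)
  exact key n t (by linarith) x hx

lemma hasDerivAt_int {f f' : ℝ → ℝ → ℝ} {L : ℝ} (hf : Continuous (Function.uncurry f))
    (hf' : Continuous (Function.uncurry f'))
    (hz : ∀ t x, L + 2 * |t| < |x| → f t x = 0 ∧ f' t x = 0)
    (hd : ∀ t x, HasDerivAt (fun t => f t x) (f' t x) t) (t : ℝ) :
    HasDerivAt (fun t => ∫ x, f t x) (∫ x, f' t x) t := by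
  set L' := L + 2 * (|t| + 1) with hL'
  have hcomp : IsCompact (Icc (t - 1) (t + 1) ×ˢ Icc (-L') L') := isCompact_Icc.prod isCompact_Icc
  obtain ⟨C, hC⟩ := hcomp.exists_bound_of_continuousOn hf'.continuousOn
  have hzb : ∀ τ ∈ Metric.ball t 1, ∀ x, x ∉ Icc (-L') L' → f τ x = 0 ∧ f' τ x = 0 := by
    intro τ hτ x hx
    apply hz
    rw [Metric.mem_ball, Real.dist_eq] at hτ
    have h1 := abs_sub_abs_le_abs_sub τ t
    have h2 : L' < |x| := by
      by_contra hcon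
      push Not at hcon
      exact hx (abs_le.mp hcon)
    linarith
  have hmem : t ∈ Metric.ball t 1 := Metric.mem_ball_self one_pos
  have hct : Continuous (f t) := hf.comp (Continuous.prodMk_right t)
  refine (hasDerivAt_integral_of_dominated_loc_of_deriv_le (μ := volume) (F := f) (F' := f')
    (bound := (Icc (-L') L').indicator fun _ => C) (x₀ := t) (s := Metric.ball t 1)
    (Metric.ball_mem_nhds t one_pos) ?_ ?_ ?_ ?_ ?_ ?_).2
  · exact Eventually.of_forall fun τ =>
      (hf.comp (Continuous.prodMk_right τ)).aestronglyMeasurable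
  · exact hct.integrable_of_hasCompactSupport
      (HasCompactSupport.intro isCompact_Icc fun x hx => (hzb t hmem x hx).1)
  · exact (hf'.comp (Continuous.prodMk_right t)).aestronglyMeasurable
  · refine Eventually.of_forall fun x τ hτ => ?_
    by_cases hx : x ∈ Icc (-L') L'
    · rw [indicator_of_mem hx]
      apply hC (τ, x)
      refine ⟨?_, hx⟩
      rw [Metric.mem_ball, Real.dist_eq, abs_lt] at hτ
      constructor <;> linarith [hτ.1, hτ.2]
    · rw [indicator_of_notMem hx, (hzb τ hτ x hx).2, norm_zero]
  · exact (integrable_indicator_iff measurableSet_Icc).mpr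
      (continuous_const.integrableOn_Icc)
  · exact Eventually.of_forall fun x τ _ => hd τ x

theorem energy {r1 s1 r0 s0 : ℝ × ℝ → ℝ} {ξ L N T : ℝ} (hξ0 : 0 ≤ ξ) (hξ1 : ξ ≤ 1)
    (G1 : AllGood r1 s1 ξ) (G0 : AllGood r0 s0 0)
    (hi1 : ∀ x, r1 (0, x) = r0 (0, x) ∧ s1 (0, x) = s0 (0, x))
    (hL : ∀ x, L < |x| → r0 (0, x) = 0 ∧ s0 (0, x) = 0)
    (hN : ∀ t ∈ Icc 0 T, ∫ x, ((r0 (t, x) - s0 (t, x)) / 2) ^ 2 ≤ N) :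
    ∀ t ∈ Icc 0 T, ∫ x, ((r1 (t, x) - r0 (t, x)) ^ 2 + (s1 (t, x) - s0 (t, x)) ^ 2) ≤ ξ * N * t := by
  obtain ⟨cr1, cs1⟩ := G1.cont
  obtain ⟨cr0, cs0⟩ := G0.cont
  have z0 := G0.supp (by simp) hL
  have z1 := G1.supp (by rwa [abs_of_nonneg hξ0])
    (fun x hx => by rw [(hi1 x).1, (hi1 x).2]; exact hL x hx)
  have hsh : ∀ (j t x : ℝ), |j| = 1 → L + 2 * |t| < |x| → L + |t| < |x + j * t| := by
    intro j t x hj h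
    have := abs_sub_abs_le_abs_sub x (-(j * t))
    rw [abs_neg, abs_mul, hj, one_mul, sub_neg_eq_add] at this
    linarith
  have hint : ∀ (g : ℝ × ℝ → ℝ) (t : ℝ), Continuous g → (∀ x, L + |t| < |x| → g (t, x) = 0) →
      Integrable (fun x => g (t, x)) := by
    intro g t hg hz
    apply (hg.comp (Continuous.prodMk_right t)).integrable_of_hasCompactSupport
    apply HasCompactSupport.intro (isCompact_Icc (a := -(L + |t|)) (b := L + |t|))
    intro x hx
    apply hz
    by_contra hcon
    push Not at hcon
    exact hx (abs_le.mp hcon)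
  -- derivative of the first part
  have dR : ∀ t, HasDerivAt (fun t => ∫ x, (r1 (t, x) - r0 (t, x)) ^ 2)
      (∫ x, 2 * (r1 (t, x) - r0 (t, x)) * (-ξ * ((r1 (t, x) - s1 (t, x)) / 2))) t := by
    intro t
    have := hasDerivAt_int (f := fun t x => (r1 (t, x - t) - r0 (t, x - t)) ^ 2)
      (f' := fun t x => 2 * (r1 (t, x - t) - r0 (t, x - t)) *
        (-ξ * ((r1 (t, x - t) - s1 (t, x - t)) / 2))) (L := L)
      (by unfold Function.uncurry; fun_prop) (by unfold Function.uncurry; fun_prop)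
      (by
        intro t x h
        have h' := hsh (-1) t x (by simp) h
        rw [neg_one_mul, ← sub_eq_add_neg] at h'
        simp [z1 t _ h', z0 t _ h'])
      (by
        intro t x
        have h := ((G1.dr t x).sub (G0.dr t x)).pow 2
        exact h.congr_deriv (by simp)) t
    refine (this.congr_of_eventuallyEq (Filter.Eventually.of_forall fun t => ?_)).congr_deriv ?_
    · exact (integral_sub_right_eq_self (fun x => (r1 (t, x) - r0 (t, x)) ^ 2) t).symm
    · exact (integral_sub_right_eq_self (fun x => 2 * (r1 (t, x) - r0 (t, x)) *
        (-ξ * ((r1 (t, x) - s1 (t, x)) / 2))) t)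
  have dS : ∀ t, HasDerivAt (fun t => ∫ x, (s1 (t, x) - s0 (t, x)) ^ 2)
      (∫ x, 2 * (s1 (t, x) - s0 (t, x)) * (ξ * ((r1 (t, x) - s1 (t, x)) / 2))) t := by
    intro t
    have := hasDerivAt_int (f := fun t x => (s1 (t, x + t) - s0 (t, x + t)) ^ 2)
      (f' := fun t x => 2 * (s1 (t, x + t) - s0 (t, x + t)) *
        (ξ * ((r1 (t, x + t) - s1 (t, x + t)) / 2))) (L := L)
      (by unfold Function.uncurry; fun_prop) (by unfold Function.uncurry; fun_prop)
      (by
        intro t x h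
        have h' := hsh 1 t x (by simp) h
        rw [one_mul] at h'
        simp [z1 t _ h', z0 t _ h'])
      (by
        intro t x
        have h := ((G1.ds t x).sub (G0.ds t x)).pow 2
        exact h.congr_deriv (by simp)) t
    refine (this.congr_of_eventuallyEq (Filter.Eventually.of_forall fun t => ?_)).congr_deriv ?_
    · exact (integral_add_right_eq_self (fun x => (s1 (t, x) - s0 (t, x)) ^ 2) t).symm
    · exact (integral_add_right_eq_self (fun x => 2 * (s1 (t, x) - s0 (t, x)) *
        (ξ * ((r1 (t, x) - s1 (t, x)) / 2))) t)
  set E : ℝ → ℝ := fun t => (∫ x, (r1 (t, x) - r0 (t, x)) ^ 2) +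
    ∫ x, (s1 (t, x) - s0 (t, x)) ^ 2 with hE
  have dE := fun t => (dR t).add (dS t)
  have dEle : ∀ t ∈ Icc 0 T,
      (∫ x, 2 * (r1 (t, x) - r0 (t, x)) * (-ξ * ((r1 (t, x) - s1 (t, x)) / 2))) +
      (∫ x, 2 * (s1 (t, x) - s0 (t, x)) * (ξ * ((r1 (t, x) - s1 (t, x)) / 2))) ≤ ξ * N := by
    intro t ht
    have i1 := hint (fun p => 2 * (r1 p - r0 p) * (-ξ * ((r1 p - s1 p) / 2))) t (by fun_prop)
      (fun x h => by simp [z1 t x h, z0 t x h])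
    have i2 := hint (fun p => 2 * (s1 p - s0 p) * (ξ * ((r1 p - s1 p) / 2))) t (by fun_prop)
      (fun x h => by simp [z1 t x h, z0 t x h])
    have i3 := hint (fun p => ξ * ((r0 p - s0 p) / 2) ^ 2) t (by fun_prop)
      (fun x h => by simp [z0 t x h])
    rw [← integral_add i1 i2]
    calc _ ≤ ∫ x, ξ * ((r0 (t, x) - s0 (t, x)) / 2) ^ 2 := by
          apply integral_mono (i1.add i2) i3
          intro x
          simp only [Pi.add_apply]
          have : 0 ≤ ξ * ((r1 (t, x) - s1 (t, x)) - (r0 (t, x) - s0 (t, x)) / 2) ^ 2 := by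
            positivity
          nlinarith
      _ = ξ * ∫ x, ((r0 (t, x) - s0 (t, x)) / 2) ^ 2 := integral_const_mul _ _
      _ ≤ ξ * N := mul_le_mul_of_nonneg_left (hN t ht) hξ0
  intro t ht
  have j1 := hint (fun p => (r1 p - r0 p) ^ 2) t (by fun_prop)
    (fun x h => by simp [z1 t x h, z0 t x h])
  have j2 := hint (fun p => (s1 p - s0 p) ^ 2) t (by fun_prop)
    (fun x h => by simp [z1 t x h, z0 t x h])
  rw [integral_add j1 j2]
  have hE0 : E 0 = 0 := by simp [hE, hi1]
  have := image_le_of_deriv_right_le_deriv_boundary (f := E) (a := 0) (b := T)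
    (B := fun t => ξ * N * t) (B' := fun _ => ξ * N)
    (fun t _ => (dE t).continuousAt.continuousWithinAt)
    (fun t _ => (dE t).hasDerivWithinAt) (by simp [hE0]) (by fun_prop)
    (fun t _ => by
      have : HasDerivAt (fun t => ξ * N * t) (ξ * N) t := by
        simpa using (hasDerivAt_id t).const_mul (ξ * N)
      exact this.hasDerivWithinAt)
    (fun t h => dEle t ⟨h.1, h.2.le⟩) ht
  exact this

theorem allGood_of {u τ ut uy τt τy : ℝ → ℝ → ℝ} {c ξ : ℝ}
    (hut : ∀ t y, HasDerivAt (fun s => u s y) (ut t y) t)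
    (huy : ∀ t y, HasDerivAt (fun z => u t z) (uy t y) y)
    (hτt : ∀ t y, HasDerivAt (fun s => τ s y) (τt t y) t)
    (hτy : ∀ t y, HasDerivAt (fun z => τ t z) (τy t y) y)
    (hpde1 : ∀ t y, ut t y - τy t y = 0)
    (hpde2 : ∀ t y, τt t y - c ^ 2 * uy t y = -ξ * τ t y) :
    AllGood (fun p => c * u p.1 (c * p.2) + τ p.1 (c * p.2))
      (fun p => c * u p.1 (c * p.2) - τ p.1 (c * p.2)) ξ := by
  have dt : ∀ (f ft : ℝ → ℝ → ℝ), (∀ t y, HasDerivAt (fun s => f s y) (ft t y) t) →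
      ∀ p : ℝ × ℝ, HasDerivAt (fun h => f (p.1 + h) (c * p.2)) (ft p.1 (c * p.2)) 0 := by
    intro f ft hf p
    have h2 : HasDerivAt (fun h : ℝ => p.1 + h) 1 0 := (hasDerivAt_id (0:ℝ)).const_add p.1
    have := HasDerivAt.comp_of_eq 0 (hf p.1 (c * p.2)) h2 (by simp)
    rw [mul_one] at this
    exact this
  have dx : ∀ (f fy : ℝ → ℝ → ℝ), (∀ t y, HasDerivAt (fun z => f t z) (fy t y) y) →
      ∀ p : ℝ × ℝ, HasDerivAt (fun h => f p.1 (c * (p.2 + h))) (fy p.1 (c * p.2) * c) 0 := by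
    intro f fy hf p
    have h2 : HasDerivAt (fun h : ℝ => c * (p.2 + h)) c 0 := by
      simpa using ((hasDerivAt_id (0:ℝ)).const_add p.2).const_mul c
    have := HasDerivAt.comp_of_eq 0 (hf p.1 (c * p.2)) h2 (by simp)
    exact this
  exact reg
    (fun p => ((dt u ut hut p).const_mul c).add (dt τ τt hτt p))
    (fun p => ((dx u uy huy p).const_mul c).add (dx τ τy hτy p))
    (fun p => ((dt u ut hut p).const_mul c).sub (dt τ τt hτt p))
    (fun p => ((dx u uy huy p).const_mul c).sub (dx τ τy hτy p))
    (fun p => by linear_combination c * hpde1 p.1 (c * p.2) + hpde2 p.1 (c * p.2))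
    (fun p => by linear_combination c * hpde1 p.1 (c * p.2) - hpde2 p.1 (c * p.2))

/-- Convergence of Maxwell shear waves to elastic shear waves as λ = 1/ξ → ∞:
the damped solution (u_ξ, τ_ξ) differs from the undamped elastic solution (u₀, τ₀)
by at most max(1, 1/G)·ξ·M²·t in L². -/
theorem stmt_10
    (G ξ T : ℝ) (hG : 0 < G) (hξ : ξ ∈ Icc (0 : ℝ) 1) (hT : 0 < T)
    (u₁ τ₁ u₀ τ₀ : ℝ → ℝ → ℝ)            -- (u₁,τ₁) = solution with parameter ξ
    (ut₁ uy₁ τt₁ τy₁ ut₀ uy₀ τt₀ τy₀ : ℝ → ℝ → ℝ)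
    -- C¹ regularity
    (hut₁ : ∀ t y, HasDerivAt (fun s => u₁ s y) (ut₁ t y) t)
    (huy₁ : ∀ t y, HasDerivAt (fun z => u₁ t z) (uy₁ t y) y)
    (hτt₁ : ∀ t y, HasDerivAt (fun s => τ₁ s y) (τt₁ t y) t)
    (hτy₁ : ∀ t y, HasDerivAt (fun z => τ₁ t z) (τy₁ t y) y)
    (hut₀ : ∀ t y, HasDerivAt (fun s => u₀ s y) (ut₀ t y) t)
    (huy₀ : ∀ t y, HasDerivAt (fun z => u₀ t z) (uy₀ t y) y)
    (hτt₀ : ∀ t y, HasDerivAt (fun s => τ₀ s y) (τt₀ t y) t)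
    (hτy₀ : ∀ t y, HasDerivAt (fun z => τ₀ t z) (τy₀ t y) y)
    -- Maxwell system with parameter ξ, and the undamped elastic system (ξ = 0)
    (hpde1₁ : ∀ t y, ut₁ t y - τy₁ t y = 0)
    (hpde2₁ : ∀ t y, τt₁ t y - G * uy₁ t y = -ξ * τ₁ t y)
    (hpde1₀ : ∀ t y, ut₀ t y - τy₀ t y = 0)
    (hpde2₀ : ∀ t y, τt₀ t y - G * uy₀ t y = 0)
    -- common compactly supported smooth initial data (u⁰, τ⁰)
    (u0 τ0 : ℝ → ℝ) (hu0 : ContDiff ℝ (⊤ : ℕ∞) u0) (hτ0 : ContDiff ℝ (⊤ : ℕ∞) τ0)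
    (hu0supp : HasCompactSupport u0) (hτ0supp : HasCompactSupport τ0)
    (hinit₁ : ∀ y, u₁ 0 y = u0 y ∧ τ₁ 0 y = τ0 y)
    (hinit₀ : ∀ y, u₀ 0 y = u0 y ∧ τ₀ 0 y = τ0 y)
    -- compact support in space for all times (finite propagation speed)
    (hsupp : ∀ t, HasCompactSupport (u₁ t) ∧ HasCompactSupport (τ₁ t) ∧
                  HasCompactSupport (u₀ t) ∧ HasCompactSupport (τ₀ t))
    -- uniform L² bound on the elastic stress
    (M : ℝ) (hM : ∀ t ∈ Icc 0 T, sqrt (∫ y, (τ₀ t y) ^ 2) ≤ M) :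
    ∀ t ∈ Icc 0 T,
      (∫ y, (u₁ t y - u₀ t y) ^ 2) + (∫ y, (τ₁ t y - τ₀ t y) ^ 2)
        ≤ max 1 (1 / G) * ξ * M ^ 2 * t := by
  classical
  obtain ⟨hξ0, hξ1⟩ := hξ
  set c := sqrt G with hcdef
  have hc : 0 < c := Real.sqrt_pos.mpr hG
  have hcG : c ^ 2 = G := Real.sq_sqrt hG.le
  have A1 := allGood_of (c := c) (ξ := ξ) hut₁ huy₁ hτt₁ hτy₁ hpde1₁ (by rw [hcG]; exact hpde2₁)
  have A0 := allGood_of (c := c) (ξ := 0) hut₀ huy₀ hτt₀ hτy₀ hpde1₀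
    (by intro t y; rw [hcG, hpde2₀ t y]; ring)
  obtain ⟨L, hL⟩ : ∃ L : ℝ, ∀ y, L < |y| → u0 y = 0 ∧ τ0 y = 0 := by
    obtain ⟨L, h⟩ := (hu0supp.isCompact.union hτ0supp.isCompact).isBounded.subset_closedBall 0
    refine ⟨L, fun y hy => ?_⟩
    have : y ∉ tsupport u0 ∪ tsupport τ0 := by
      intro hm
      have := h hm
      rw [mem_closedBall_zero_iff, Real.norm_eq_abs] at this
      linarith
    rw [mem_union, not_or] at this
    exact ⟨image_eq_zero_of_notMem_tsupport this.1, image_eq_zero_of_notMem_tsupport this.2⟩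
  have hscale : ∀ g : ℝ → ℝ, ∫ x, g (c * x) = c⁻¹ * ∫ y, g y := by
    intro g
    rw [Measure.integral_comp_mul_left, abs_of_pos (inv_pos.mpr hc), smul_eq_mul]
  have E := energy (L := L / c) (N := c⁻¹ * M ^ 2) (T := T) hξ0 hξ1 A1 A0
    (by
      intro x
      simp only [(hinit₁ (c * x)).1, (hinit₁ (c * x)).2, (hinit₀ (c * x)).1, (hinit₀ (c * x)).2,
        and_self])
    (by
      intro x hx
      have : L < |c * x| := by
        rw [abs_mul, abs_of_pos hc]
        rwa [div_lt_iff₀' hc] at hx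
      obtain ⟨a, b⟩ := hL _ this
      simp only [(hinit₀ (c * x)).1, (hinit₀ (c * x)).2, a, b]
      simp)
    (by
      intro t ht
      have e : ∀ x, ((c * u₀ t (c * x) + τ₀ t (c * x) - (c * u₀ t (c * x) - τ₀ t (c * x))) / 2) ^ 2
          = (fun y => (τ₀ t y) ^ 2) (c * x) := by intro x; ring
      simp only [e]
      rw [hscale (fun y => (τ₀ t y) ^ 2)]
      apply mul_le_mul_of_nonneg_left _ (inv_pos.mpr hc).le
      exact (Real.sqrt_le_iff.mp (hM t ht)).2)
  intro t ht
  have Et := E t ht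
  obtain ⟨s1, s2, s3, s4⟩ := hsupp t
  have cu₁ : Continuous (u₁ t) := continuous_iff_continuousAt.mpr fun y => (huy₁ t y).continuousAt
  have cτ₁ : Continuous (τ₁ t) := continuous_iff_continuousAt.mpr fun y => (hτy₁ t y).continuousAt
  have cu₀ : Continuous (u₀ t) := continuous_iff_continuousAt.mpr fun y => (huy₀ t y).continuousAt
  have cτ₀ : Continuous (τ₀ t) := continuous_iff_continuousAt.mpr fun y => (hτy₀ t y).continuousAt
  have hI : ∀ f g : ℝ → ℝ, Continuous f → Continuous g → HasCompactSupport f →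
      HasCompactSupport g → Integrable (fun y => (f y - g y) ^ 2) := by
    intro f g cf cg sf sg
    apply Continuous.integrable_of_hasCompactSupport (by fun_prop)
    exact (sf.sub sg).comp_left (g := fun z : ℝ => z ^ 2) (by simp)
  have I1 := hI _ _ cu₁ cu₀ s1 s3
  have I2 := hI _ _ cτ₁ cτ₀ s2 s4
  have e : ∀ x, (c * u₁ t (c * x) + τ₁ t (c * x) - (c * u₀ t (c * x) + τ₀ t (c * x))) ^ 2
      + (c * u₁ t (c * x) - τ₁ t (c * x) - (c * u₀ t (c * x) - τ₀ t (c * x))) ^ 2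
      = (fun y => 2 * G * (u₁ t y - u₀ t y) ^ 2 + 2 * (τ₁ t y - τ₀ t y) ^ 2) (c * x) := by
    intro x; simp only; rw [← hcG]; ring
  simp only [e] at Et
  rw [hscale (fun y => 2 * G * (u₁ t y - u₀ t y) ^ 2 + 2 * (τ₁ t y - τ₀ t y) ^ 2),
    integral_add (I1.const_mul (2 * G)) (I2.const_mul 2), integral_const_mul,
    integral_const_mul] at Et
  have W0 : 0 ≤ ∫ y, (u₁ t y - u₀ t y) ^ 2 := integral_nonneg fun y => sq_nonneg _
  have S0 : 0 ≤ ∫ y, (τ₁ t y - τ₀ t y) ^ 2 := integral_nonneg fun y => sq_nonneg _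
  set W := ∫ y, (u₁ t y - u₀ t y) ^ 2
  set S := ∫ y, (τ₁ t y - τ₀ t y) ^ 2
  have Et2 : 2 * G * W + 2 * S ≤ ξ * M ^ 2 * t := by
    have h := mul_le_mul_of_nonneg_left Et hc.le
    have e1 : c * (c⁻¹ * (2 * G * W + 2 * S)) = 2 * G * W + 2 * S := by field_simp
    have e2 : c * (ξ * (c⁻¹ * M ^ 2) * t) = ξ * M ^ 2 * t := by field_simp
    rwa [e1, e2] at h
  have m1 : 1 ≤ max 1 (1 / G) := le_max_left _ _
  have m2 : 1 ≤ max 1 (1 / G) * G := by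
    have := le_max_right 1 (1 / G)
    calc (1:ℝ) = 1 / G * G := by field_simp
      _ ≤ _ := mul_le_mul_of_nonneg_right this hG.le
  set m := max 1 (1 / G)
  have h1 : W ≤ m * G * W := by nlinarith
  have h2 : S ≤ m * S := by nlinarith
  have h3 : m * (2 * G * W + 2 * S) ≤ m * (ξ * M ^ 2 * t) :=
    mul_le_mul_of_nonneg_left Et2 (by linarith)
  linarith
end
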